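/- Let G be an unmixed simple graph that is either a cactus graph, a bipartite graph, or a chordal graph. Then the following are equivalent: (1) R/I(G) is Cohen–Macaulay; (2) G is vertex decomposable; (3) J(G) is weakly polymatroidal in some ordering of the variables; (4) J(G)^s is weakly polymatroidal in some ordering of the variables for all s ≥ 1. -/

import Mathlib

/-!
STATEMENT 10: Let `G` be an unmixed simple graph which is a cactus graph, a bipartite
graph, or a chordal graph.  Then the following are equivalent:
(1) `R/I(G)` is Cohen–Macaulay;
(2) `G` is vertex decomposable (i.e. its independence complex is vertex decomposable);
(3) `J(G)` is weakly polymatroidal in some ordering of the variables;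
(4) `J(G)^s` is weakly polymatroidal in some ordering of the variables for all `s ≥ 1`.
-/

open MvPolynomial

namespace Stmt

variable (K : Type) [Field K]

/-- `F` is a vertex cover of the graph `G`. -/
def IsVertexCover {V : Type} (G : SimpleGraph V) (F : Finset V) : Prop :=
  ∀ v w, G.Adj v w → v ∈ F ∨ w ∈ F

/-- `F` is a minimal vertex cover of the graph `G`. -/
def IsMinimalVertexCover {V : Type} (G : SimpleGraph V) (F : Finset V) : Prop :=
  IsVertexCover G F ∧ ∀ F' ⊆ F, IsVertexCover G F' → F' = F

/-- The vertex cover ideal `J(G)`, generated by the monomials `∏_{v ∈ F} x_v`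
with `F` a minimal vertex cover of `G`. -/
noncomputable def coverIdeal {V : Type} (G : SimpleGraph V) : Ideal (MvPolynomial V K) :=
  Ideal.span { m | ∃ F : Finset V, IsMinimalVertexCover G F ∧ m = ∏ v ∈ F, X v }

/-- The `s`-th symbolic power `J(G)^{(s)} = ⋂_{{v,w} ∈ E(G)} (x_v, x_w)^s`. -/
noncomputable def symbolicCoverPower {V : Type} (G : SimpleGraph V) (s : ℕ) :
    Ideal (MvPolynomial V K) :=
  ⨅ (v : V) (w : V) (_ : G.Adj v w), (Ideal.span {X v, X w} : Ideal (MvPolynomial V K)) ^ s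

/-- `a` is the exponent vector of an element of the minimal monomial generating set `G(I)`
of the monomial ideal `I`: the monomial `x^a` lies in `I` and no proper monomial divisor
of it lies in `I`. -/
def IsMonoMinGen {τ : Type} (I : Ideal (MvPolynomial τ K)) (a : τ →₀ ℕ) : Prop :=
  (monomial a (1 : K)) ∈ I ∧
    ∀ b : τ →₀ ℕ, (monomial b (1 : K)) ∈ I → b ≤ a → b = a

/-- A monomial ideal `I` (not necessarily generated in one degree) is weakly polymatroidal
with respect to a strict order `lt` on the variables (where `lt p q` means that the
variable `x_p` precedes, i.e. is greater than, the variable `x_q`):  for all exponent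
vectors `a b` of minimal monomial generators `u = x^a`, `v = x^b` of `I`, if `a` and `b`
agree on all variables preceding `q` and `a q < b q`, then there is a variable `p`
coming after `q` such that `x_q · u / x_p` is again a minimal monomial generator. -/
def WeaklyPolymatroidalWrt {τ : Type} [DecidableEq τ] (lt : τ → τ → Prop)
    (I : Ideal (MvPolynomial τ K)) : Prop :=
  ∀ a b : τ →₀ ℕ, IsMonoMinGen K I a → IsMonoMinGen K I b →
    ∀ q : τ, (∀ p, lt p q → a p = b p) → a q < b q →
      ∃ p, lt q p ∧ 0 < a p ∧
        IsMonoMinGen K I (a + Finsupp.single q 1 - Finsupp.single p 1)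

/-- The collection `Δ` of finite subsets of `V` is (the set of faces of) a simplicial
complex: it is closed under passing to subsets. -/
def IsSimplicialComplex {V : Type} (Δ : Finset V → Prop) : Prop :=
  ∀ F G : Finset V, Δ F → G ⊆ F → Δ G

/-- `F` is a facet (maximal face) of `Δ`. -/
def IsFacet {V : Type} (Δ : Finset V → Prop) (F : Finset V) : Prop :=
  Δ F ∧ ∀ G, Δ G → F ⊆ G → F = G

/-- The link of the vertex `x` in `Δ`. -/
def cplxLink {V : Type} [DecidableEq V] (Δ : Finset V → Prop) (x : V) :
    Finset V → Prop :=
  fun F => x ∉ F ∧ Δ (insert x F)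

/-- The deletion of the vertex `x` from `Δ`. -/
def cplxDel {V : Type} (Δ : Finset V → Prop) (x : V) : Finset V → Prop :=
  fun F => x ∉ F ∧ Δ F

/-- Vertex decomposability of a simplicial complex: either `Δ` is a simplex, or it has a
shedding vertex `x` whose link and deletion are both vertex decomposable. -/
inductive VertexDecomposable {V : Type} [DecidableEq V] : (Finset V → Prop) → Prop
  | simplex (Δ : Finset V → Prop) (F : Finset V) (h : ∀ G, Δ G ↔ G ⊆ F) :
      VertexDecomposable Δ
  | shed (Δ : Finset V → Prop) (x : V) (hx : Δ {x})
      (hlink : VertexDecomposable (cplxLink Δ x))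
      (hdel : VertexDecomposable (cplxDel Δ x))
      (hshed : ∀ F, IsFacet (cplxLink Δ x) F → ¬ IsFacet (cplxDel Δ x) F) :
      VertexDecomposable Δ

/-- The Alexander dual ideal of `Δ`, with `Δ` regarded as a complex on the vertex set `W`:
it is generated by the monomials `∏_{v ∈ W \ F} x_v` with `F` a facet of `Δ`. -/
noncomputable def dualIdealIn {V : Type} [DecidableEq V] (W : Finset V)
    (Δ : Finset V → Prop) : Ideal (MvPolynomial V K) :=
  Ideal.span { m | ∃ F, IsFacet Δ F ∧ m = ∏ v ∈ W \ F, X v }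

/-- The Alexander dual ideal `I_Δ^∨` of the Stanley–Reisner ideal of `Δ`. -/
noncomputable def dualIdeal {V : Type} [Fintype V] [DecidableEq V]
    (Δ : Finset V → Prop) : Ideal (MvPolynomial V K) :=
  dualIdealIn K Finset.univ Δ

/-- `G` is unmixed: all minimal vertex covers have the same cardinality. -/
def IsUnmixed {V : Type} (G : SimpleGraph V) : Prop :=
  ∀ F F' : Finset V, IsMinimalVertexCover G F → IsMinimalVertexCover G F' →
    F.card = F'.card

/-- A subgraph of `G` which is a cycle: it is connected and every one of its vertices has
exactly two neighbours in it. -/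
def IsCycleSubgraph {V : Type} (G : SimpleGraph V) (H : G.Subgraph) : Prop :=
  H.Connected ∧ ∀ v ∈ H.verts, (H.neighborSet v).ncard = 2

/-- `G` is a cactus graph: every edge of `G` belongs to at most one cycle. -/
def IsCactus {V : Type} (G : SimpleGraph V) : Prop :=
  ∀ C₁ C₂ : G.Subgraph, IsCycleSubgraph G C₁ → IsCycleSubgraph G C₂ →
    ∀ e ∈ C₁.edgeSet, e ∈ C₂.edgeSet → C₁ = C₂

/-- `G` is chordal: every cycle of length at least 4 has a chord. -/
def IsChordal {V : Type} (G : SimpleGraph V) : Prop :=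
  ∀ (v : V) (c : G.Walk v v), c.IsCycle → 4 ≤ c.length →
    ∃ a b, a ∈ c.support ∧ b ∈ c.support ∧ G.Adj a b ∧ s(a, b) ∉ c.edges

/-- The independence complex of `G`: faces are the independent sets of `G`. -/
def indepCpx {V : Type} (G : SimpleGraph V) : Finset V → Prop :=
  fun F => ∀ v ∈ F, ∀ w ∈ F, ¬ G.Adj v w

/-- The edge ideal `I(G)`, generated by the monomials `x_v x_w` over edges `{v,w}`. -/
noncomputable def edgeIdeal {V : Type} (G : SimpleGraph V) : Ideal (MvPolynomial V K) :=
  Ideal.span { m | ∃ v w, G.Adj v w ∧ m = X v * X w }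

/-- `R ⧸ I` is a Cohen–Macaulay ring, expressed (for a graded quotient of a polynomial
ring) by the existence of a regular sequence inside the graded maximal ideal
`m = (x_v : v)` whose length equals the Krull dimension of `R ⧸ I`
(i.e. `depth_m (R ⧸ I) = dim (R ⧸ I)`). -/
def IsCohenMacaulayQuot {τ : Type} (I : Ideal (MvPolynomial τ K)) : Prop :=
  ∃ rs : List (MvPolynomial τ K),
    (∀ r ∈ rs, r ∈ Ideal.span (Set.range (X : τ → MvPolynomial τ K))) ∧
    RingTheory.Sequence.IsRegular (MvPolynomial τ K ⧸ I) rs ∧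
    ((rs.length : WithTop ℕ) : WithBot (WithTop ℕ)) = ringKrullDim (MvPolynomial τ K ⧸ I)

section Facets

variable {V : Type} [Fintype V] [DecidableEq V]

/-- Every facet of the complex has exactly `d` vertices. -/
def IsPureOfCard (Δ : Finset V → Prop) (d : ℕ) : Prop :=
  ∀ F, IsFacet Δ F → F.card = d

omit [DecidableEq V] in
lemma exists_isFacet_superset (Δ : Finset V → Prop) {F : Finset V} (hF : Δ F) :
    ∃ F', F ⊆ F' ∧ IsFacet Δ F' := by
  obtain ⟨F', h, hm⟩ := Finite.exists_le_maximal (p := Δ) hF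
  exact ⟨F', h, hm.1, fun G hG hFG => hm.eq_of_le hG hFG⟩

omit [DecidableEq V] in
lemma IsPureOfCard.card_le {Δ : Finset V → Prop} {d : ℕ} (hd : IsPureOfCard Δ d)
    {F : Finset V} (hF : Δ F) : F.card ≤ d := by
  obtain ⟨F', h, hm⟩ := exists_isFacet_superset Δ hF
  exact (Finset.card_le_card h).trans (hd _ hm).le

omit [DecidableEq V] in
lemma IsPureOfCard.isFacet_iff {Δ : Finset V → Prop} {d : ℕ} (hd : IsPureOfCard Δ d)
    {F : Finset V} : IsFacet Δ F ↔ Δ F ∧ F.card = d := by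
  refine ⟨fun h => ⟨h.1, hd _ h⟩, fun h => ⟨h.1, fun F' hF' hs => ?_⟩⟩
  exact Finset.eq_of_subset_of_card_le hs ((hd.card_le hF').trans h.2.ge)

omit [Fintype V] [DecidableEq V] in
lemma indepCpx_isSimplicialComplex (G : SimpleGraph V) : IsSimplicialComplex (indepCpx G) :=
  fun _ _ hF h v hv w hw => hF v (h hv) w (h hw)

lemma isVertexCover_compl_iff (G : SimpleGraph V) (F : Finset V) :
    IsVertexCover G Fᶜ ↔ indepCpx G F := by
  simp only [IsVertexCover, indepCpx, Finset.mem_compl]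
  constructor
  · intro h v hv w hw hvw
    rcases h v w hvw with h | h <;> contradiction
  · intro h v w hvw
    by_contra hc
    push Not at hc
    exact h v hc.1 w hc.2 hvw

lemma isMinimalVertexCover_compl_iff (G : SimpleGraph V) (F : Finset V) :
    IsMinimalVertexCover G Fᶜ ↔ IsFacet (indepCpx G) F := by
  unfold IsMinimalVertexCover IsFacet
  rw [isVertexCover_compl_iff]
  refine and_congr_right fun _ => ⟨fun h F' hF' hs => ?_, fun h F' hs hF' => ?_⟩
  · have := h F'ᶜ (Finset.compl_subset_compl.2 hs) ((isVertexCover_compl_iff G F').2 hF')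
    exact (compl_injective this).symm
  · have := h F'ᶜ ((isVertexCover_compl_iff G _).1 (by simpa using hF'))
      (by rw [Finset.subset_compl_comm]; exact hs)
    rw [this, compl_compl]

lemma IsUnmixed.exists_isPureOfCard {G : SimpleGraph V} (h : IsUnmixed G) :
    ∃ d, IsPureOfCard (indepCpx G) d := by
  obtain ⟨F₀, -, h₀⟩ := exists_isFacet_superset (indepCpx G) (F := ∅) (by simp [indepCpx])
  refine ⟨F₀.card, fun F hF => ?_⟩
  have := h Fᶜ F₀ᶜ ((isMinimalVertexCover_compl_iff G F).2 hF)
    ((isMinimalVertexCover_compl_iff G F₀).2 h₀)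
  rw [Finset.card_compl, Finset.card_compl] at this
  have h1 := Finset.card_le_univ F
  have h2 := Finset.card_le_univ F₀
  omega

end Facets

section WeaklyRegular

open scoped Pointwise

variable {S : Type} [CommRing S]

/-- The sequence is weakly regular on `S ⧸ I`, phrased through membership in ideals. -/
def WeaklyRegularMod : Ideal S → List S → Prop
  | _, [] => True
  | I, r :: rs => (∀ p, r * p ∈ I → p ∈ I) ∧ WeaklyRegularMod (I ⊔ Ideal.span {r}) rs

lemma isWeaklyRegular_quotient_iff (I : Ideal S) (rs : List S) :
    RingTheory.Sequence.IsWeaklyRegular (S ⧸ I) rs ↔ WeaklyRegularMod I rs := by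
  induction rs generalizing I with
  | nil => simp [WeaklyRegularMod]
  | cons r rs ih =>
    rw [RingTheory.Sequence.isWeaklyRegular_cons_iff, WeaklyRegularMod, ← ih]
    refine and_congr ?_ ?_
    · exact isSMulRegular_quotient_iff_mem_of_smul_mem I r
    · have h : (r • ⊤ : Submodule S (S ⧸ I)) =
          (I ⊔ Ideal.span {r} : Submodule S S).map I.mkQ := by
        ext x
        obtain ⟨y, rfl⟩ := I.mkQ_surjective x
        simp only [Submodule.mem_map, Submodule.mem_smul_pointwise_iff_exists]
        constructor
        · rintro ⟨z, -, hz⟩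
          obtain ⟨w, rfl⟩ := I.mkQ_surjective z
          exact ⟨r * w, Submodule.mem_sup_right
            (Ideal.mul_mem_right _ _ (Ideal.mem_span_singleton_self r)), hz⟩
        · rintro ⟨z, hz, hzy⟩
          obtain ⟨a, ha, b, hb, rfl⟩ := Submodule.mem_sup.1 hz
          obtain ⟨c, rfl⟩ := Ideal.mem_span_singleton'.1 hb
          refine ⟨I.mkQ c, trivial, ?_⟩
          rw [← hzy, map_add, show I.mkQ a = 0 from (Submodule.Quotient.mk_eq_zero I).2 ha,
            zero_add, ← map_smul, smul_eq_mul, mul_comm]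
      exact LinearEquiv.isWeaklyRegular_congr
        ((Submodule.quotEquivOfEq _ _ h).trans
          (Submodule.quotientQuotientEquivQuotient I _ le_sup_left)) rs

lemma WeaklyRegularMod.of_colon_of_sup {I J : Ideal S} {x : S}
    (hJ : ∀ p, p ∈ J ↔ x * p ∈ I) {rs : List S} (h₁ : WeaklyRegularMod J rs)
    (h₂ : WeaklyRegularMod (I ⊔ Ideal.span {x}) rs) : WeaklyRegularMod I rs := by
  induction rs generalizing I J with
  | nil => trivial
  | cons r rs ih =>
    have key : ∀ p, r * p ∈ I ⊔ Ideal.span {x} → ∃ i ∈ I, ∃ t, p = i + t * x := by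
      intro p hp
      obtain ⟨a, ha, b, hb, hab⟩ := Submodule.mem_sup.1 (h₂.1 p hp)
      obtain ⟨c, rfl⟩ := Ideal.mem_span_singleton'.1 hb
      exact ⟨a, ha, c, hab.symm⟩
    refine ⟨fun p hp => ?_, ih (J := J ⊔ Ideal.span {r}) (fun p => ?_) h₁.2 ?_⟩
    · obtain ⟨i, hi, t, rfl⟩ := key p (Submodule.mem_sup_left hp)
      have h3 : x * (r * t) ∈ I := by
        have := I.sub_mem hp (I.mul_mem_left r hi)
        convert this using 1
        ring
      have := (hJ t).1 (h₁.1 t ((hJ _).2 h3))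
      exact I.add_mem hi (by rwa [mul_comm])
    · constructor
      · intro hp
        obtain ⟨a, ha, b, hb, rfl⟩ := Submodule.mem_sup.1 hp
        rw [mul_add]
        exact Ideal.add_mem _ (Submodule.mem_sup_left ((hJ a).1 ha))
          (Submodule.mem_sup_right (Ideal.mul_mem_left _ _ hb))
      · intro hp
        obtain ⟨a, ha, b, hb, hab⟩ := Submodule.mem_sup.1 hp
        obtain ⟨s, rfl⟩ := Ideal.mem_span_singleton'.1 hb
        have : r * s ∈ I ⊔ Ideal.span {x} := by
          have e : r * s = -a + p * x := by linear_combination hab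
          rw [e]
          exact Ideal.add_mem _ (Submodule.mem_sup_left (I.neg_mem ha))
            (Submodule.mem_sup_right (Ideal.mul_mem_left _ _ (Ideal.mem_span_singleton_self x)))
        obtain ⟨i, hi, t, rfl⟩ := key s this
        have h3 : p - t * r ∈ J := by
          rw [hJ]
          have e : x * (p - t * r) = a + i * r := by linear_combination -hab
          rw [e]
          exact I.add_mem ha (I.mul_mem_right _ hi)
        have : p = (p - t * r) + t * r := by ring
        rw [this]
        exact Ideal.add_mem _ (Submodule.mem_sup_left h3)
            (Submodule.mem_sup_right (Ideal.mul_mem_left _ _ (Ideal.mem_span_singleton_self r)))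
    · have := h₂.2
      rwa [sup_right_comm] at this

end WeaklyRegular

section StanleyReisner

variable (K : Type) [Field K] {V : Type}

/-- The exponent vector of the squarefree monomial `∏_{v ∈ t} x_v`. -/
noncomputable def sqfreeExp (t : Finset V) : V →₀ ℕ := ∑ i ∈ t, Finsupp.single i 1

lemma prod_X_eq_monomial (t : Finset V) :
    (∏ i ∈ t, X i : MvPolynomial V K) = monomial (sqfreeExp t) 1 := by
  rw [sqfreeExp, monomial_sum_one]
  rfl

lemma sqfreeExp_apply [DecidableEq V] (t : Finset V) (j : V) :
    sqfreeExp t j = if j ∈ t then 1 else 0 := by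
  simp [sqfreeExp, Finsupp.finsetSum_apply, Finsupp.single_apply]

lemma support_sqfreeExp (t : Finset V) : (sqfreeExp t).support = t := by
  classical
  ext j
  simp [sqfreeExp_apply]

/-- The Stanley–Reisner ideal: it is spanned by the monomials whose support is not a face. -/
noncomputable def srIdeal (Δ : Finset V → Prop) : Ideal (MvPolynomial V K) :=
  Ideal.span ((fun a => monomial a (1 : K)) '' {a | ¬ Δ a.support})

variable {K}

lemma mem_srIdeal {Δ : Finset V → Prop} (hΔ : IsSimplicialComplex Δ) {p : MvPolynomial V K} :
    p ∈ srIdeal K Δ ↔ ∀ a ∈ p.support, ¬ Δ a.support := by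
  rw [srIdeal, mem_ideal_span_monomial_image]
  refine forall₂_congr fun a _ => ⟨?_, fun h => ⟨a, h, le_rfl⟩⟩
  rintro ⟨b, hb, hba⟩ ha
  exact hb (hΔ _ _ ha (Finsupp.support_mono hba))

lemma monomial_mem_srIdeal {Δ : Finset V → Prop} {a : V →₀ ℕ} (ha : ¬ Δ a.support) (c : K) :
    monomial a c ∈ srIdeal K Δ := by
  have : monomial a c = C c * monomial a 1 := by simp [C_mul_monomial]
  rw [this]
  exact Ideal.mul_mem_left _ _ (Ideal.subset_span ⟨a, ha, rfl⟩)

lemma prod_X_mem_srIdeal {Δ : Finset V → Prop} {t : Finset V} (ht : ¬ Δ t) :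
    ∏ i ∈ t, X i ∈ srIdeal K Δ := by
  rw [prod_X_eq_monomial]
  exact monomial_mem_srIdeal (by rwa [support_sqfreeExp]) 1

lemma X_mul_mem_srIdeal_iff [DecidableEq V] {Δ : Finset V → Prop} (hΔ : IsSimplicialComplex Δ)
    (x : V) (p : MvPolynomial V K) :
    p ∈ srIdeal K (fun F => Δ (insert x F)) ↔ X x * p ∈ srIdeal K Δ := by
  have h : IsSimplicialComplex (fun F => Δ (insert x F)) :=
    fun F G hF hG => hΔ _ _ hF (Finset.insert_subset_insert _ hG)
  rw [mem_srIdeal hΔ, mem_srIdeal h, support_X_mul]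
  simp only [Finset.mem_map, forall_exists_index, and_imp, addLeftEmbedding_apply]
  have e : ∀ a : V →₀ ℕ, (Finsupp.single x 1 + a).support = insert x a.support := by
    intro a
    ext j
    by_cases hj : j = x
    · simp [hj]
    · simp [hj]
  constructor
  · rintro h a b hb rfl
    rw [e]
    exact h b hb
  · intro h a ha
    rw [← e]
    exact h _ a ha rfl

lemma srIdeal_sup_prod (Δ : Finset V → Prop) (B : Finset V) :
    srIdeal K Δ ⊔ Ideal.span {∏ i ∈ B, X i} = srIdeal K (fun F => Δ F ∧ ¬ B ⊆ F) := by
  classical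
  apply le_antisymm
  · refine sup_le (Ideal.span_mono (Set.image_mono fun a ha h => ha h.1)) ?_
    rw [Ideal.span_singleton_le_iff_mem]
    exact prod_X_mem_srIdeal (by simp)
  · refine Ideal.span_le.2 ?_
    rintro _ ⟨a, ha, rfl⟩
    by_cases h : Δ a.support
    · have hB : B ⊆ a.support := by
        by_contra hB
        exact ha ⟨h, hB⟩
      refine Submodule.mem_sup_right (Ideal.mem_span_singleton.2 ?_)
      rw [prod_X_eq_monomial]
      refine monomial_dvd_monomial.2 ⟨Or.inr fun j => ?_, one_dvd _⟩
      rw [sqfreeExp_apply]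
      split_ifs with hj
      · exact Nat.one_le_iff_ne_zero.2 (Finsupp.mem_support_iff.1 (hB hj))
      · exact Nat.zero_le _
    · exact Submodule.mem_sup_left (monomial_mem_srIdeal h 1)

lemma srIdeal_indepCpx (G : SimpleGraph V) : srIdeal K (indepCpx G) = edgeIdeal K G := by
  classical
  apply le_antisymm
  · refine Ideal.span_le.2 ?_
    rintro _ ⟨a, ha, rfl⟩
    simp only [indepCpx, Set.mem_ofPred_eq] at ha
    push Not at ha
    obtain ⟨v, hv, w, hw, hvw⟩ := ha
    have hs : (X v * X w : MvPolynomial V K) ∈ edgeIdeal K G :=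
      Ideal.subset_span ⟨v, w, hvw, rfl⟩
    refine Ideal.mem_of_dvd _ ?_ hs
    have : (X v * X w : MvPolynomial V K) =
        monomial (Finsupp.single v 1 + Finsupp.single w 1) 1 := by
      rw [X, X, monomial_mul, one_mul]
    rw [this]
    refine monomial_dvd_monomial.2 ⟨Or.inr fun j => ?_, one_dvd _⟩
    have := hvw.ne
    rw [Finsupp.mem_support_iff] at hv hw
    rw [Finsupp.add_apply, Finsupp.single_apply, Finsupp.single_apply]
    split_ifs with h1 h2 h2
    · subst h1; subst h2; exact absurd rfl this
    · subst h1; omega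
    · subst h2; omega
    · omega
  · refine Ideal.span_le.2 ?_
    rintro _ ⟨v, w, hvw, rfl⟩
    have : (X v * X w : MvPolynomial V K) = ∏ i ∈ {v, w}, X i := by
      rw [Finset.prod_pair hvw.ne]
    rw [this]
    exact prod_X_mem_srIdeal fun h => h v (by simp) w (by simp) hvw

end StanleyReisner

section Esymm

variable (K : Type) [Field K] (V : Type) [Fintype V]

/-- The elementary symmetric polynomials of degrees `d, d - 1, …, 1`. -/
noncomputable def esymmList : ℕ → List (MvPolynomial V K)
  | 0 => []
  | d + 1 => esymm V K (d + 1) :: esymmList d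

variable {K V}

lemma weaklyRegularMod_top {S : Type} [CommRing S] (rs : List S) : WeaklyRegularMod ⊤ rs := by
  induction rs with
  | nil => trivial
  | cons r rs ih => exact ⟨fun _ _ => trivial, by simpa using ih⟩

variable [DecidableEq V]

omit [Fintype V] [DecidableEq V] in
lemma isSimplicialComplex_simplex (F : Finset V) : IsSimplicialComplex (fun G => G ⊆ F) :=
  fun _ _ h h' => h'.trans h

lemma esymm_sub_prod_mem {F : Finset V} {d : ℕ} (hF : F.card = d) :
    esymm V K d - ∏ i ∈ F, X i ∈ srIdeal K (fun G => G ⊆ F) := by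
  rw [esymm, ← Finset.sum_erase_add (a := F) _ _ (by simp [hF]), add_sub_cancel_right]
  refine Ideal.sum_mem _ fun t ht => prod_X_mem_srIdeal fun h => ?_
  simp only [Finset.mem_erase, Finset.mem_powersetCard] at ht
  exact ht.1 (Finset.eq_of_subset_of_card_le h (by omega))

omit [Fintype V] in
lemma prod_X_mul_mem_srIdeal_simplex {F B : Finset V} (hB : B ⊆ F) {p : MvPolynomial V K}
    (hp : (∏ i ∈ B, X i) * p ∈ srIdeal K (fun G => G ⊆ F)) :
    p ∈ srIdeal K (fun G => G ⊆ F) := by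
  induction B using Finset.induction_on with
  | empty => simpa using hp
  | insert x B hx ih =>
    rw [Finset.prod_insert hx, mul_assoc,
      ← X_mul_mem_srIdeal_iff (isSimplicialComplex_simplex F)] at hp
    have hxF := hB (Finset.mem_insert_self x B)
    simp only [Finset.insert_subset_iff, hxF, true_and] at hp
    exact ih (fun _ h => hB (Finset.mem_insert_of_mem h)) hp

lemma weaklyRegularMod_simplex (d : ℕ) (F : Finset V) (hF : F.card = d) :
    WeaklyRegularMod (srIdeal K (fun G => G ⊆ F)) (esymmList K V d) := by
  induction d generalizing F with
  | zero => trivial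
  | succ d ih =>
    have hs := esymm_sub_prod_mem (K := K) hF
    refine ⟨fun p hp => prod_X_mul_mem_srIdeal_simplex subset_rfl ?_, ?_⟩
    · have := Ideal.sub_mem _ hp (Ideal.mul_mem_right p _ hs)
      convert this using 1
      ring
    · have e : srIdeal K (fun G => G ⊆ F) ⊔ Ideal.span {esymm V K (d + 1)} =
          srIdeal K (fun G => G ⊆ F) ⊔ Ideal.span {∏ i ∈ F, X i} := by
        apply le_antisymm <;> refine sup_le le_sup_left ?_ <;>
          rw [Ideal.span_singleton_le_iff_mem]
        · rw [← sub_add_cancel (esymm V K (d + 1)) (∏ i ∈ F, X i)]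
          exact Ideal.add_mem _ (Submodule.mem_sup_left hs)
            (Submodule.mem_sup_right (Ideal.mem_span_singleton_self _))
        · rw [← sub_sub_cancel (esymm V K (d + 1)) (∏ i ∈ F, X i)]
          exact Ideal.sub_mem _ (Submodule.mem_sup_right (Ideal.mem_span_singleton_self _))
            (Submodule.mem_sup_left hs)
      rw [e, srIdeal_sup_prod]
      suffices H : ∀ B ⊆ F, WeaklyRegularMod (srIdeal K (fun G => G ⊆ F ∧ ¬ B ⊆ G))
          (esymmList K V d) from H F subset_rfl
      intro B
      induction B using Finset.induction_on with
      | empty =>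
        intro _
        have : srIdeal K (fun G => G ⊆ F ∧ ¬ ∅ ⊆ G) = ⊤ := by
          rw [Ideal.eq_top_iff_one]
          simpa using prod_X_mem_srIdeal (K := K) (Δ := fun G => G ⊆ F ∧ ¬ ∅ ⊆ G) (t := ∅)
            (by simp)
        rw [this]
        exact weaklyRegularMod_top _
      | insert x B hx ihB =>
        intro hB
        have hxF := hB (Finset.mem_insert_self x B)
        have hΔ : IsSimplicialComplex (fun G => G ⊆ F ∧ ¬ insert x B ⊆ G) :=
          fun _ _ h h' => ⟨h'.trans h.1, fun h'' => h.2 (h''.trans h')⟩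
        have h1 := ihB fun _ h => hB (Finset.mem_insert_of_mem h)
        refine WeaklyRegularMod.of_colon_of_sup (x := X x)
          (fun p => X_mul_mem_srIdeal_iff hΔ x p) ?_ ?_
        · convert h1 using 3 with G
          simp only [Finset.insert_subset_iff, hxF, Finset.mem_insert_self, true_and]
          rw [Finset.subset_insert_iff_of_notMem hx]
        · have := srIdeal_sup_prod (K := K) (fun G => G ⊆ F ∧ ¬ insert x B ⊆ G) {x}
          rw [Finset.prod_singleton] at this
          rw [this]
          convert ih (F.erase x) (by rw [Finset.card_erase_of_mem hxF]; omega) using 3 with G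
          simp only [Finset.singleton_subset_iff, Finset.subset_erase, Finset.insert_subset_iff]
          tauto

omit [Fintype V] in
lemma IsSimplicialComplex.link {Δ : Finset V → Prop} (hΔ : IsSimplicialComplex Δ) (x : V) :
    IsSimplicialComplex (cplxLink Δ x) :=
  fun _ _ h h' => ⟨fun hx => h.1 (h' hx), hΔ _ _ h.2 (Finset.insert_subset_insert _ h')⟩

omit [Fintype V] [DecidableEq V] in
lemma IsSimplicialComplex.del {Δ : Finset V → Prop} (hΔ : IsSimplicialComplex Δ) (x : V) :
    IsSimplicialComplex (cplxDel Δ x) :=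
  fun _ _ h h' => ⟨fun hx => h.1 (h' hx), hΔ _ _ h.2 h'⟩

omit [Fintype V] in
lemma IsPureOfCard.link {Δ : Finset V → Prop} {d : ℕ} (hd : IsPureOfCard Δ (d + 1)) {x : V} :
    IsPureOfCard (cplxLink Δ x) d := by
  intro F hF
  have : IsFacet Δ (insert x F) := by
    refine ⟨hF.1.2, fun G hG hs => ?_⟩
    have hx : x ∈ G := hs (Finset.mem_insert_self _ _)
    have := hF.2 (G.erase x) ⟨Finset.notMem_erase _ _, by rwa [Finset.insert_erase hx]⟩
      (Finset.subset_erase.2 ⟨fun _ h => hs (Finset.mem_insert_of_mem h), hF.1.1⟩)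
    rw [this, Finset.insert_erase hx]
  have := hd _ this
  rw [Finset.card_insert_of_notMem hF.1.1] at this
  omega

omit [Fintype V] in
lemma IsPureOfCard.del {Δ : Finset V → Prop} {d : ℕ} (hd : IsPureOfCard Δ d)
    (hΔ : IsSimplicialComplex Δ) {x : V}
    (hshed : ∀ F, IsFacet (cplxLink Δ x) F → ¬ IsFacet (cplxDel Δ x) F) :
    IsPureOfCard (cplxDel Δ x) d := by
  intro F hF
  refine hd F ⟨hF.1.2, fun H hH hs => ?_⟩
  by_cases hx : x ∈ H
  · refine absurd hF (hshed F ⟨⟨hF.1.1, hΔ _ _ hH (Finset.insert_subset hx hs)⟩,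
      fun G hG hFG => ?_⟩)
    exact hF.2 G ⟨hG.1, hΔ _ _ hG.2 (Finset.subset_insert _ _)⟩ hFG
  · exact hF.2 H ⟨hx, hH⟩ hs

lemma VertexDecomposable.weaklyRegularMod {Δ : Finset V → Prop} (h : VertexDecomposable Δ)
    (hΔ : IsSimplicialComplex Δ) {d : ℕ} (hd : IsPureOfCard Δ d) (W : Finset V)
    (hW : ∀ F, Δ F → Disjoint F W) :
    WeaklyRegularMod (srIdeal K (fun G => Δ (G \ W))) (esymmList K V (d + W.card)) := by
  induction h generalizing d W with
  | simplex Δ F h =>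
    have hF : Δ F := (h F).2 subset_rfl
    have hFd : F.card = d := hd F ⟨hF, fun G hG hs => hs.antisymm ((h G).1 hG)⟩
    have := weaklyRegularMod_simplex (K := K) (d + W.card) (W ∪ F)
      (by rw [Finset.card_union_of_disjoint (hW F hF).symm]; omega)
    convert this using 3 with G
    rw [h]
    exact sdiff_le_iff
  | shed Δ x hx hlink hdel hshed ihl ihd =>
    have hxW : x ∉ W := by simpa using hW _ hx
    have hΔW : IsSimplicialComplex (fun G => Δ (G \ W)) :=
      fun _ _ h h' => hΔ _ _ h (Finset.sdiff_subset_sdiff h' subset_rfl)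
    obtain ⟨d, rfl⟩ : ∃ d', d = d' + 1 := by
      have := hd.card_le hx
      rw [Finset.card_singleton] at this
      exact ⟨d - 1, by omega⟩
    refine WeaklyRegularMod.of_colon_of_sup (x := X x)
          (fun p => X_mul_mem_srIdeal_iff hΔW x p) ?_ ?_
    · have := ihl (hΔ.link x) hd.link (insert x W) (fun F hF => Finset.disjoint_insert_right.2
        ⟨hF.1, hW _ (hΔ _ _ hF.2 (Finset.subset_insert _ _))⟩)
      rw [Finset.card_insert_of_notMem hxW, ← add_assoc, add_right_comm] at this
      convert this using 3 with G
      have e : insert x G \ W = insert x (G \ insert x W) := by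
        ext j
        simp only [Finset.mem_sdiff, Finset.mem_insert]
        by_cases hj : j = x
        · subst hj; simp [hxW]
        · simp [hj]
      simp [cplxLink, e]
    · have := srIdeal_sup_prod (K := K) (fun G => Δ (G \ W)) {x}
      rw [Finset.prod_singleton] at this
      rw [this]
      convert ihd (hΔ.del x) (hd.del hΔ hshed) W (fun F hF => hW F hF.2) using 3 with G
      simp [cplxDel, hxW]
      tauto

end Esymm

section KrullDim

variable {K : Type} [Field K] {V : Type} [Fintype V]

lemma ringKrullDim_edgeIdeal_quotient [DecidableEq V] {G : SimpleGraph V} {d : ℕ}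
    (hd : IsPureOfCard (indepCpx G) d) :
    ringKrullDim (MvPolynomial V K ⧸ edgeIdeal K G) = d := by
  have hpoly : ∀ F : Finset V, ringKrullDim (MvPolynomial F K) = F.card := by
    intro F
    rw [MvPolynomial.ringKrullDim_of_isNoetherianRing, ringKrullDim_eq_zero_of_field]
    simp
  apply le_antisymm
  · rw [ringKrullDim_quotient, Order.krullDim]
    refine iSup_le fun p => ?_
    set P₀ := (p 0).1.asIdeal with hP₀
    have hIP : edgeIdeal K G ≤ P₀ := (p 0).2
    classical
    set F : Finset V := Finset.univ.filter fun v => X v ∉ P₀ with hF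
    have hFi : indepCpx G F := by
      intro v hv w hw hvw
      simp only [hF, Finset.mem_filter, Finset.mem_univ, true_and] at hv hw
      have : (X v * X w : MvPolynomial V K) ∈ P₀ := hIP (Ideal.subset_span ⟨v, w, hvw, rfl⟩)
      exact ((p 0).1.isPrime.mem_or_mem this).elim hv hw
    let J : Ideal (MvPolynomial V K) := Ideal.span (X '' {v | v ∉ F})
    have hJ : J ≤ P₀ := by
      refine Ideal.span_le.2 ?_
      rintro _ ⟨v, hv, rfl⟩
      simpa [hF] using hv
    have hsurj : Function.Surjective ((Ideal.Quotient.mk J).comp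
        (rename (R := K) (Subtype.val : F → V)).toRingHom) := by
      intro q
      obtain ⟨q, rfl⟩ := Ideal.Quotient.mk_surjective q
      induction q using MvPolynomial.induction_on with
      | C a => exact ⟨C a, by simp⟩
      | add p q hp hq =>
        obtain ⟨a, ha⟩ := hp
        obtain ⟨b, hb⟩ := hq
        exact ⟨a + b, by rw [map_add, ha, hb, map_add]⟩
      | mul_X p v hp =>
        obtain ⟨a, ha⟩ := hp
        by_cases hv : v ∈ F
        · refine ⟨a * X ⟨v, hv⟩, ?_⟩
          rw [map_mul, ha, map_mul]
          simp
        · refine ⟨0, ?_⟩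
          rw [map_zero, map_mul, Ideal.Quotient.eq_zero_iff_mem.2
            (Ideal.subset_span ⟨v, hv, rfl⟩ : (X v : MvPolynomial V K) ∈ J), mul_zero]
    have hle := ringKrullDim_le_of_surjective _ hsurj
    rw [hpoly, ringKrullDim_quotient] at hle
    let p' : LTSeries (PrimeSpectrum.zeroLocus (R := MvPolynomial V K) J) :=
      { length := p.length
        toFun := fun i => ⟨(p i).1, by
          have : (p 0).1 ≤ (p i).1 := p.monotone (Fin.zero_le i)
          exact hJ.trans this⟩
        step := fun i => p.step i }
    have h1 := Order.LTSeries.length_le_krullDim p'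
    have h2 : (F.card : WithBot ℕ∞) ≤ d := by exact_mod_cast hd.card_le hFi
    exact (h1.trans hle).trans h2
  · obtain ⟨F, -, hF⟩ := exists_isFacet_superset (indepCpx G) (F := ∅) (by simp [indepCpx])
    rw [← hd F hF, ← hpoly F]
    let φ : MvPolynomial V K →ₐ[K] MvPolynomial F K :=
      aeval fun v => if h : v ∈ F then X ⟨v, h⟩ else 0
    have hφ : ∀ a ∈ edgeIdeal K G, φ a = 0 := by
      intro a ha
      refine (Ideal.span_le (I := RingHom.ker φ.toRingHom)).2 ?_ ha
      rintro _ ⟨v, w, hvw, rfl⟩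
      have := hF.1 v
      simp only [AlgHom.toRingHom_eq_coe, SetLike.mem_coe, RingHom.mem_ker, RingHom.coe_coe,
        map_mul, φ, aeval_X]
      by_cases hv : v ∈ F
      · by_cases hw : w ∈ F
        · exact absurd hvw (hF.1 v hv w hw)
        · simp [hw]
      · simp [hv]
    refine ringKrullDim_le_of_surjective (Ideal.Quotient.lift _ φ.toRingHom hφ) ?_
    refine Ideal.Quotient.lift_surjective_of_surjective _ hφ ?_
    intro q
    refine ⟨rename Subtype.val q, ?_⟩
    have : φ.comp (rename (Subtype.val : F → V)) = AlgHom.id K _ := by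
      ext v
      simp [φ]
    exact DFunLike.congr_fun this q

end KrullDim

section Regular

variable {K : Type} [Field K] {V : Type} [Fintype V]

omit [Fintype V] in
lemma edgeIdeal_le_span_X (G : SimpleGraph V) :
    edgeIdeal K G ≤ Ideal.span (Set.range (X : V → MvPolynomial V K)) := by
  refine Ideal.span_le.2 ?_
  rintro _ ⟨v, w, -, rfl⟩
  exact Ideal.mul_mem_right _ _ (Ideal.subset_span ⟨v, rfl⟩)

omit [Fintype V] in
lemma isRegular_of_weaklyRegularMod {I : Ideal (MvPolynomial V K)}
    (hI : I ≤ Ideal.span (Set.range (X : V → MvPolynomial V K))) {rs : List (MvPolynomial V K)}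
    (hrs : ∀ r ∈ rs, r ∈ Ideal.span (Set.range (X : V → MvPolynomial V K)))
    (h : WeaklyRegularMod I rs) :
    RingTheory.Sequence.IsRegular (MvPolynomial V K ⧸ I) rs := by
  refine ⟨(isWeaklyRegular_quotient_iff I rs).2 h, fun htop => ?_⟩
  set m := Ideal.span (Set.range (X : V → MvPolynomial V K)) with hm
  have hle : (Ideal.ofList rs • ⊤ : Submodule (MvPolynomial V K) (MvPolynomial V K ⧸ I)) ≤
      Submodule.map I.mkQ m := by
    refine Submodule.smul_le.2 fun r hr x _ => ?_
    obtain ⟨y, rfl⟩ := I.mkQ_surjective x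
    rw [← map_smul]
    exact Submodule.mem_map_of_mem (Ideal.mul_mem_right _ _ (Ideal.span_le.2 hrs hr))
  have h1 : I.mkQ 1 ∈ Submodule.map I.mkQ m := hle (htop ▸ trivial)
  obtain ⟨y, hy, hy1⟩ := h1
  have h2 : y - 1 ∈ I := (Submodule.Quotient.eq I).1 hy1
  have h3 : (1 : MvPolynomial V K) ∈ m := by
    have := m.sub_mem hy (hI h2)
    rwa [sub_sub_cancel] at this
  have h4 : m ≤ RingHom.ker (constantCoeff (R := K) (σ := V)) := by
    refine Ideal.span_le.2 ?_
    rintro _ ⟨v, rfl⟩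
    simp
  have := h4 h3
  simp at this

lemma mem_esymmList {d : ℕ} {r : MvPolynomial V K} (hr : r ∈ esymmList K V d) :
    r ∈ Ideal.span (Set.range (X : V → MvPolynomial V K)) := by
  classical
  induction d with
  | zero => simp [esymmList] at hr
  | succ d ih =>
    rcases List.mem_cons.1 hr with rfl | hr
    · refine Ideal.sum_mem _ fun t ht => ?_
      rw [Finset.mem_powersetCard] at ht
      obtain ⟨v, hv⟩ := Finset.card_pos.1 (by omega : 0 < t.card)
      exact Ideal.mem_of_dvd _ (Finset.dvd_prod_of_mem _ hv) (Ideal.subset_span ⟨v, rfl⟩)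
    · exact ih hr

lemma length_esymmList (d : ℕ) : (esymmList K V d).length = d := by
  induction d with
  | zero => rfl
  | succ d ih => simp [esymmList, ih]

theorem isCohenMacaulayQuot_of_vertexDecomposable [DecidableEq V] {G : SimpleGraph V} {d : ℕ}
    (hd : IsPureOfCard (indepCpx G) d) (h : VertexDecomposable (indepCpx G)) :
    IsCohenMacaulayQuot K (edgeIdeal K G) := by
  refine ⟨esymmList K V d, fun r hr => mem_esymmList hr,
    isRegular_of_weaklyRegularMod (edgeIdeal_le_span_X G) (fun r hr => mem_esymmList hr) ?_, ?_⟩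
  · have := h.weaklyRegularMod (K := K) (indepCpx_isSimplicialComplex G) hd ∅ (by simp)
    simpa [srIdeal_indepCpx] using this
  · rw [length_esymmList, ringKrullDim_edgeIdeal_quotient hd]
    rfl

end Regular

section Exchange

variable {V : Type} [Fintype V] [DecidableEq V]

/-- The weak exchange property of a family of finite sets with respect to a strict order. -/
def HasExchange (lt : V → V → Prop) (𝓕 : Finset V → Prop) : Prop :=
  ∀ F F' q, 𝓕 F → 𝓕 F' → (∀ p, lt p q → (p ∈ F ↔ p ∈ F')) → q ∈ F → q ∉ F' →
    ∃ p, lt q p ∧ p ∉ F ∧ 𝓕 (insert p (F.erase q))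

lemma vertexDecomposable_of_hasExchange (lt : V → V → Prop) [IsStrictTotalOrder V lt]
    (U W : Finset V) (𝓕 : Finset V → Prop) (hne : ∃ F, 𝓕 F) (hU : ∀ F, 𝓕 F → F ⊆ U)
    (hex : HasExchange lt 𝓕) (hW : Disjoint W U) :
    VertexDecomposable (fun G => ∃ F, 𝓕 F ∧ G ⊆ F ∪ W) := by
  induction U using Finset.strongInduction generalizing 𝓕 W with
  | H U ih =>
  rcases U.eq_empty_or_nonempty with rfl | hUne
  · refine VertexDecomposable.simplex _ W fun G => ⟨?_, fun h => ?_⟩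
    · rintro ⟨F, hF, h⟩
      rwa [Finset.subset_empty.1 (hU F hF), Finset.empty_union] at h
    · obtain ⟨F, hF⟩ := hne
      exact ⟨F, hF, h.trans Finset.subset_union_right⟩
  obtain ⟨x, hxU, hmin⟩ := (Finite.wellFounded_of_trans_of_irrefl lt).has_min (U : Set V) hUne
  have hxW : x ∉ W := fun h => Finset.disjoint_left.1 hW h hxU
  have hlt : ∀ y ∈ U, y ≠ x → lt x y := fun y hy hyx => by
    rcases trichotomous_of lt x y with h | h | h
    · exact h
    · exact absurd h.symm hyx
    · exact absurd h (hmin y hy)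
  have hWx : Disjoint W (U.erase x) := hW.mono_right (Finset.erase_subset _ _)
  set 𝓕₁ : Finset V → Prop := fun F => x ∉ F ∧ 𝓕 (insert x F) with h𝓕₁
  have hU₁ : ∀ F, 𝓕₁ F → F ⊆ U.erase x := fun F hF =>
    Finset.subset_erase.2 ⟨(Finset.subset_insert _ _).trans (hU _ hF.2), hF.1⟩
  have hex₁ : HasExchange lt 𝓕₁ := by
    intro F F' q hF hF' hag hq hq'
    have hqx : q ≠ x := fun h => hF.1 (h ▸ hq)
    obtain ⟨p, hp, hpF, h⟩ := hex (insert x F) (insert x F') q hF.2 hF'.2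
      (fun p hp => by simp [hag p hp]) (Finset.mem_insert_of_mem hq) (by simp [hq', hqx])
    rw [Finset.mem_insert, not_or] at hpF
    refine ⟨p, hp, hpF.2, by simp [Ne.symm hpF.1, hF.1], ?_⟩
    rwa [Finset.erase_insert_of_ne (Ne.symm hqx), Finset.insert_comm] at h
  by_cases h0 : ∀ F, 𝓕 F → x ∉ F
  · exact ih (U.erase x) (Finset.erase_ssubset hxU) W 𝓕 hne
      (fun F hF => Finset.subset_erase.2 ⟨hU F hF, h0 F hF⟩) hex hWx
  push Not at h0
  obtain ⟨F₁, hF₁, hxF₁⟩ := h0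
  have hne₁ : ∃ F, 𝓕₁ F :=
    ⟨F₁.erase x, Finset.notMem_erase _ _, by rwa [Finset.insert_erase hxF₁]⟩
  by_cases h1 : ∀ F, 𝓕 F → x ∈ F
  · have := ih (U.erase x) (Finset.erase_ssubset hxU) (insert x W) 𝓕₁ hne₁ hU₁ hex₁
      (Finset.disjoint_insert_left.2 ⟨Finset.notMem_erase _ _, hWx⟩)
    convert this using 2 with G
    constructor
    · rintro ⟨F, hF, hG⟩
      refine ⟨F.erase x, ⟨Finset.notMem_erase _ _, by rwa [Finset.insert_erase (h1 F hF)]⟩, ?_⟩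
      rwa [Finset.union_insert, ← Finset.insert_union, Finset.insert_erase (h1 F hF)]
    · rintro ⟨F, hF, hG⟩
      exact ⟨insert x F, hF.2, by rwa [Finset.insert_union, ← Finset.union_insert]⟩
  push Not at h1
  obtain ⟨F₀, hF₀, hxF₀⟩ := h1
  have hswap : ∀ F, 𝓕 F → x ∈ F → ∃ p, p ∉ F ∧ 𝓕 (insert p (F.erase x)) := by
    intro F hF hx
    have hn : ∀ p, lt p x → p ∉ U := fun p hp hpU => hmin p hpU hp
    obtain ⟨p, -, h⟩ := hex F F₀ x hF hF₀ (fun p hp => ⟨fun h => absurd (hU _ hF h) (hn p hp),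
      fun h => absurd (hU _ hF₀ h) (hn p hp)⟩) hx hxF₀
    exact ⟨p, h⟩
  refine VertexDecomposable.shed _ x ⟨F₁, hF₁, by simp [hxF₁]⟩ ?_ ?_ ?_
  · have := ih (U.erase x) (Finset.erase_ssubset hxU) W 𝓕₁ hne₁ hU₁ hex₁ hWx
    convert this using 2 with G
    constructor
    · rintro ⟨hxG, F, hF, hG⟩
      have hxF : x ∈ F := by
        have := hG (Finset.mem_insert_self x G)
        simpa [hxW] using this
      refine ⟨F.erase x, ⟨Finset.notMem_erase _ _, by rwa [Finset.insert_erase hxF]⟩, ?_⟩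
      intro y hy
      have := hG (Finset.mem_insert_of_mem hy)
      have hyx : y ≠ x := fun h => hxG (h ▸ hy)
      simpa [hyx] using this
    · rintro ⟨F, hF, hG⟩
      refine ⟨fun hx => ?_, insert x F, hF.2, ?_⟩
      · have := hG hx
        simp [hxW, hF.1] at this
      · rw [Finset.insert_union]
        exact Finset.insert_subset_insert _ hG
  · have := ih (U.erase x) (Finset.erase_ssubset hxU) W (fun F => 𝓕 F ∧ x ∉ F) ⟨F₀, hF₀, hxF₀⟩
      (fun F hF => Finset.subset_erase.2 ⟨hU F hF.1, hF.2⟩) ?_ hWx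
    · convert this using 2 with G
      constructor
      · rintro ⟨hxG, F, hF, hG⟩
        by_cases hxF : x ∈ F
        · obtain ⟨p, hp, hpF⟩ := hswap F hF hxF
          have hpx : x ≠ p := fun h => hp (h ▸ hxF)
          refine ⟨_, ⟨hpF, by simp [hpx]⟩, fun y hy => ?_⟩
          have h1 := hG hy
          have h2 : y ≠ x := fun h => hxG (h ▸ hy)
          simp only [Finset.mem_union, Finset.mem_insert, Finset.mem_erase] at h1 ⊢
          tauto
        · exact ⟨F, ⟨hF, hxF⟩, hG⟩
      · rintro ⟨F, hF, hG⟩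
        refine ⟨fun hx => ?_, F, hF.1, hG⟩
        have := hG hx
        simp [hxW, hF.2] at this
    · intro F F' q hF hF' hag hq hq'
      obtain ⟨p, hp, hpF, h⟩ := hex F F' q hF.1 hF'.1 hag hq hq'
      refine ⟨p, hp, hpF, h, ?_⟩
      have h1 : lt x q := hlt q (hU _ hF.1 hq) fun h => hF.2 (h ▸ hq)
      have h2 : x ≠ p := by
        rintro rfl
        exact irrefl_of lt x (trans_of lt h1 hp)
      simp [h2, hF.2]
  · rintro F hF hF'
    obtain ⟨hxF, F₂, hF₂, hs⟩ := hF.1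
    have hxF₂ : x ∈ F₂ := by
      have := hs (Finset.mem_insert_self x F)
      simpa [hxW] using this
    obtain ⟨p, hp, hpF⟩ := hswap F₂ hF₂ hxF₂
    have hpx : x ≠ p := fun h => hp (h ▸ hxF₂)
    have hpW : p ∉ W := fun h => Finset.disjoint_left.1 hW h (hU _ hpF (Finset.mem_insert_self _ _))
    have := hF'.2 (insert p (F₂.erase x) ∪ W) ⟨by simp [hpx, hxW], _, hpF, subset_rfl⟩ ?_
    · have h3 : p ∈ F := by rw [this]; simp
      have := hs (Finset.mem_insert_of_mem h3)
      simp [hp, hpW] at this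
    · intro y hy
      have h1 := hs (Finset.mem_insert_of_mem hy)
      have h2 : y ≠ x := fun h => hxF (h ▸ hy)
      simp only [Finset.mem_union, Finset.mem_insert, Finset.mem_erase] at h1 ⊢
      tauto

end Exchange

section CoverPowers

variable {K : Type} [Field K] {V : Type} [Fintype V] [DecidableEq V]

/-- `m` is the sum of the indicator vectors of `s` maximal independent sets of `G`. -/
def IsFacetSum (G : SimpleGraph V) (s : ℕ) (m : V → ℕ) : Prop :=
  ∃ T : Fin s → Finset V, (∀ k, IsFacet (indepCpx G) (T k)) ∧
    ∀ v, m v = (Finset.univ.filter fun k => v ∈ T k).card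

omit [Fintype V] in
lemma IsFacetSum.le {G : SimpleGraph V} {s : ℕ} {m : V → ℕ} (h : IsFacetSum G s m) (v : V) :
    m v ≤ s := by
  obtain ⟨T, -, hm⟩ := h
  rw [hm]
  simpa using Finset.card_le_univ (Finset.univ.filter fun k => v ∈ T k)

lemma IsFacetSum.sum_eq {G : SimpleGraph V} {s d : ℕ} (hd : IsPureOfCard (indepCpx G) d)
    {m : V → ℕ} (h : IsFacetSum G s m) : ∑ v, m v = s * d := by
  obtain ⟨T, hT, hm⟩ := h
  simp only [hm, Finset.card_filter]
  rw [Finset.sum_comm]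
  simp [hd _ (hT _)]

lemma coverIdeal_eq_span (G : SimpleGraph V) : coverIdeal K G =
    Ideal.span ((fun a => monomial a (1 : K)) ''
      {a | ∃ F, IsFacet (indepCpx G) F ∧ a = sqfreeExp Fᶜ}) := by
  unfold coverIdeal
  congr 1
  ext p
  constructor
  · rintro ⟨F, hF, rfl⟩
    refine ⟨_, ⟨Fᶜ, ?_, rfl⟩, ?_⟩
    · rwa [← isMinimalVertexCover_compl_iff, compl_compl]
    · simp only [compl_compl]
      rw [prod_X_eq_monomial]
  · rintro ⟨_, ⟨F, hF, rfl⟩, rfl⟩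
    exact ⟨Fᶜ, (isMinimalVertexCover_compl_iff G F).2 hF, by rw [prod_X_eq_monomial]⟩

lemma coverIdeal_pow_eq_span (G : SimpleGraph V) (s : ℕ) : coverIdeal K G ^ s =
    Ideal.span ((fun a => monomial a (1 : K)) ''
      {a | ∃ m, IsFacetSum G s m ∧ ∀ v, a v + m v = s}) := by
  have hcard : ∀ (T : Fin s → Finset V) v,
      (∑ k, sqfreeExp (T k)ᶜ) v + (Finset.univ.filter fun k => v ∈ T k).card = s := by
    intro T v
    simp only [Finsupp.finsetSum_apply, sqfreeExp_apply, Finset.mem_compl]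
    rw [← Finset.card_filter, add_comm, Finset.card_filter_add_card_filter_not, Finset.card_univ,
      Fintype.card_fin]
  rw [coverIdeal_eq_span, Ideal.span, Submodule.span_pow]
  congr 1
  ext p
  rw [Set.mem_pow_iff_prod]
  constructor
  · rintro ⟨f, hf, rfl⟩
    choose b hb hbf using hf
    choose T hT hTb using hb
    refine ⟨∑ k, b k, ⟨_, ⟨T, hT, fun v => rfl⟩, fun v => ?_⟩, ?_⟩
    · simp only [hTb]
      exact hcard T v
    · simp only [monomial_sum_one]
      exact Finset.prod_congr rfl fun k _ => hbf k
  · rintro ⟨a, ⟨m, ⟨T, hT, hm⟩, ha⟩, rfl⟩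
    refine ⟨fun k => monomial (sqfreeExp (T k)ᶜ) 1, fun k => ⟨_, ⟨T k, hT k, rfl⟩, rfl⟩, ?_⟩
    rw [← monomial_sum_one]
    refine congrArg (fun e => monomial e (1 : K)) (Finsupp.ext fun v => ?_)
    have h1 := hcard T v
    have h2 := ha v
    rw [hm] at h2
    omega

lemma isMonoMinGen_coverIdeal_pow_iff {G : SimpleGraph V} {d : ℕ}
    (hd : IsPureOfCard (indepCpx G) d) (s : ℕ) (a : V →₀ ℕ) :
    IsMonoMinGen K (coverIdeal K G ^ s) a ↔ ∃ m, IsFacetSum G s m ∧ ∀ v, a v + m v = s := by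
  have hmem : ∀ a : V →₀ ℕ, monomial a (1 : K) ∈ coverIdeal K G ^ s ↔
      ∃ b : V →₀ ℕ, (∃ m, IsFacetSum G s m ∧ ∀ v, b v + m v = s) ∧ b ≤ a := by
    intro a
    classical
    rw [coverIdeal_pow_eq_span, mem_ideal_span_monomial_image, support_monomial,
      if_neg (one_ne_zero' K)]
    simp
  have hsum : ∀ a : V →₀ ℕ, (∃ m, IsFacetSum G s m ∧ ∀ v, a v + m v = s) →
      ∑ v, a v + s * d = Fintype.card V * s := by
    rintro a ⟨m, hm, ha⟩
    rw [← hm.sum_eq hd, ← Finset.sum_add_distrib]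
    simp [ha]
  have heq : ∀ a b : V →₀ ℕ, b ≤ a → (∃ m, IsFacetSum G s m ∧ ∀ v, a v + m v = s) →
      (∃ m, IsFacetSum G s m ∧ ∀ v, b v + m v = s) → b = a := by
    intro a b hba ha hb
    have h1 : ∑ v, b v = ∑ v, a v := by
      have := hsum a ha
      have := hsum b hb
      omega
    ext v
    exact (Finset.sum_eq_sum_iff_of_le fun v _ => hba v).1 h1 v (Finset.mem_univ v)
  constructor
  · rintro ⟨h1, h2⟩
    obtain ⟨b, hb, hba⟩ := (hmem a).1 h1
    have hbI := (hmem b).2 ⟨b, hb, le_rfl⟩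
    rwa [h2 b hbI hba] at hb
  · intro h
    refine ⟨(hmem a).2 ⟨a, h, le_rfl⟩, fun b hb hba => ?_⟩
    obtain ⟨c, hc, hcb⟩ := (hmem b).1 hb
    have := heq a c (hcb.trans hba) h hc
    subst this
    exact le_antisymm hba hcb

omit [Fintype V] in
lemma isFacetSum_one_iff {G : SimpleGraph V} {m : V → ℕ} :
    IsFacetSum G 1 m ↔ ∃ F, IsFacet (indepCpx G) F ∧ ∀ v, m v = if v ∈ F then 1 else 0 := by
  constructor
  · rintro ⟨T, hT, hm⟩
    refine ⟨T 0, hT 0, fun v => ?_⟩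
    rw [hm, Finset.card_filter, Fin.sum_univ_one]
  · rintro ⟨F, hF, hm⟩
    refine ⟨fun _ => F, fun _ => hF, fun v => ?_⟩
    rw [hm, Finset.card_filter]
    simp

theorem vertexDecomposable_of_weaklyPolymatroidal {G : SimpleGraph V} {d : ℕ}
    (hd : IsPureOfCard (indepCpx G) d) (r : LinearOrder V)
    (h : WeaklyPolymatroidalWrt K r.lt (coverIdeal K G)) : VertexDecomposable (indepCpx G) := by
  have hgen : ∀ F, IsFacet (indepCpx G) F → IsMonoMinGen K (coverIdeal K G) (sqfreeExp Fᶜ) := by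
    intro F hF
    rw [← pow_one (coverIdeal K G), isMonoMinGen_coverIdeal_pow_iff hd]
    refine ⟨_, isFacetSum_one_iff.2 ⟨F, hF, fun v => rfl⟩, fun v => ?_⟩
    rw [sqfreeExp_apply]
    by_cases hv : v ∈ F <;> simp [hv]
  have hirr : ∀ p, ¬ r.lt p p := fun p => @lt_irrefl V r.toPreorder p
  have hex : HasExchange r.lt (IsFacet (indepCpx G)) := by
    intro F F' q hF hF' hag hq hq'
    obtain ⟨p, hqp, hp0, hg⟩ := h _ _ (hgen F hF) (hgen F' hF') q
      (fun p hp => by simp only [sqfreeExp_apply, Finset.mem_compl, hag p hp])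
      (by simp [sqfreeExp_apply, hq, hq'])
    have hpF : p ∉ F := by
      rw [sqfreeExp_apply] at hp0
      by_contra hc
      simp [hc] at hp0
    refine ⟨p, hqp, hpF, ?_⟩
    rw [← pow_one (coverIdeal K G), isMonoMinGen_coverIdeal_pow_iff hd] at hg
    obtain ⟨m, hm, hma⟩ := hg
    obtain ⟨F₂, hF₂, hmF⟩ := isFacetSum_one_iff.1 hm
    convert hF₂ using 1
    ext v
    have h1 := hma v
    rw [hmF] at h1
    have hpq : p ≠ q := fun h => hirr q (h ▸ hqp)
    simp only [Finsupp.tsub_apply, Finsupp.add_apply, sqfreeExp_apply, Finsupp.single_apply,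
      Finset.mem_compl] at h1
    simp only [Finset.mem_insert, Finset.mem_erase]
    by_cases hvp : v = p
    · subst hvp
      simp only [hpF, hpq.symm, not_false_eq_true, if_true, if_false] at h1
      by_cases hv : v ∈ F₂
      · simp [hv]
      · simp [hv] at h1
    · by_cases hvq : v = q
      · subst hvq
        simp only [hq, Ne.symm hvp, not_true_eq_false, if_true, if_false] at h1
        by_cases hv : v ∈ F₂
        · simp [hv] at h1
        · simp [hv, hvp]
      · simp only [Ne.symm hvp, Ne.symm hvq, if_false] at h1
        by_cases hv : v ∈ F₂ <;> by_cases hv' : v ∈ F <;> simp [hv, hv', hvp, hvq] at h1 ⊢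
  obtain ⟨F₀, -, hF₀⟩ := exists_isFacet_superset (indepCpx G) (F := ∅) (by simp [indepCpx])
  have : IsStrictTotalOrder V r.lt := @instIsStrictTotalOrderLt V r
  have hv := vertexDecomposable_of_hasExchange r.lt Finset.univ ∅ _ ⟨F₀, hF₀⟩
    (fun F _ => Finset.subset_univ F) hex (Finset.disjoint_empty_left _)
  convert hv using 1
  funext F
  simp only [Finset.union_empty]
  apply propext
  constructor
  · intro hF
    obtain ⟨F', hs, hF'⟩ := exists_isFacet_superset (indepCpx G) hF
    exact ⟨F', hF', hs⟩
  · rintro ⟨F', hF', hs⟩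
    exact indepCpx_isSimplicialComplex G _ _ hF'.1 hs

omit [DecidableEq V] in
lemma exists_linearOrder_of_rank (ρ : V → ℕ) :
    ∃ r : LinearOrder V, ∀ p q, ρ p < ρ q → r.lt p q := by
  let e := Fintype.equivFin V
  let f : V → ℕ ×ₗ Fin (Fintype.card V) := fun v => toLex (ρ v, e v)
  have hf : Function.Injective f := fun v w h => e.injective (Prod.ext_iff.1 h).2
  refine ⟨LinearOrder.lift' f hf, fun p q h => ?_⟩
  exact (Prod.Lex.toLex_lt_toLex (x := (ρ p, e p)) (y := (ρ q, e q))).2 (Or.inl h)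

/-- The exchange property, with respect to a rank function on the vertices, for sums of maximal
independent sets. -/
def FacetSumExchange (G : SimpleGraph V) (ρ : V → ℕ) : Prop :=
  ∀ s m m', IsFacetSum G s m → IsFacetSum G s m' → ∀ q, (∀ p, ρ p < ρ q → m p = m' p) →
    m' q < m q → ∃ p, ρ q < ρ p ∧ ∃ m'', IsFacetSum G s m'' ∧
      ∀ v, m'' v + (if v = q then 1 else 0) = m v + (if v = p then 1 else 0)

theorem weaklyPolymatroidal_of_facetSumExchange {G : SimpleGraph V} {d : ℕ}
    (hd : IsPureOfCard (indepCpx G) d) {ρ : V → ℕ} (h : FacetSumExchange G ρ) :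
    ∃ r : LinearOrder V, ∀ s, WeaklyPolymatroidalWrt K r.lt (coverIdeal K G ^ s) := by
  obtain ⟨r, hr⟩ := exists_linearOrder_of_rank ρ
  refine ⟨r, fun s a b ha hb q hag hlt => ?_⟩
  rw [isMonoMinGen_coverIdeal_pow_iff hd] at ha hb
  obtain ⟨m, hm, ham⟩ := ha
  obtain ⟨m', hm', hbm⟩ := hb
  obtain ⟨p, hqp, m'', hm'', heq⟩ := h s m m' hm hm' q (fun p hp => by
    have h1 := hag p (hr p q hp)
    have h2 := ham p
    have h3 := hbm p
    omega) (by
    have h2 := ham q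
    have h3 := hbm q
    omega)
  have hpq : p ≠ q := by
    rintro rfl
    exact lt_irrefl _ hqp
  have hp : 0 < a p := by
    have h1 := heq p
    have h2 := hm''.le p
    have h3 := ham p
    rw [if_neg hpq, if_pos rfl] at h1
    omega
  refine ⟨p, hr q p hqp, hp, ?_⟩
  rw [isMonoMinGen_coverIdeal_pow_iff hd]
  refine ⟨m'', hm'', fun v => ?_⟩
  have h1 := heq v
  have h2 := hm''.le v
  have h3 := ham v
  simp only [Finsupp.tsub_apply, Finsupp.add_apply, Finsupp.single_apply]
  by_cases hvp : v = p
  · subst hvp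
    simp only [if_true, hpq, hpq.symm, if_false] at h1 ⊢
    omega
  · by_cases hvq : v = q
    · subst hvq
      simp only [if_true, hvp, Ne.symm hvp, if_false] at h1 ⊢
      omega
    · simp only [hvp, hvq, Ne.symm hvp, Ne.symm hvq, if_false] at h1 ⊢
      omega

end CoverPowers

section Koszul

variable {V S : Type} [CommRing S]

/-- The Koszul-type differential with weights `y` on (non-alternating) cochains. -/
def koszulD (y : V → S) : (List V → S) → List V → S
  | _, [] => 0
  | c, v :: l => y v * c l - koszulD y (fun l' => c (v :: l')) l

lemma koszulD_add (y : V → S) (c c' : List V → S) (l : List V) :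
    koszulD y (fun l => c l + c' l) l = koszulD y c l + koszulD y c' l := by
  induction l generalizing c c' with
  | nil => simp [koszulD]
  | cons v l ih => simp only [koszulD, ih]; ring

lemma koszulD_mul (y : V → S) (r : S) (c : List V → S) (l : List V) :
    koszulD y (fun l => r * c l) l = r * koszulD y c l := by
  induction l generalizing c with
  | nil => simp [koszulD]
  | cons v l ih => simp only [koszulD, ih]; ring

lemma koszulD_zero (y : V → S) (l : List V) : koszulD y (fun _ => 0) l = 0 := by
  simpa using koszulD_mul y 0 (fun _ => 0) l

lemma koszulD_sub (y : V → S) (c c' : List V → S) (l : List V) :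
    koszulD y (fun l => c l - c' l) l = koszulD y c l - koszulD y c' l := by
  have := koszulD_add y c (fun l => (-1) * c' l) l
  rw [koszulD_mul] at this
  simpa [sub_eq_add_neg] using this

lemma koszulD_sum {ι : Type} (y : V → S) (s : Finset ι) (c : ι → List V → S) (l : List V) :
    koszulD y (fun l => ∑ i ∈ s, c i l) l = ∑ i ∈ s, koszulD y (c i) l := by
  classical
  induction s using Finset.induction_on with
  | empty => simpa using koszulD_zero y l
  | insert a s ha ih => simp only [Finset.sum_insert ha, koszulD_add, ih]

lemma koszulD_add_weight (y z : V → S) (c : List V → S) (l : List V) :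
    koszulD (fun v => y v + z v) c l = koszulD y c l + koszulD z c l := by
  induction l generalizing c with
  | nil => simp [koszulD]
  | cons v l ih => simp only [koszulD, ih]; ring

lemma koszulD_mul_weight (r : S) (y : V → S) (c : List V → S) (l : List V) :
    koszulD (fun v => r * y v) c l = r * koszulD y c l := by
  induction l generalizing c with
  | nil => simp [koszulD]
  | cons v l ih => simp only [koszulD, ih]; ring

lemma koszulD_sum_weight {ι : Type} (s : Finset ι) (y : ι → V → S) (c : List V → S)
    (l : List V) :
    koszulD (fun v => ∑ i ∈ s, y i v) c l = ∑ i ∈ s, koszulD (y i) c l := by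
  classical
  induction s using Finset.induction_on with
  | empty => simpa using koszulD_mul_weight 0 (fun _ => 0) c l
  | insert a s ha ih => simp only [Finset.sum_insert ha, koszulD_add_weight, ih]

lemma koszulD_mem (y : V → S) {I : Ideal S} {c : List V → S} {n : ℕ}
    (h : ∀ l, l.length = n → c l ∈ I) {l : List V} (hl : l.length = n + 1) :
    koszulD y c l ∈ I := by
  induction n generalizing c l with
  | zero =>
    match l, hl with
    | [v], _ => simpa [koszulD] using I.mul_mem_left (y v) (h [] rfl)
  | succ n ih =>
    match l, hl with
    | v :: l, hl =>
      refine I.sub_mem (I.mul_mem_left _ (h l (by simpa using hl))) (ih (fun l' hl' => ?_) ?_)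
      · exact h _ (by simp [hl'])
      · simpa using hl

lemma koszulD_anticomm (y z : V → S) (c : List V → S) (l : List V) :
    koszulD y (koszulD z c) l = - koszulD z (koszulD y c) l := by
  induction l generalizing c with
  | nil => simp [koszulD]
  | cons v l ih =>
    simp only [koszulD, koszulD_sub, koszulD_mul, ih]
    ring

lemma koszulD_koszulD (y : V → S) (c : List V → S) (l : List V) :
    koszulD y (koszulD y c) l = 0 := by
  induction l generalizing c with
  | nil => simp [koszulD]
  | cons v l ih =>
    simp only [koszulD, koszulD_sub, koszulD_mul, ih]
    ring

lemma koszulD_homotopy [Fintype V] (a y : V → S) (c : List V → S) (l : List V) :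
    ∑ w, a w * koszulD y c (w :: l) =
      (∑ w, a w * y w) * c l - koszulD y (fun l => ∑ w, a w * c (w :: l)) l := by
  simp only [koszulD, koszulD_sum, koszulD_mul, mul_sub, Finset.sum_sub_distrib,
    Finset.sum_mul, mul_assoc]

/-- The cohomology of `koszulD y` with coefficients in `S ⧸ I` vanishes in degrees `< k`. -/
def KoszulVanishing (y : V → S) (k : ℕ) (I : Ideal S) : Prop :=
  ∀ i < k, ∀ c, (∀ l : List V, l.length = i + 1 → koszulD y c l ∈ I) →
    ∃ e, ∀ l : List V, l.length = i → c l - koszulD y e l ∈ I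

lemma KoszulVanishing.succ_of_sup [Fintype V] {y : V → S} {k : ℕ} {I : Ideal S} {f : S}
    (hreg : ∀ p, f * p ∈ I → p ∈ I) {N : ℕ} (hN : f ^ N ∈ Ideal.span (Set.range y))
    (hk : KoszulVanishing y k (I ⊔ Ideal.span {f})) : KoszulVanishing y (k + 1) I := by
  intro i hi c hc
  have step : ∀ c g : List V → S,
      (∀ l : List V, l.length = i → f * c l - koszulD y g l ∈ I) →
      ∃ e, ∀ l : List V, l.length = i → c l - koszulD y e l ∈ I := by
    intro c g hg
    rcases i with _ | j
    · refine ⟨fun _ => 0, fun l hl => ?_⟩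
      obtain rfl := List.length_eq_zero_iff.1 hl
      simpa [koszulD] using hreg _ (by simpa [koszulD] using hg [] rfl)
    · obtain ⟨e, he⟩ := hk j (by omega) g fun l hl => by
        have := Ideal.sub_mem (I ⊔ Ideal.span {f}) (Ideal.mul_mem_right (c l) _
          (Submodule.mem_sup_right (Ideal.mem_span_singleton_self f)))
          (Submodule.mem_sup_left (hg l hl))
        simpa using this
      have he' : ∀ l : List V, ∃ t, l.length = j → g l - koszulD y e l - f * t ∈ I := by
        intro l
        by_cases hl : l.length = j
        · obtain ⟨a, ha, b, hb, hab⟩ := Submodule.mem_sup.1 (he l hl)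
          obtain ⟨t, rfl⟩ := Ideal.mem_span_singleton'.1 hb
          refine ⟨t, fun _ => ?_⟩
          rw [← hab]
          convert ha using 1
          ring
        · exact ⟨0, fun h => absurd h hl⟩
      choose t ht using he'
      refine ⟨t, fun l hl => hreg _ ?_⟩
      have h1 := koszulD_mem y ht hl
      rw [koszulD_sub, koszulD_sub, koszulD_mul, koszulD_koszulD] at h1
      have := I.add_mem (hg l hl) h1
      convert this using 1
      ring
  have iter : ∀ n, ∀ g : List V → S,
      (∀ l : List V, l.length = i → f ^ n * c l - koszulD y g l ∈ I) →
      ∃ e, ∀ l : List V, l.length = i → c l - koszulD y e l ∈ I := by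
    intro n
    induction n with
    | zero => exact fun g hg => ⟨g, by simpa using hg⟩
    | succ n ih =>
      intro g hg
      obtain ⟨e, he⟩ := step (fun l => f ^ n * c l) g fun l hl => by
        have := hg l hl
        rwa [pow_succ', mul_assoc] at this
      exact ih e he
  obtain ⟨a, ha⟩ := Ideal.mem_span_range_iff_exists_fun.1 hN
  refine iter N (fun l => ∑ w, a w * c (w :: l)) fun l hl => ?_
  rw [← ha, ← koszulD_homotopy]
  exact Ideal.sum_mem _ fun w _ => I.mul_mem_left _ (hc _ (by simp [hl]))

lemma WeaklyRegularMod.koszulVanishing [Fintype V] {y : V → S} {I : Ideal S} {rs : List S}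
    (h : WeaklyRegularMod I rs) (hrs : ∀ r ∈ rs, r ∈ (Ideal.span (Set.range y)).radical) :
    KoszulVanishing y rs.length I := by
  induction rs generalizing I with
  | nil => exact fun i hi => absurd hi (by simp)
  | cons r rs ih =>
    obtain ⟨N, hN⟩ := hrs r (by simp)
    exact (ih h.2 fun r hr => hrs r (by simp [hr])).succ_of_sup h.1 hN

/-- Iterated wedge product with the dual basis vectors of the list. -/
def wedgeList [DecidableEq V] (L : List V) (c : List V → S) : List V → S :=
  L.foldr (fun v c => koszulD (Pi.single v 1) c) c

variable [DecidableEq V]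

lemma wedgeList_mem {I : Ideal S} {c : List V → S} {n : ℕ} (L : List V)
    (h : ∀ l, l.length = n → c l ∈ I) {l : List V} (hl : l.length = L.length + n) :
    wedgeList L c l ∈ I := by
  induction L generalizing l with
  | nil => exact h l (by simpa using hl)
  | cons v L ih =>
    exact koszulD_mem (n := L.length + n) _ (fun l hl => ih hl)
      (by rw [hl, List.length_cons]; omega)

lemma koszulD_wedgeList (y : V → S) (L : List V) (c : List V → S) (l : List V) :
    koszulD y (wedgeList L c) l = (-1) ^ L.length * wedgeList L (koszulD y c) l := by
  induction L generalizing l with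
  | nil => simp [wedgeList]
  | cons v L ih =>
    have : koszulD y (wedgeList L c) = fun l => (-1) ^ L.length * wedgeList L (koszulD y c) l :=
      funext ih
    change koszulD y (koszulD _ (wedgeList L c)) l = _ * koszulD _ (wedgeList L (koszulD y c)) l
    rw [koszulD_anticomm, this, koszulD_mul, List.length_cons]
    ring

lemma wedgeList_koszulD_single {L : List V} {v : V} (hv : v ∈ L) (c : List V → S) (l : List V) :
    wedgeList L (koszulD (Pi.single v 1) c) l = 0 := by
  induction L generalizing l with
  | nil => simp at hv
  | cons u L ih =>
    change koszulD _ (wedgeList L _) l = 0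
    by_cases h : v ∈ L
    · rw [show wedgeList L (koszulD (Pi.single v 1) c) = fun _ => 0 from funext (ih h),
        koszulD_zero]
    · obtain rfl : v = u := by simpa [h] using hv
      have := koszulD_wedgeList (Pi.single v 1) L c
      have h2 : wedgeList L (koszulD (Pi.single v 1) c) =
          fun l => (-1) ^ L.length * koszulD (Pi.single v 1) (wedgeList L c) l := by
        funext l
        rw [this, ← mul_assoc, ← mul_pow]
        simp
      rw [h2, koszulD_mul, koszulD_koszulD, mul_zero]

lemma wedgeList_add (L : List V) (c c' : List V → S) (l : List V) :
    wedgeList L (fun l => c l + c' l) l = wedgeList L c l + wedgeList L c' l := by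
  induction L generalizing l with
  | nil => rfl
  | cons v L ih =>
    change koszulD _ (wedgeList L _) l = koszulD _ _ l + koszulD _ _ l
    rw [← koszulD_add]
    exact congrArg (fun c => koszulD _ c l) (funext ih)

lemma wedgeList_mul (L : List V) (r : S) (c : List V → S) (l : List V) :
    wedgeList L (fun l => r * c l) l = r * wedgeList L c l := by
  induction L generalizing l with
  | nil => rfl
  | cons v L ih =>
    change koszulD _ (wedgeList L _) l = r * koszulD _ _ l
    rw [← koszulD_mul]
    exact congrArg (fun c => koszulD _ c l) (funext ih)

lemma wedgeList_sum {ι : Type} (L : List V) (s : Finset ι) (c : ι → List V → S) (l : List V) :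
    wedgeList L (fun l => ∑ i ∈ s, c i l) l = ∑ i ∈ s, wedgeList L (c i) l := by
  classical
  induction s using Finset.induction_on with
  | empty => simpa using wedgeList_mul L (0 : S) (fun _ => 0) l
  | insert a s ha ih => simp only [Finset.sum_insert ha, wedgeList_add, ih]

lemma koszulD_single_eq_zero {v : V} {l : List V} (hv : v ∉ l) (c : List V → S) :
    koszulD (Pi.single v 1) c l = 0 := by
  induction l generalizing c with
  | nil => rfl
  | cons u l ih =>
    simp only [List.mem_cons, not_or] at hv
    simp [koszulD, ih hv.2, Ne.symm hv.1]

lemma wedgeList_append {L : List V} (hL : L.Nodup) (c : List V → S) {l : List V}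
    (h : ∀ v ∈ L, v ∉ l) : wedgeList L c (L ++ l) = c l := by
  induction L with
  | nil => rfl
  | cons v L ih =>
    rw [List.nodup_cons] at hL
    change koszulD _ (wedgeList L c) (v :: (L ++ l)) = _
    have : v ∉ L ++ l := by simp [hL.1, h v (by simp)]
    rw [koszulD, koszulD_single_eq_zero this, ih hL.2 fun u hu => h u (by simp [hu])]
    simp

end Koszul

section LinkCohomology

variable {V : Type} {S : Type} [CommRing S]

/-- Multiplying a cochain by the product of the weights and a fixed factor. -/
lemma koszulD_prod (y : V → S) (m : S) (c : List V → S) (l : List V) :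
    koszulD y (fun l => c l * ((l.map y).prod * m)) l =
      koszulD 1 c l * ((l.map y).prod * m) := by
  induction l generalizing c m with
  | nil => simp [koszulD]
  | cons v l ih =>
    have := ih (y v * m) (fun l => c (v :: l))
    simp only [koszulD, List.map_cons, List.prod_cons, Pi.one_apply, one_mul, sub_mul]
    rw [show (fun l' => c (v :: l') * (y v * (l'.map y).prod * m)) =
      fun l' => c (v :: l') * ((l'.map y).prod * (y v * m)) by funext l'; ring, this]
    ring

lemma koszulD_map {R : Type} [CommRing R] (f : R →+* S) (c : List V → R) (l : List V) :
    koszulD 1 (fun l => f (c l)) l = f (koszulD 1 c l) := by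
  induction l generalizing c with
  | nil => simp [koszulD]
  | cons v l ih => simp [koszulD, ih]

/-- Evaluating `koszulD y E` after a prefix whose weights lie in `I`. -/
lemma koszulD_append_mem {y : V → S} {I : Ideal S} {L : List V} (hL : ∀ v ∈ L, y v ∈ I)
    (E : List V → S) (l : List V) :
    koszulD y E (L ++ l) - (-1) ^ L.length * koszulD y (fun l => E (L ++ l)) l ∈ I := by
  induction L generalizing E with
  | nil => simp
  | cons v L ih =>
    have h1 := ih (fun u hu => hL u (by simp [hu])) (fun l => E (v :: l))
    have h2 := I.mul_mem_right (E (L ++ l)) (hL v (by simp))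
    have := I.sub_mem h2 h1
    simp only [List.cons_append, koszulD, List.length_cons]
    convert this using 1
    ring

variable {K : Type} [Field K]

lemma coeff_koszulD {y : V → MvPolynomial V K} (E : List V → MvPolynomial V K) (a : V →₀ ℕ)
    {l : List V} (hl : ∀ v ∈ l, y v = X v) :
    coeff ((l.map fun v => Finsupp.single v 1).sum + a) (koszulD y E l) =
      koszulD 1 (fun l => coeff ((l.map fun v => Finsupp.single v 1).sum + a) (E l)) l := by
  induction l generalizing E a with
  | nil => simp [koszulD]
  | cons v l ih =>
    have h := ih (fun l => E (v :: l)) (a + Finsupp.single v 1) fun u hu => hl u (by simp [hu])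
    simp only [koszulD, List.map_cons, List.sum_cons, coeff_sub, Pi.one_apply, one_mul,
      hl v (by simp)]
    congr 1
    · rw [add_assoc, coeff_X_mul]
    · rw [show Finsupp.single v 1 + (l.map fun v => Finsupp.single v 1).sum + a =
        (l.map fun v => Finsupp.single v 1).sum + (a + Finsupp.single v 1) by abel, h]
      refine congrArg (fun c => koszulD 1 c l) (funext fun l' => ?_)
      exact congrArg (fun e => coeff e _) (by abel)

lemma prod_map_X (l : List V) : (l.map (X : V → MvPolynomial V K)).prod =
    monomial (l.map fun v => Finsupp.single v 1).sum 1 := by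
  induction l with
  | nil => simp
  | cons v l ih => simp [ih, X, monomial_mul]

lemma mem_support_sum_single [DecidableEq V] (l : List V) (u : V) :
    (l.map fun v => Finsupp.single v 1).sum u = l.count u := by
  induction l with
  | nil => simp
  | cons v l ih => simp [ih, Finsupp.single_apply, List.count_cons, add_comm]

variable [Fintype V] [DecidableEq V]

/-- A Cohen–Macaulay edge ideal forces the cohomology of links of the independence complex
to vanish below the top degree. -/
theorem IsCohenMacaulayQuot.exists_primitive {G : SimpleGraph V} {d : ℕ}
    (hd : IsPureOfCard (indepCpx G) d) (hCM : IsCohenMacaulayQuot K (edgeIdeal K G))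
    {F : Finset V} {j : ℕ} (hj : j + F.card < d) (c : List V → K)
    (hc : ∀ l : List V, l.length = j + 1 → (∀ v ∈ l, v ∉ F) → indepCpx G (F ∪ l.toFinset) →
      koszulD 1 c l = 0) :
    ∃ e : List V → K, ∀ l : List V, l.length = j → (∀ v ∈ l, v ∉ F) →
      indepCpx G (F ∪ l.toFinset) → c l = koszulD 1 e l := by
  obtain ⟨rs, hrs, hreg, hlen⟩ := hCM
  rw [ringKrullDim_edgeIdeal_quotient hd] at hlen
  have hlen : rs.length = d := WithTop.coe_injective (WithBot.coe_injective hlen)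
  have hI := (isWeaklyRegular_quotient_iff _ _).1 hreg.toIsWeaklyRegular
  set y : V → MvPolynomial V K := fun v => if v ∈ F then X v ^ 2 else X v with hy
  set y' : V → MvPolynomial V K := fun v => if v ∈ F then 0 else X v with hy'
  have hrad : Ideal.span (Set.range (X : V → MvPolynomial V K)) ≤
      (Ideal.span (Set.range y)).radical := by
    refine Ideal.span_le.2 ?_
    rintro _ ⟨v, rfl⟩
    have h1 : y v ∈ Ideal.span (Set.range y) := Ideal.subset_span ⟨v, rfl⟩
    by_cases hv : v ∈ F
    · exact ⟨2, by simpa [hy, hv] using h1⟩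
    · exact ⟨1, by simpa [hy, hv] using h1⟩
  have hvan := hI.koszulVanishing fun r hr => hrad (hrs r hr)
  rw [hlen] at hvan
  have hyy : ∀ (c : List V → MvPolynomial V K) l, koszulD y c l =
      koszulD y' c l + ∑ v ∈ F, X v ^ 2 * koszulD (Pi.single v 1) c l := by
    intro c l
    have : y = fun v => y' v + ∑ u ∈ F, X u ^ 2 * (Pi.single u 1 : V → MvPolynomial V K) v := by
      funext v
      by_cases hv : v ∈ F <;> simp [hy, hy', hv, Pi.single_apply]
    rw [this, koszulD_add_weight, koszulD_sum_weight]
    simp only [koszulD_mul_weight]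
  set xF : MvPolynomial V K := ∏ v ∈ F, X v with hxF
  set c' : List V → MvPolynomial V K :=
    fun l => C (c l) * ((l.map y').prod * xF) with hc'
  set L := F.toList with hL
  have hLF : ∀ v, v ∈ L ↔ v ∈ F := fun v => by simp [hL]
  have hLlen : L.length = F.card := by simp [hL]
  have hmemI : ∀ p, p ∈ edgeIdeal K G ↔ ∀ a ∈ p.support, ¬ indepCpx G a.support := by
    intro p
    rw [← srIdeal_indepCpx, mem_srIdeal (indepCpx_isSimplicialComplex G)]
  have hmap : ∀ l : List V, (∀ v ∈ l, v ∉ F) → (l.map y').prod * xF =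
      monomial ((l.map fun v => Finsupp.single v 1).sum + sqfreeExp F) (1 : K) := by
    intro l hl
    have : l.map y' = l.map X := List.map_congr_left fun v hv => by simp [hy', hl v hv]
    rw [this, prod_map_X, hxF, prod_X_eq_monomial, monomial_mul, one_mul]
  have hsupp : ∀ l : List V, ((l.map fun v => Finsupp.single v 1).sum + sqfreeExp F).support =
      F ∪ l.toFinset := by
    intro l
    ext u
    simp [mem_support_sum_single, sqfreeExp_apply, List.count_eq_zero]
    tauto
  have hcoc : ∀ l : List V, l.length = j + 1 → koszulD y' c' l ∈ edgeIdeal K G := by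
    intro l hl
    rw [hc', koszulD_prod, koszulD_map]
    by_cases h1 : ∀ v ∈ l, v ∉ F
    · by_cases h2 : indepCpx G (F ∪ l.toFinset)
      · simp [hc l hl h1 h2]
      · rw [hmap l h1]
        refine Ideal.mul_mem_left _ _ ?_
        rw [← srIdeal_indepCpx]
        exact monomial_mem_srIdeal (by rwa [hsupp]) 1
    · push Not at h1
      obtain ⟨v, hv, hvF⟩ := h1
      have : (l.map y').prod = 0 :=
        List.prod_eq_zero (List.mem_map.2 ⟨v, hv, by simp [hy', hvF]⟩)
      simp [this]
  have hC : ∀ l : List V, l.length = j + F.card + 1 →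
      koszulD y (wedgeList L c') l ∈ edgeIdeal K G := by
    intro l hl
    rw [koszulD_wedgeList]
    refine Ideal.mul_mem_left _ _ ?_
    rw [show koszulD y c' = fun l => koszulD y' c' l +
      ∑ v ∈ F, X v ^ 2 * koszulD (Pi.single v 1) c' l from funext (hyy c'), wedgeList_add,
      wedgeList_sum]
    refine Ideal.add_mem _ (wedgeList_mem (n := j + 1) L hcoc (by omega)) ?_
    refine Ideal.sum_mem _ fun v hv => ?_
    rw [wedgeList_mul, wedgeList_koszulD_single ((hLF v).2 hv), mul_zero]
    exact zero_mem _
  obtain ⟨E, hE⟩ := hvan (j + F.card) hj _ hC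
  set E' : List V → MvPolynomial V K := fun l => E (L ++ l)
  set e : List V → K := fun l =>
    (-1) ^ L.length * coeff ((l.map fun v => Finsupp.single v 1).sum + sqfreeExp F) (E' l)
  refine ⟨e, fun l hl hlF hind => ?_⟩
  set μ := (l.map fun v => Finsupp.single v 1).sum + sqfreeExp F with hμ
  have h0 := hE (L ++ l) (by simp [hLlen, hl, add_comm])
  rw [wedgeList_append F.nodup_toList _ fun v hv hvl => hlF v hvl ((hLF v).1 hv)] at h0
  have h1 := koszulD_append_mem (y := y) (I := Ideal.span (Set.range fun v : F =>
    (X (v : V) ^ 2 : MvPolynomial V K))) (L := L) (fun v hv =>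
      Ideal.subset_span ⟨⟨v, (hLF v).1 hv⟩, by simp [hy, (hLF v).1 hv]⟩) E l
  have hz : ∀ p ∈ Ideal.span (Set.range fun v : F => (X (v : V) ^ 2 : MvPolynomial V K)),
      coeff μ p = 0 := by
    intro p hp
    obtain ⟨a, rfl⟩ := Ideal.mem_span_range_iff_exists_fun.1 hp
    rw [coeff_sum]
    refine Finset.sum_eq_zero fun v _ => ?_
    rw [X_pow_eq_monomial, coeff_mul_monomial', if_neg]
    intro hle
    have := hle v
    rw [Finsupp.single_eq_same, hμ, Finsupp.add_apply, mem_support_sum_single, sqfreeExp_apply,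
      List.count_eq_zero.2 fun h => hlF _ h v.2] at this
    simp at this
  have hz1 := hz _ h1
  have hz2 : coeff μ (c' l - koszulD y E (L ++ l)) = 0 := by
    by_contra hne
    exact (hmemI _).1 h0 μ (mem_support_iff.2 hne) (by rwa [hμ, hsupp])
  have hcl : coeff μ (c' l) = c l := by
    simp only [hc']
    rw [hmap l hlF, coeff_C_mul, coeff_monomial, if_pos rfl, mul_one]
  have hneg : ((-1) ^ L.length : MvPolynomial V K) = C ((-1) ^ L.length) := by simp
  rw [coeff_sub, hcl] at hz2
  rw [coeff_sub, hneg, coeff_C_mul, hμ, coeff_koszulD _ _ fun v hv => by simp [hy, hlF v hv],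
    ← hμ] at hz1
  rw [sub_eq_zero.1 hz2, sub_eq_zero.1 hz1, ← koszulD_mul]

end LinkCohomology

section Swap

variable {V : Type} [Fintype V] [DecidableEq V] {G : SimpleGraph V} {d : ℕ}

/-- In an unmixed graph an independent set is at least as large as any independent set
whose closed neighbourhood it covers. -/
lemma IsPureOfCard.card_le_of_dominates (hd : IsPureOfCard (indepCpx G) d) {I I' : Finset V}
    (hI : indepCpx G I) (hI' : indepCpx G I')
    (h₁ : ∀ v ∈ I', v ∈ I ∨ ∃ u ∈ I, G.Adj u v)
    (h₂ : ∀ u ∈ I', ∀ v, G.Adj u v → v ∈ I ∨ ∃ u ∈ I, G.Adj u v) : I'.card ≤ I.card := by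
  obtain ⟨T, hIT, hT⟩ := exists_isFacet_superset (indepCpx G) hI
  have key : ∀ t ∈ T \ I, t ∉ I' ∧ ∀ u ∈ I', ¬ G.Adj u t := by
    intro t ht
    rw [Finset.mem_sdiff] at ht
    have hno : ¬ (t ∈ I ∨ ∃ u ∈ I, G.Adj u t) := by
      rintro (h | ⟨u, hu, h⟩)
      · exact ht.2 h
      · exact hT.1 u (hIT hu) t ht.1 h
    exact ⟨fun h => hno (h₁ t h), fun u hu h => hno (h₂ u hu t h)⟩
  have hind : indepCpx G (T \ I ∪ I') := by
    intro v hv w hw hvw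
    rcases Finset.mem_union.1 hv with hv | hv <;> rcases Finset.mem_union.1 hw with hw | hw
    · exact hT.1 v (Finset.mem_sdiff.1 hv).1 w (Finset.mem_sdiff.1 hw).1 hvw
    · exact (key v hv).2 w hw hvw.symm
    · exact (key w hw).2 v hv hvw
    · exact hI' v hv w hw hvw
  have h1 := hd.card_le hind
  rw [Finset.card_union_of_disjoint (Finset.disjoint_left.2 fun t ht => (key t ht).1),
    Finset.card_sdiff_of_subset hIT, hd T hT] at h1
  have := hd.card_le hI
  omega

end Swap

section LinkColoring

variable {K : Type} [Field K] {V : Type} [Fintype V] [DecidableEq V] {G : SimpleGraph V} {d : ℕ}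

/-- A vertex of the link of `F` in the independence complex. -/
def IsLinkVertex (G : SimpleGraph V) (F : Finset V) (v : V) : Prop :=
  v ∉ F ∧ ∀ u ∈ F, ¬ G.Adj u v

omit [Fintype V] in
lemma IsLinkVertex.indepCpx_insert {F : Finset V} (hF : indepCpx G F) {v : V}
    (hv : IsLinkVertex G F v) : indepCpx G (insert v F) := by
  intro a ha b hb hab
  rcases Finset.mem_insert.1 ha with rfl | ha' <;> rcases Finset.mem_insert.1 hb with rfl | hb'
  · exact hab.ne rfl
  · exact hv.2 b hb' hab.symm
  · exact hv.2 a ha' hab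
  · exact hF a ha' b hb' hab

/-- Connectedness of the one-skeleton of positive dimensional links. -/
lemma IsCohenMacaulayQuot.link_coloring_const
    (hd : IsPureOfCard (indepCpx G) d) (hCM : IsCohenMacaulayQuot K (edgeIdeal K G))
    {F : Finset V} (hF : F.card + 2 ≤ d) (f : V → K)
    (hf : ∀ u v, IsLinkVertex G F u → IsLinkVertex G F v → ¬ G.Adj u v → f u = f v)
    {u v : V} (hFi : indepCpx G F) (hu : IsLinkVertex G F u) (hv : IsLinkVertex G F v) :
    f u = f v := by
  have hlink : ∀ l : List V, (∀ v ∈ l, v ∉ F) → indepCpx G (F ∪ l.toFinset) →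
      ∀ v ∈ l, IsLinkVertex G F v := fun l hl h v hv =>
    ⟨hl v hv, fun u hu => h u (by simp [hu]) v (by simp [hv])⟩
  obtain ⟨e, he⟩ := hCM.exists_primitive hd (F := F) (j := 1) (by omega)
    (fun l => match l with | [] => 0 | v :: _ => f v) (by
      intro l hl hlF hind
      match l, hl with
      | [a, b], _ =>
        have := hf b a (hlink _ hlF hind b (by simp)) (hlink _ hlF hind a (by simp))
          (hind b (by simp) a (by simp))
        simp [koszulD, this])
  have key : ∀ v, IsLinkVertex G F v → f v = e [] := by
    intro v hv
    have := he [v] rfl (by simpa using hv.1) (by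
      have := hv.indepCpx_insert hFi
      rwa [Finset.insert_eq, Finset.union_comm] at this)
    simpa [koszulD] using this
  rw [key u hu, key v hv]

end LinkColoring

section Bipartite

variable {V : Type} [Fintype V] [DecidableEq V] {G : SimpleGraph V} {d : ℕ}

/-- A perfect matching of the nonisolated vertices of `G` between `X` and its complement,
given by `φ` with inverse `ψ`. -/
structure IsBipartiteMatching (G : SimpleGraph V) (X : Finset V) (φ ψ : V → V) : Prop where
  adj : ∀ x ∈ X, G.Adj x (φ x)
  bip : ∀ u v, G.Adj u v → (u ∈ X ↔ v ∉ X)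
  left_inv : ∀ x ∈ X, ψ (φ x) = x
  cover : ∀ v ∉ X, (ψ v ∈ X ∧ φ (ψ v) = v) ∨ ∀ u, ¬ G.Adj u v

lemma exists_injOn_adj (hd : IsPureOfCard (indepCpx G) d) {X : Finset V}
    (hXi : indepCpx G X) (hX : ∀ x ∈ X, ∃ y, G.Adj x y)
    (hN : ∀ x ∈ X, ∀ x' ∈ X, ∀ y y', G.Adj x y → G.Adj x' y' → ¬ G.Adj y y') :
    ∃ φ : V → V, Set.InjOn φ X ∧ ∀ x ∈ X, G.Adj x (φ x) := by
  classical
  have hall := (Finset.all_card_le_biUnion_card_iff_exists_injective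
    (fun x : X => G.neighborFinset x)).1 (by
      intro s
      have hs := hd.card_le_of_dominates (I := s.biUnion fun x => G.neighborFinset x)
        (I' := s.image Subtype.val) (by
          intro v hv w hw
          simp only [Finset.mem_biUnion, SimpleGraph.mem_neighborFinset] at hv hw
          obtain ⟨x, -, hx⟩ := hv
          obtain ⟨x', -, hx'⟩ := hw
          exact hN x x.2 x' x'.2 v w hx hx')
        (by
          intro v hv w hw
          obtain ⟨x, -, rfl⟩ := Finset.mem_image.1 hv
          obtain ⟨x', -, rfl⟩ := Finset.mem_image.1 hw
          exact hXi x x.2 x' x'.2)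
        (by
          intro v hv
          obtain ⟨x, hx, rfl⟩ := Finset.mem_image.1 hv
          obtain ⟨y, hy⟩ := hX x x.2
          exact Or.inr ⟨y, Finset.mem_biUnion.2 ⟨x, hx, by simpa using hy⟩, hy.symm⟩)
        (by
          intro u hu v huv
          obtain ⟨x, hx, rfl⟩ := Finset.mem_image.1 hu
          exact Or.inl (Finset.mem_biUnion.2 ⟨x, hx, by simpa using huv⟩))
      rwa [Finset.card_image_of_injective _ Subtype.val_injective] at hs)
  obtain ⟨f, hf, hfa⟩ := hall
  refine ⟨fun v => if h : v ∈ X then f ⟨v, h⟩ else v, fun a ha b hb hab => ?_, fun x hx => ?_⟩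
  · have ha : a ∈ X := ha
    have hb : b ∈ X := hb
    simp only [ha, hb, dif_pos] at hab
    simpa using hf hab
  · simpa [hx] using hfa ⟨x, hx⟩

lemma exists_isBipartiteMatching (hd : IsPureOfCard (indepCpx G) d) (hG : G.Colorable 2) :
    ∃ X φ ψ, IsBipartiteMatching G X φ ψ := by
  classical
  obtain ⟨col⟩ := hG
  have hcol : ∀ {u v}, G.Adj u v → (col u = 0 ↔ col v = 1) := by
    intro u v h
    have := col.valid h
    have := Fin.exists_fin_two.1 ⟨col u, rfl⟩
    omega
  set Z : Fin 2 → Finset V := fun i => Finset.univ.filter fun v => col v = i ∧ ∃ w, G.Adj v w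
  have hmem : ∀ i v, v ∈ Z i ↔ col v = i ∧ ∃ w, G.Adj v w := fun i v => by simp [Z]
  have hmatch : ∀ i, ∃ φ : V → V, Set.InjOn φ (Z i) ∧ ∀ x ∈ Z i, G.Adj x (φ x) := by
    intro i
    refine exists_injOn_adj hd ?_ (fun x hx => ((hmem i x).1 hx).2) ?_
    · intro v hv w hw hvw
      exact col.valid hvw (((hmem i v).1 hv).1.trans ((hmem i w).1 hw).1.symm)
    · intro x hx x' hx' y y' h h' hyy
      have h1 := col.valid h
      have h2 := col.valid h'
      have h3 := col.valid hyy
      have h4 := ((hmem i x).1 hx).1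
      have h5 := ((hmem i x').1 hx').1
      omega
  obtain ⟨φ, hφ, hφa⟩ := hmatch 0
  obtain ⟨φ', hφ', hφa'⟩ := hmatch 1
  have himg : (Z 0).image φ ⊆ Z 1 := by
    intro v hv
    obtain ⟨x, hx, rfl⟩ := Finset.mem_image.1 hv
    exact (hmem _ _).2 ⟨(hcol (hφa x hx)).1 ((hmem _ _).1 hx).1, x, (hφa x hx).symm⟩
  have himg' : (Z 1).image φ' ⊆ Z 0 := by
    intro v hv
    obtain ⟨x, hx, rfl⟩ := Finset.mem_image.1 hv
    exact (hmem _ _).2 ⟨(hcol (hφa' x hx).symm).2 ((hmem _ _).1 hx).1, x, (hφa' x hx).symm⟩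
  have heq : (Z 0).image φ = Z 1 := by
    refine Finset.eq_of_subset_of_card_le himg ?_
    rw [Finset.card_image_of_injOn hφ, ← Finset.card_image_of_injOn hφ']
    exact Finset.card_le_card himg'
  have hZ : ∀ {u v}, G.Adj u v → (u ∈ Z 0 ↔ col u = 0) := fun h => by
    rw [hmem]
    exact and_iff_left ⟨_, h⟩
  rcases isEmpty_or_nonempty V with hV | hV
  · exact ⟨∅, id, id, by simp, fun u => isEmptyElim u, by simp, fun u => isEmptyElim u⟩
  refine ⟨Z 0, φ, Function.invFunOn φ (Z 0), hφa, fun u v h => ?_, fun x hx => ?_, fun v hv => ?_⟩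
  · rw [hZ h, hZ h.symm, hcol h]
    omega
  · exact hφ.leftInvOn_invFunOn hx
  · by_cases h : ∃ w, G.Adj v w
    · left
      have hv1 : v ∈ Z 1 := by
        refine (hmem _ _).2 ⟨?_, h⟩
        have : col v ≠ 0 := fun h0 => hv ((hmem _ _).2 ⟨h0, h⟩)
        omega
      rw [← heq] at hv1
      obtain ⟨x, hx, hxv⟩ := Finset.mem_image.1 hv1
      have hex : ∃ a ∈ (Z 0 : Set V), φ a = v := ⟨x, hx, hxv⟩
      exact ⟨Function.invFunOn_mem hex, Function.invFunOn_eq hex⟩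
    · right
      exact fun u hu => h ⟨u, hu.symm⟩

namespace IsBipartiteMatching

variable {X : Finset V} {φ ψ : V → V}

lemma mem_or_mem (h : IsBipartiteMatching G X φ ψ) (hd : IsPureOfCard (indepCpx G) d)
    {T : Finset V} (hT : IsFacet (indepCpx G) T) {x : V} (hx : x ∈ X) : x ∈ T ∨ φ x ∈ T := by
  classical
  by_contra hcon
  push Not at hcon
  set Z : Finset V := Finset.univ.filter fun v => ∀ u, ¬ G.Adj u v
  have hZ : ∀ v, v ∈ Z ↔ ∀ u, ¬ G.Adj u v := by simp [Z]
  have hXZ : indepCpx G (X ∪ Z) := by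
    intro v hv w hw hvw
    rcases Finset.mem_union.1 hv with hv | hv
    · rcases Finset.mem_union.1 hw with hw | hw
      · exact (h.bip v w hvw).1 hv hw
      · exact (hZ w).1 hw v hvw
    · exact (hZ v).1 hv w hvw.symm
  have hle := hd.card_le hXZ
  rw [Finset.card_union_of_disjoint (Finset.disjoint_left.2 fun v hv hvZ =>
    (hZ v).1 hvZ _ (h.adj v hv).symm)] at hle
  have hsub : T \ X ⊆ ((X \ T).erase x).image φ ∪ Z := by
    intro t ht
    rw [Finset.mem_sdiff] at ht
    rcases h.cover t ht.2 with ⟨h1, h2⟩ | h1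
    · refine Finset.mem_union_left _ (Finset.mem_image.2 ⟨ψ t, ?_, h2⟩)
      refine Finset.mem_erase.2 ⟨?_, Finset.mem_sdiff.2 ⟨h1, fun h3 => ?_⟩⟩
      · rintro h4
        rw [h4] at h2
        exact hcon.2 (h2 ▸ ht.1)
      · have := h.adj _ h1
        rw [h2] at this
        exact hT.1 _ h3 _ ht.1 this
    · exact Finset.mem_union_right _ ((hZ t).2 h1)
  have h1 := (Finset.card_le_card hsub).trans (Finset.card_union_le _ _)
  have h2 := (Finset.card_image_le (s := (X \ T).erase x) (f := φ))
  have hxm : x ∈ X \ T := Finset.mem_sdiff.2 ⟨hx, hcon.1⟩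
  rw [Finset.card_erase_of_mem hxm] at h2
  have h3 := Finset.card_pos.2 ⟨x, hxm⟩
  have h4 := Finset.card_sdiff_add_card_inter T X
  have h5 := Finset.card_sdiff_add_card_inter X T
  rw [Finset.inter_comm] at h5
  have := hd T hT
  omega

lemma trans (h : IsBipartiteMatching G X φ ψ) (hd : IsPureOfCard (indepCpx G) d)
    {i j k : V} (hi : i ∈ X) (hj : j ∈ X) (hij : G.Adj i (φ j))
    (hjk : G.Adj j (φ k)) : G.Adj i (φ k) := by
  by_contra hik
  have hind : indepCpx G {i, φ k} := by
    intro v hv w hw hvw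
    simp only [Finset.mem_insert, Finset.mem_singleton] at hv hw
    rcases hv with rfl | rfl <;> rcases hw with rfl | rfl
    · exact hvw.ne rfl
    · exact hik hvw
    · exact hik hvw.symm
    · exact hvw.ne rfl
  obtain ⟨T, hsT, hT⟩ := exists_isFacet_superset _ hind
  rcases h.mem_or_mem hd hT hj with h1 | h1
  · exact hT.1 _ h1 _ (hsT (by simp)) hjk
  · exact hT.1 _ (hsT (by simp)) _ h1 hij

lemma antisymm {K : Type} [Field K] (h : IsBipartiteMatching G X φ ψ)
    (hd : IsPureOfCard (indepCpx G) d) (hCM : IsCohenMacaulayQuot K (edgeIdeal K G))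
    {i j : V} (hi : i ∈ X) (hj : j ∈ X) (hij : G.Adj i (φ j)) (hji : G.Adj j (φ i)) : i = j := by
  classical
  by_contra hne
  obtain ⟨F, -, hF⟩ := Finite.exists_le_maximal (p := fun F : Finset V => indepCpx G F ∧
    ∀ u ∈ F, u ≠ i ∧ u ≠ φ i ∧ ¬ G.Adj u i ∧ ¬ G.Adj u (φ i)) (a := ∅) (by simp [indepCpx])
  have hFi := hF.1.1
  have hFp := hF.1.2
  have hmax : ∀ v, IsLinkVertex G F v → v = i ∨ v = φ i ∨ G.Adj v i ∨ G.Adj v (φ i) := by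
    intro v hv
    by_contra hcon
    push Not at hcon
    have := hF.2 (y := insert v F) ⟨hv.indepCpx_insert hFi, fun u hu => by
      rcases Finset.mem_insert.1 hu with rfl | hu
      · exact hcon
      · exact hFp u hu⟩ (Finset.subset_insert _ _)
    exact hv.1 (this (Finset.mem_insert_self _ _))
  have hφX : φ i ∉ X := (h.bip _ _ (h.adj i hi)).1 hi
  have hlx : ∀ v, IsLinkVertex G F v → v ∈ X → G.Adj v (φ i) := by
    intro v hv hvX
    rcases hmax v hv with rfl | rfl | h1 | h1
    · exact h.adj _ hi
    · exact absurd hvX hφX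
    · exact absurd hi ((h.bip _ _ h1).1 hvX)
    · exact h1
  have hly : ∀ v, IsLinkVertex G F v → v ∉ X → G.Adj i v := by
    intro v hv hvX
    rcases hmax v hv with rfl | rfl | h1 | h1
    · exact absurd hi hvX
    · exact h.adj _ hi
    · exact h1.symm
    · exact absurd ((h.bip _ _ h1).2 hφX) hvX
  have hli : IsLinkVertex G F i :=
    ⟨fun hiF => (hFp i hiF).1 rfl, fun u hu => (hFp u hu).2.2.1⟩
  have hlφ : IsLinkVertex G F (φ i) :=
    ⟨fun hiF => (hFp _ hiF).2.1 rfl, fun u hu => (hFp u hu).2.2.2⟩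
  have hcov : ∀ {u v}, G.Adj u v → u ∈ X → ψ v ∈ X ∧ φ (ψ v) = v := by
    intro u v huv hu
    exact (h.cover v ((h.bip _ _ huv).1 hu)).resolve_right fun hno => hno u huv
  have hlj : IsLinkVertex G F j := by
    refine ⟨fun hjF => (hFp j hjF).2.2.2 hji, fun u hu huj => ?_⟩
    obtain ⟨h1, h2⟩ := hcov huj.symm hj
    refine (hFp u hu).2.2.1 ?_
    have := h.trans hd hi hj hij (h2.symm ▸ huj.symm)
    exact (h2 ▸ this).symm
  have hcard : F.card + 2 ≤ d := by
    have hind : indepCpx G (insert j (insert i F)) := by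
      refine IsLinkVertex.indepCpx_insert (hli.indepCpx_insert hFi) ⟨?_, ?_⟩
      · simp [hlj.1, Ne.symm hne]
      · intro u hu huj
        rcases Finset.mem_insert.1 hu with rfl | hu
        · exact absurd hj ((h.bip _ _ huj).1 hi)
        · exact hlj.2 u hu huj
    have := hd.card_le hind
    rwa [Finset.card_insert_of_notMem (by simp [hlj.1, Ne.symm hne]),
      Finset.card_insert_of_notMem hli.1] at this
  have hcompl : ∀ u v, IsLinkVertex G F u → IsLinkVertex G F v → u ∈ X → v ∉ X → G.Adj u v := by
    intro u v hu hv huX hvX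
    have h1 := hly v hv hvX
    obtain ⟨h2, h3⟩ := hcov h1 hi
    have := h.trans hd huX hi (hlx u hu huX) (h3.symm ▸ h1)
    exact h3 ▸ this
  have := hCM.link_coloring_const hd hcard (fun v => if v ∈ X then 1 else 0) (by
    intro u v hu hv huv
    by_cases h1 : u ∈ X <;> by_cases h2 : v ∈ X
    · simp [h1, h2]
    · exact absurd (hcompl u v hu hv h1 h2) huv
    · exact absurd (hcompl v u hv hu h2 h1).symm huv
    · simp [h1, h2]) hFi hli hlφ
  simp [hi, hφX] at this

lemma isFacetSum_iff (h : IsBipartiteMatching G X φ ψ) (hd : IsPureOfCard (indepCpx G) d)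
    (s : ℕ) (m : V → ℕ) : IsFacetSum G s m ↔ (∀ x ∈ X, m x + m (φ x) = s) ∧
      (∀ u v, G.Adj u v → m u + m v ≤ s) ∧ ∀ v, (∀ u, ¬ G.Adj u v) → m v = s := by
  classical
  have hdisj : ∀ (T : Fin s → Finset V) (u v : V), (∀ k, IsFacet (indepCpx G) (T k)) →
      G.Adj u v → Disjoint (Finset.univ.filter fun k => u ∈ T k)
        (Finset.univ.filter fun k => v ∈ T k) := by
    intro T u v hT huv
    rw [Finset.disjoint_filter]
    exact fun k _ hu hv => (hT k).1 u hu v hv huv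
  constructor
  · rintro ⟨T, hT, hm⟩
    refine ⟨fun x hx => ?_, fun u v huv => ?_, fun v hv => ?_⟩
    · rw [hm, hm, ← Finset.card_union_of_disjoint (hdisj T _ _ hT (h.adj x hx)),
        ← Finset.filter_or, Finset.filter_true_of_mem fun k _ => h.mem_or_mem hd (hT k) hx]
      simp
    · rw [hm, hm, ← Finset.card_union_of_disjoint (hdisj T _ _ hT huv)]
      simpa using Finset.card_le_univ
        ((Finset.univ.filter fun k => u ∈ T k) ∪ Finset.univ.filter fun k => v ∈ T k)
    · rw [hm, Finset.filter_true_of_mem]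
      · simp
      · intro k _
        by_contra hvT
        have := (hT k).2 (insert v (T k)) (IsLinkVertex.indepCpx_insert (hT k).1
          ⟨hvT, fun u _ => hv u⟩) (Finset.subset_insert _ _)
        exact hvT (this ▸ Finset.mem_insert_self _ _)
  · rintro ⟨h1, h2, h3⟩
    have hms : ∀ v, m v ≤ s := by
      intro v
      by_cases hv : ∃ u, G.Adj u v
      · obtain ⟨u, hu⟩ := hv
        have := h2 u v hu
        omega
      · push Not at hv
        exact (h3 v hv).le
    refine ⟨fun k => Finset.univ.filter fun v => (v ∈ X ∧ m (φ v) ≤ k) ∨ (v ∉ X ∧ k.1 < m v),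
      fun k => ⟨?_, fun T' hT' hs => ?_⟩, fun v => ?_⟩
    · have key : ∀ x y, x ∈ X → m (φ x) ≤ k → k.1 < m y → ¬ G.Adj x y := by
        intro x y hx hk hy hxy
        have := h1 x hx
        have := h2 x y hxy
        omega
      intro v hv w hw hvw
      simp only [Finset.mem_filter, Finset.mem_univ, true_and] at hv hw
      have hb := h.bip v w hvw
      rcases hv with ⟨hv, hv'⟩ | ⟨hv, hv'⟩ <;> rcases hw with ⟨hw, hw'⟩ | ⟨hw, hw'⟩
      · exact hb.1 hv hw
      · exact key v w hv hv' hw' hvw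
      · exact key w v hw hw' hv' hvw.symm
      · exact hv (hb.2 hw)
    · refine hs.antisymm fun v hv => ?_
      by_contra hvT
      simp only [Finset.mem_filter, Finset.mem_univ, true_and, not_or, not_and, not_le,
        not_lt] at hvT
      by_cases hvX : v ∈ X
      · refine hT' v hv (φ v) (hs ?_) (h.adj v hvX)
        simp only [Finset.mem_filter, Finset.mem_univ, true_and]
        exact Or.inr ⟨(h.bip _ _ (h.adj v hvX)).1 hvX, hvT.1 hvX⟩
      · rcases h.cover v hvX with ⟨h4, h5⟩ | h4
        · have h6 := h.adj _ h4
          rw [h5] at h6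
          refine hT' _ (hs ?_) v hv h6
          simp only [Finset.mem_filter, Finset.mem_univ, true_and]
          exact Or.inl ⟨h4, h5.symm ▸ hvT.2 hvX⟩
        · have := h3 v h4
          have := hvT.2 hvX
          omega
    · have hcount : ∀ a, a ≤ s → (Finset.univ.filter fun k : Fin s => k.1 < a).card = a := by
        intro a ha
        rw [Fin.card_filter_val_lt, min_eq_right ha]
      by_cases hvX : v ∈ X
      · have h4 := h1 v hvX
        have h5 := Finset.card_filter_add_card_filter_not (s := (Finset.univ : Finset (Fin s)))
          (fun k => k.1 < m (φ v))
        rw [hcount _ (hms _)] at h5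
        simp only [not_lt, Finset.card_univ, Fintype.card_fin] at h5
        simp only [Finset.mem_filter, Finset.mem_univ, true_and, hvX, not_true, false_and,
          or_false]
        omega
      · simp [hvX, hcount _ (hms v)]

theorem facetSumExchange {K : Type} [Field K] (h : IsBipartiteMatching G X φ ψ)
    (hd : IsPureOfCard (indepCpx G) d) (hCM : IsCohenMacaulayQuot K (edgeIdeal K G)) :
    ∃ ρ, FacetSumExchange G ρ := by
  classical
  refine ⟨fun v => if v ∉ X ∧ ∃ u, G.Adj u v then (G.neighborFinset (ψ v)).card
    else Fintype.card V + 1, ?_⟩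
  intro s m m' hm hm' q hag hlt
  have hm0 := hm
  rw [h.isFacetSum_iff hd] at hm hm'
  obtain ⟨h1, h2, h3⟩ := hm
  obtain ⟨h1', h2', h3'⟩ := hm'
  have hrank : ∀ x ∈ X, φ x ∉ X ∧ ∃ u, G.Adj u (φ x) := fun x hx =>
    ⟨(h.bip _ _ (h.adj x hx)).1 hx, x, h.adj x hx⟩
  have hlow : ∀ x, (G.neighborFinset x).card < Fintype.card V + 1 := fun x =>
    Nat.lt_succ_of_le (Finset.card_le_univ _)
  by_cases hqX : q ∈ X
  · have := hag (φ q) (by simp only [hrank q hqX, hqX]; simpa using hlow _)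
    have := h1 q hqX
    have := h1' q hqX
    omega
  by_cases hqi : ∃ u, G.Adj u q
  swap
  · push Not at hqi
    have := h3 q hqi
    have := h3' q hqi
    omega
  obtain ⟨hi, hiq⟩ := (h.cover q hqX).resolve_right fun hno => hqi.elim hno
  set i := ψ q with hidef
  have hadj := h.adj i hi
  rw [hiq] at hadj
  have hsi := h1 i hi
  have hsi' := h1' i hi
  rw [hiq] at hsi hsi'
  refine ⟨i, ?_, fun v => if v = q then m v - 1 else if v = i then m v + 1 else m v, ?_, ?_⟩
  · have := hlow (ψ q)
    simp only [hqX, hqi, hi]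
    simpa using hlow _
  · have hstrict : ∀ v, G.Adj i v → v ≠ q → m i + 1 + m v ≤ s := by
      intro v hiv hvq
      have hvX := (h.bip _ _ hiv).1 hi
      obtain ⟨hb, hbv⟩ := (h.cover v hvX).resolve_right fun hno => hno i hiv
      have hle : m v = m' v := by
        apply hag
        have hex : ∃ u, G.Adj u v := ⟨i, hiv⟩
        simp only [hvX, hex, hqX, hqi, not_false_iff, and_self, if_true]
        apply Finset.card_lt_card
        rw [Finset.ssubset_iff_of_subset]
        · refine ⟨q, by simpa using hadj, fun hbq => hvq ?_⟩
          have hbq : G.Adj (ψ v) q := by simpa using hbq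
          have := h.antisymm hd hCM hi hb (by rwa [hbv]) (by rwa [hiq])
          rw [← hbv, ← this, hiq]
        · intro w hw
          have hw : G.Adj (ψ v) w := by simpa using hw
          have hwX := (h.bip _ _ hw).1 hb
          obtain ⟨hc, hcw⟩ := (h.cover w hwX).resolve_right fun hno => hno _ hw
          have := h.trans hd hi hb (by rwa [hbv]) (by rwa [hcw])
          rw [hcw] at this
          simpa using this
      have := h2' i v hiv
      omega
    rw [h.isFacetSum_iff hd]
    have hne : i ≠ q := hadj.ne
    refine ⟨fun x hx => ?_, fun u v huv => ?_, fun v hv => ?_⟩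
    · have hxq : x ≠ q := fun e => hqX (e ▸ hx)
      have hxi : φ x ≠ i := fun e => (hrank x hx).1 (e ▸ hi)
      have := h1 x hx
      by_cases hx' : x = i
      · subst hx'
        simp only [hne, hiq, if_true, if_false]
        omega
      · have : φ x ≠ q := fun e => hx' (by rw [← h.left_inv x hx, e])
        simp only [hxq, hxi, hx', this, if_false]
        omega
    · have := h2 u v huv
      have hcase : ∀ v, G.Adj i v → v ≠ q → (m i + 1) + m v ≤ s := hstrict
      by_cases huq : u = q <;> by_cases hvq : v = q <;> by_cases hui : u = i <;>
        by_cases hvi : v = i <;> simp only [huq, hvq, hui, hvi, if_true, if_false, hne, hne.symm]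
      all_goals first
        | (subst_vars; first | exact absurd rfl huv.ne | exact absurd rfl hne | skip) 
      all_goals first
        | omega
        | (have := hcase _ huv hvq; omega)
        | (have := hcase _ huv.symm huq; omega)
    · have hvq : v ≠ q := fun e => hqi.elim fun u hu => hv u (e ▸ hu)
      have hvi : v ≠ i := fun e => hv q (e ▸ hadj.symm)
      simp [hvq, hvi, h3 v hv]
  · intro v
    have hne : i ≠ q := hadj.ne
    by_cases hvq : v = q
    · subst hvq
      simp [hne.symm]
      omega
    · by_cases hvi : v = i
      · subst hvi
        simp [hvq]
      · simp [hvq, hvi]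

end IsBipartiteMatching

end Bipartite

section ExchangePieces

variable {V : Type} [Fintype V] [DecidableEq V] {G : SimpleGraph V} {d : ℕ}

/-- A set of vertices inside which exchanges along the rank `ρ` can be performed. -/
structure IsExchangePiece (G : SimpleGraph V) (P : Finset V) (ρ : V → ℕ) : Prop where
  low : ∀ v ∈ P, ρ v ≠ 0 → (∀ w, G.Adj v w → w ∈ P) ∨ ∃ a b, ∀ w, G.Adj v w → w = a ∨ w = b
  exchange : ∀ s m m', IsFacetSum G s m → IsFacetSum G s m' → ∀ q ∈ P,
    (∀ p ∈ P, ρ p < ρ q → m p = m' p) →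
    (ρ q ≠ 0 → ∀ v ∉ P, (∃ u ∈ P, G.Adj v u) →
      (¬ ∃ a b, ∀ w, G.Adj v w → w = a ∨ w = b) → m v = m' v) →
    m' q < m q → ∃ p ∈ P, ρ q < ρ p ∧ ∃ m'', IsFacetSum G s m'' ∧
      ∀ v, m'' v + (if v = q then 1 else 0) = m v + (if v = p then 1 else 0)

omit [Fintype V] in
theorem exists_facetSumExchange_of_pieces (𝒬 : Finset (Finset V))
    (hdisj : ∀ P ∈ 𝒬, ∀ Q ∈ 𝒬, P ≠ Q → Disjoint P Q) (hcov : ∀ v, ∃ P ∈ 𝒬, v ∈ P)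
    (h : ∀ P ∈ 𝒬, ∃ ρ, IsExchangePiece G P ρ) : ∃ ρ, FacetSumExchange G ρ := by
  choose Q hQ hvQ using hcov
  have hQu : ∀ P ∈ 𝒬, ∀ v ∈ P, Q v = P := by
    intro P hP v hv
    by_contra hne
    exact Finset.disjoint_left.1 (hdisj _ (hQ v) P hP hne) (hvQ v) hv
  choose! ρ hρ using h
  refine ⟨fun v => ρ (Q v) v, fun s m m' hm hm' q hag hlt => ?_⟩
  obtain ⟨p, hp, hqp, h1⟩ := (hρ _ (hQ q)).exchange s m m' hm hm' q (hvQ q) (fun p hp hpq => by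
    apply hag
    change ρ (Q p) p < ρ (Q q) q
    rwa [hQu _ (hQ q) p hp]) (fun hq0 v hv ⟨u, hu, hvu⟩ hdeg => by
    apply hag
    have h0 : ρ (Q v) v = 0 := by
      by_contra hne
      rcases (hρ _ (hQ v)).low v (hvQ v) hne with h2 | h2
      · have := hQu _ (hQ v) u (h2 u hvu)
        rw [hQu _ (hQ q) u hu] at this
        exact hv (this ▸ hvQ v)
      · exact hdeg h2
    change ρ (Q v) v < ρ (Q q) q
    rw [h0]
    exact Nat.pos_of_ne_zero hq0) hlt
  exact ⟨p, by change ρ (Q q) q < ρ (Q p) p; rwa [hQu _ (hQ q) p hp], h1⟩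

omit [Fintype V] in
lemma IsFacet.mem_of_forall_not_adj {T : Finset V} (hT : IsFacet (indepCpx G) T) {v : V}
    (h : ∀ u ∈ T, ¬ G.Adj u v) : v ∈ T := by
  by_contra hv
  have := hT.2 _ (IsLinkVertex.indepCpx_insert hT.1 ⟨hv, h⟩) (Finset.subset_insert _ _)
  exact hv (this ▸ Finset.mem_insert_self _ _)

/-- Replacing two summands of a facet sum. -/
lemma IsPureOfCard.exists_facetSum_of_replace_two (hd : IsPureOfCard (indepCpx G) d) {s : ℕ}
    {T : Fin s → Finset V} (hT : ∀ k, IsFacet (indepCpx G) (T k)) {m : V → ℕ}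
    (hm : ∀ v, m v = (Finset.univ.filter fun k => v ∈ T k).card) {k₁ k₂ : Fin s}
    (hk : k₁ ≠ k₂) {T₁ T₂ : Finset V} (h₁ : indepCpx G T₁) (h₂ : indepCpx G T₂) {p q : V}
    (hc : ∀ v, (if v ∈ T₁ then 1 else 0) + (if v ∈ T₂ then 1 else 0) + (if v = q then 1 else 0) =
      (if v ∈ T k₁ then 1 else 0) + (if v ∈ T k₂ then 1 else 0) + (if v = p then 1 else 0)) :
    ∃ m'', IsFacetSum G s m'' ∧
      ∀ v, m'' v + (if v = q then 1 else 0) = m v + (if v = p then 1 else 0) := by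
  have hcard : T₁.card + T₂.card = d + d := by
    have := Finset.sum_congr (rfl : (Finset.univ : Finset V) = Finset.univ) fun v _ => hc v
    simp only [Finset.sum_add_distrib, Finset.sum_ite_mem, Finset.univ_inter, Finset.sum_const,
      smul_eq_mul, mul_one, Finset.sum_ite_eq', Finset.mem_univ, if_true, hd _ (hT _)] at this
    omega
  have h1 := hd.card_le h₁
  have h2 := hd.card_le h₂
  have hT₁ := hd.isFacet_iff.2 ⟨h₁, by omega⟩
  have hT₂ := hd.isFacet_iff.2 ⟨h₂, by omega⟩
  set T' := Function.update (Function.update T k₁ T₁) k₂ T₂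
  have hk1 : T' k₁ = T₁ := by simp [T', hk]
  have hk2 : T' k₂ = T₂ := by simp [T']
  have hk3 : ∀ k, k ≠ k₁ → k ≠ k₂ → T' k = T k := fun k h h' => by simp [T', h, h']
  refine ⟨_, ⟨T', fun k => ?_, fun v => rfl⟩, fun v => ?_⟩
  · by_cases h : k = k₁
    · rw [h, hk1]; exact hT₁
    by_cases h' : k = k₂
    · rw [h', hk2]; exact hT₂
    rw [hk3 k h h']
    exact hT k
  · rw [hm]
    simp only [Finset.card_filter]
    have e : ∀ f : Fin s → ℕ, ∑ k, f k =
        f k₁ + f k₂ + ∑ k ∈ (Finset.univ.erase k₁).erase k₂, f k := by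
      intro f
      rw [add_assoc, Finset.add_sum_erase _ _ (by simp [hk.symm]),
        Finset.add_sum_erase _ _ (by simp)]
    rw [e, e, hk1, hk2, Finset.sum_congr rfl fun k hk => by
      rw [hk3 k (by simp at hk; tauto) (by simp at hk; tauto)]]
    have := hc v
    omega

/-- Exchanging a vertex in one summand of a facet sum. -/
lemma IsPureOfCard.exists_facetSum_of_swap (hd : IsPureOfCard (indepCpx G) d) {s : ℕ}
    {T : Fin s → Finset V} (hT : ∀ k, IsFacet (indepCpx G) (T k)) {m : V → ℕ}
    (hm : ∀ v, m v = (Finset.univ.filter fun k => v ∈ T k).card) {k : Fin s} {p q : V}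
    (hq : q ∈ T k) (hqp : G.Adj q p) (hp : ∀ u ∈ T k, G.Adj p u → u = q) :
    ∃ m'', IsFacetSum G s m'' ∧
      ∀ v, m'' v + (if v = q then 1 else 0) = m v + (if v = p then 1 else 0) := by
  have hpT : p ∉ T k := fun h => (hT k).1 q hq p h hqp
  have hi : indepCpx G (insert p ((T k).erase q)) := by
    refine IsLinkVertex.indepCpx_insert (indepCpx_isSimplicialComplex G _ _ (hT k).1
      (Finset.erase_subset _ _)) ⟨fun h => hpT (Finset.mem_of_mem_erase h), fun u hu hup => ?_⟩
    rw [Finset.mem_erase] at hu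
    exact hu.1 (hp u hu.2 hup.symm)
  have hT' : IsFacet (indepCpx G) (insert p ((T k).erase q)) := by
    refine hd.isFacet_iff.2 ⟨hi, ?_⟩
    rw [Finset.card_insert_of_notMem fun h => hpT (Finset.mem_of_mem_erase h),
      Finset.card_erase_add_one hq, hd _ (hT k)]
  refine ⟨_, ⟨Function.update T k (insert p ((T k).erase q)), fun k' => ?_, fun v => rfl⟩,
    fun v => ?_⟩
  · by_cases h : k' = k
    · subst h; simpa using hT'
    · simpa [h] using hT k'
  · rw [hm]
    simp only [Finset.card_filter]
    rw [← Finset.add_sum_erase _ _ (Finset.mem_univ k),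
      ← Finset.add_sum_erase _ _ (Finset.mem_univ k), Finset.sum_congr rfl fun k' hk' => by
        rw [Function.update_of_ne (Finset.ne_of_mem_erase hk')]]
    simp only [Function.update_self, Finset.mem_insert, Finset.mem_erase]
    have hne := hqp.ne
    by_cases h1 : v = q
    · subst h1
      simp [hq, hne]
      omega
    · by_cases h2 : v = p
      · subst h2
        simp [hpT, h1]
        omega
      · simp [h1, h2]

omit [Fintype V] in
lemma exists_mem_of_lt {s : ℕ} {T : Fin s → Finset V} {m m' : V → ℕ}
    (hm : ∀ v, m v = (Finset.univ.filter fun k => v ∈ T k).card) {q : V} (h : m' q < m q) :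
    ∃ k, q ∈ T k := by
  by_contra hcon
  push Not at hcon
  have := hm q
  simp [hcon] at this
  omega

/-- A clique containing a vertex with no further neighbours in `W`. -/
structure IsSimplicialPiece (G : SimpleGraph V) (W P : Finset V) (f : V) : Prop where
  subset : P ⊆ W
  mem : f ∈ P
  clique : ∀ u ∈ P, ∀ v ∈ P, u ≠ v → G.Adj u v
  nbr : ∀ w ∈ W, G.Adj f w → w ∈ P

theorem IsSimplicialPiece.isExchangePiece (hd : IsPureOfCard (indepCpx G) d) {P : Finset V} {f : V}
    (h : IsSimplicialPiece G Finset.univ P f) :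
    IsExchangePiece G P fun v => if v = f then 1 else 0 := by
  have hsum : ∀ s m, IsFacetSum G s m → ∑ v ∈ P, m v = s := by
    rintro s m ⟨T, hT, hm⟩
    simp only [hm, Finset.card_filter]
    rw [Finset.sum_comm]
    have : ∀ k, ∑ v ∈ P, (if v ∈ T k then 1 else 0) = 1 := by
      intro k
      have hex : ∃ v ∈ P, v ∈ T k := by
        by_contra hcon
        push Not at hcon
        exact hcon f h.mem (IsFacet.mem_of_forall_not_adj (hT k) fun u hu huf =>
          hcon u (h.nbr u (Finset.mem_univ _) huf.symm) hu)
      obtain ⟨v, hv, hvT⟩ := hex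
      rw [Finset.sum_eq_single_of_mem v hv]
      · simp [hvT]
      · intro u hu huv
        rw [if_neg]
        exact fun huT => (hT k).1 u huT v hvT (h.clique u hu v hv huv)
    simp [this]
  refine ⟨fun v hv hne => ?_, fun s m m' hm hm' q hq hag _ hlt => ?_⟩
  · left
    by_cases hvf : v = f
    · subst hvf
      exact fun w => h.nbr w (Finset.mem_univ _)
    · simp [hvf] at hne
  · have hne : q ≠ f := by
      rintro rfl
      have h1 := hsum s m hm
      have h2 := hsum s m' hm'
      have h3 : ∑ p ∈ P.erase q, m p = ∑ p ∈ P.erase q, m' p :=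
        Finset.sum_congr rfl fun p hp => hag p (Finset.mem_of_mem_erase hp) (by
          simp [Finset.ne_of_mem_erase hp])
      rw [← Finset.add_sum_erase _ _ hq, h3] at h1
      rw [← Finset.add_sum_erase _ _ hq] at h2
      omega
    refine ⟨f, h.mem, by simp [hne], ?_⟩
    obtain ⟨T, hT, hm⟩ := hm
    obtain ⟨k, hk⟩ := exists_mem_of_lt hm hlt
    refine hd.exists_facetSum_of_swap hT hm hk (h.clique q hq f h.mem hne) fun u hu hfu => ?_
    by_contra huq
    exact (hT k).1 u hu q hk (h.clique u (h.nbr u (Finset.mem_univ _) hfu) q hq huq)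

/-- An edge `x₁x₂` lying on a four-cycle `x₁x₂x₃x₄` and having no other neighbours in `W`. -/
structure IsSquarePiece (G : SimpleGraph V) (W P : Finset V) (x₁ x₂ x₃ x₄ : V) : Prop where
  eq : P = {x₁, x₂}
  mem₁ : x₁ ∈ W
  mem₂ : x₂ ∈ W
  mem₃ : x₃ ∈ W
  mem₄ : x₄ ∈ W
  ne₁₃ : x₁ ≠ x₃
  ne₂₄ : x₂ ≠ x₄
  nbr₁ : ∀ w ∈ W, G.Adj x₁ w ↔ w = x₂ ∨ w = x₄
  nbr₂ : ∀ w ∈ W, G.Adj x₂ w ↔ w = x₁ ∨ w = x₃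
  adj : G.Adj x₃ x₄
  ex₃ : ∃ w ∈ W, G.Adj x₃ w ∧ w ≠ x₂ ∧ w ≠ x₄
  ex₄ : ∃ w ∈ W, G.Adj x₄ w ∧ w ≠ x₁ ∧ w ≠ x₃

theorem IsSquarePiece.isExchangePiece (hd : IsPureOfCard (indepCpx G) d) {P : Finset V}
    {x₁ x₂ x₃ x₄ : V} (h : IsSquarePiece G Finset.univ P x₁ x₂ x₃ x₄) :
    IsExchangePiece G P fun v => if v = x₁ then 1 else 2 := by
  obtain ⟨rfl, -, -, -, -, h13, h24, n1, n2, h34, ⟨w3, -, hw3, hw32, hw34⟩, -⟩ := h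
  replace n1 := fun w => n1 w (Finset.mem_univ _)
  replace n2 := fun w => n2 w (Finset.mem_univ _)
  have a12 : G.Adj x₁ x₂ := (n1 _).2 (Or.inl rfl)
  have a14 : G.Adj x₁ x₄ := (n1 _).2 (Or.inr rfl)
  have a23 : G.Adj x₂ x₃ := (n2 _).2 (Or.inr rfl)
  have hpat : ∀ T, IsFacet (indepCpx G) T → (x₁ ∈ T ↔ x₂ ∉ T) ∧ (x₃ ∈ T → x₁ ∈ T) := by
    intro T hT
    have hA : x₁ ∈ T → x₂ ∉ T := fun h1 h2 => hT.1 _ h1 _ h2 a12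
    have hB : x₂ ∉ T → x₁ ∈ T := by
      intro h2
      by_contra h1
      have h4 : x₄ ∈ T := by
        by_contra h4
        refine h1 (IsFacet.mem_of_forall_not_adj hT fun u hu hu1 => ?_)
        rcases (n1 u).1 hu1.symm with rfl | rfl <;> contradiction
      have h3 : x₃ ∈ T := by
        by_contra h3
        refine h2 (IsFacet.mem_of_forall_not_adj hT fun u hu hu1 => ?_)
        rcases (n2 u).1 hu1.symm with rfl | rfl <;> contradiction
      exact hT.1 _ h3 _ h4 h34
    exact ⟨⟨hA, hB⟩, fun h3 => hB fun h2 => hT.1 _ h2 _ h3 a23⟩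
  have hsum : ∀ s m, IsFacetSum G s m → m x₁ + m x₂ = s ∧ m x₃ ≤ m x₁ := by
    rintro s m ⟨T, hT, hm⟩
    have h1 := Finset.card_filter_add_card_filter_not (s := (Finset.univ : Finset (Fin s)))
          (fun k => x₂ ∈ T k)
    rw [hm, hm, hm, Finset.filter_congr fun k _ => (hpat _ (hT k)).1]
    refine ⟨by simpa [add_comm] using h1, Finset.card_le_card fun k => ?_⟩
    simp only [Finset.mem_filter, Finset.mem_univ, true_and]
    exact fun h3 => (hpat _ (hT k)).1.1 ((hpat _ (hT k)).2 h3)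
  refine ⟨fun v hv hne => Or.inr ?_, fun s m m' hm hm' q hq hag hag0 hlt => ?_⟩
  · rcases Finset.mem_insert.1 hv with rfl | hv
    · exact ⟨_, _, fun w => (n1 w).1⟩
    · rw [Finset.mem_singleton] at hv
      subst hv
      exact ⟨_, _, fun w => (n2 w).1⟩
  · rcases Finset.mem_insert.1 hq with rfl | hq
    · refine ⟨x₂, by simp, by simp [a12.ne.symm], ?_⟩
      have h3 := hag0 (by simp) x₃ (by simp [h13.symm, a23.ne.symm]) ⟨x₂, by simp, a23.symm⟩ (by
        rintro ⟨a, b, hab⟩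
        have e1 := hab _ a23.symm
        have e2 := hab _ h34
        have e3 := hab _ hw3
        grind)
      have h4 := (hsum s m' hm').2
      obtain ⟨T, hT, hm⟩ := hm
      have hlt2 : m x₃ < m q := by omega
      rw [hm, hm] at hlt2
      obtain ⟨k, hk, hk3⟩ := Finset.exists_mem_notMem_of_card_lt_card hlt2
      simp only [Finset.mem_filter, Finset.mem_univ, true_and] at hk hk3
      refine hd.exists_facetSum_of_swap hT hm hk a12 fun u hu h2u => ?_
      rcases (n2 u).1 h2u with rfl | rfl
      · rfl
      · exact absurd hu hk3
    · rw [Finset.mem_singleton] at hq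
      subst hq
      have h1 := hag x₁ (by simp) (by simp [a12.ne.symm])
      have h2 := (hsum s m hm).1
      have h3 := (hsum s m' hm').1
      omega

end ExchangePieces

section PentagonPieces

variable {V : Type} [Fintype V] [DecidableEq V] {G : SimpleGraph V} {d : ℕ}

/-- A five-cycle `v₁v₂v₃v₄v₅` whose vertices other than `v₁` and `v₃` have no further
neighbours in `W`. -/
structure IsPentagonPiece (G : SimpleGraph V) (W P : Finset V) (v₁ v₂ v₃ v₄ v₅ : V) : Prop where
  eq : P = {v₁, v₂, v₃, v₄, v₅}
  subset : P ⊆ W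
  ne₁₃ : v₁ ≠ v₃
  ne₁₄ : v₁ ≠ v₄
  ne₂₄ : v₂ ≠ v₄
  ne₂₅ : v₂ ≠ v₅
  ne₃₅ : v₃ ≠ v₅
  nbr₂ : ∀ w ∈ W, G.Adj v₂ w ↔ w = v₁ ∨ w = v₃
  nbr₄ : ∀ w ∈ W, G.Adj v₄ w ↔ w = v₃ ∨ w = v₅
  nbr₅ : ∀ w ∈ W, G.Adj v₅ w ↔ w = v₄ ∨ w = v₁

omit [Fintype V] in
lemma IsPentagonPiece.reflect {W P : Finset V} {v₁ v₂ v₃ v₄ v₅ : V}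
    (h : IsPentagonPiece G W P v₁ v₂ v₃ v₄ v₅) : IsPentagonPiece G W P v₃ v₂ v₁ v₅ v₄ where
  eq := by rw [h.eq]; ext; simp only [Finset.mem_insert, Finset.mem_singleton]; tauto
  subset := h.subset
  ne₁₃ := h.ne₁₃.symm
  ne₁₄ := h.ne₃₅
  ne₂₄ := h.ne₂₅
  ne₂₅ := h.ne₂₄
  ne₃₅ := h.ne₁₄
  nbr₂ w hw := by rw [h.nbr₂ w hw, or_comm]
  nbr₄ w hw := by rw [h.nbr₅ w hw, or_comm]
  nbr₅ w hw := by rw [h.nbr₄ w hw, or_comm]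

/-- Outside the pentagon, `D` separates the neighbours of `v₁` from those of `v₃`. -/
structure IsPentagonSeparator (G : SimpleGraph V) (P D : Finset V) (v₁ v₃ : V) : Prop where
  disj : ∀ v ∈ D, v ∉ P
  left : ∀ v, G.Adj v₁ v → v ∉ P → v ∈ D
  closed : ∀ u ∈ D, ∀ v, G.Adj u v → v ∉ P → v ∈ D
  right : ∀ u ∈ D, ¬ G.Adj v₃ u

lemma IsPentagonSeparator.reflect {P D : Finset V} {v₁ v₃ : V}
    (h : IsPentagonSeparator G P D v₁ v₃) : IsPentagonSeparator G P (P ∪ D)ᶜ v₃ v₁ where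
  disj v hv := by simp at hv; exact hv.1
  left v hv hvP := by
    simp only [Finset.mem_compl, Finset.mem_union, not_or]
    exact ⟨hvP, fun hvD => h.right v hvD hv⟩
  closed u hu v huv hvP := by
    simp only [Finset.mem_compl, Finset.mem_union, not_or] at hu ⊢
    exact ⟨hvP, fun hvD => hu.2 (h.closed v hvD u huv.symm hu.1)⟩
  right u hu huv := by
    simp only [Finset.mem_compl, Finset.mem_union, not_or] at hu
    exact hu.2 (h.left u huv hu.1)

lemma IsPentagonPiece.exists_facetSum (hd : IsPureOfCard (indepCpx G) d) {P D : Finset V}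
    {v₁ v₂ v₃ v₄ v₅ : V} (h : IsPentagonPiece G Finset.univ P v₁ v₂ v₃ v₄ v₅)
    (hD : IsPentagonSeparator G P D v₁ v₃) {s : ℕ}
    {T : Fin s → Finset V} (hT : ∀ k, IsFacet (indepCpx G) (T k)) {m : V → ℕ}
    (hm : ∀ v, m v = (Finset.univ.filter fun k => v ∈ T k).card) {k₁ k₂ : Fin s}
    (h₁ : v₁ ∈ T k₁) (h₃ : v₃ ∈ T k₁) (h₂ : v₂ ∈ T k₂) (h₄ : v₄ ∈ T k₂) :
    ∃ m'', IsFacetSum G s m'' ∧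
      ∀ v, m'' v + (if v = v₂ then 1 else 0) = m v + (if v = v₅ then 1 else 0) := by
  have n2 := fun w => h.nbr₂ w (Finset.mem_univ _)
  have n4 := fun w => h.nbr₄ w (Finset.mem_univ _)
  have n5 := fun w => h.nbr₅ w (Finset.mem_univ _)
  have hP : ∀ v, v ∈ P ↔ v = v₁ ∨ v = v₂ ∨ v = v₃ ∨ v = v₄ ∨ v = v₅ := by
    intro v; rw [h.eq]; simp
  have a21 : G.Adj v₂ v₁ := (n2 _).2 (Or.inl rfl)
  have a23 : G.Adj v₂ v₃ := (n2 _).2 (Or.inr rfl)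
  have a43 : G.Adj v₄ v₃ := (n4 _).2 (Or.inl rfl)
  have a45 : G.Adj v₄ v₅ := (n4 _).2 (Or.inr rfl)
  have a51 : G.Adj v₅ v₁ := (n5 _).2 (Or.inr rfl)
  have i1 := (hT k₁).1
  have i2 := (hT k₂).1
  have b2 : v₂ ∉ T k₁ := fun hv => i1 _ hv _ h₁ a21
  have b4 : v₄ ∉ T k₁ := fun hv => i1 _ hv _ h₃ a43
  have b5 : v₅ ∉ T k₁ := fun hv => i1 _ hv _ h₁ a51
  have c1 : v₁ ∉ T k₂ := fun hv => i2 _ h₂ _ hv a21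
  have c3 : v₃ ∉ T k₂ := fun hv => i2 _ h₂ _ hv a23
  have c5 : v₅ ∉ T k₂ := fun hv => i2 _ h₄ _ hv a45
  have hk : k₁ ≠ k₂ := by rintro rfl; exact b2 h₂
  have hne1 := h.ne₁₃
  have hne2 := h.ne₁₄
  have hne3 := h.ne₂₄
  have hne4 := h.ne₂₅
  have hne5 := h.ne₃₅
  have d12 := a21.ne
  have d23 := a23.ne
  have d43 := a43.ne
  have d45 := a45.ne
  have d51 := a51.ne
  have hdisj := hD.disj
  have sym : ∀ A B : Finset V, indepCpx G A → indepCpx G B → (∀ u ∈ A, ∀ v ∈ B, ¬ G.Adj u v) →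
      indepCpx G (A ∪ B) := by
    intro A B hA hB hAB u hu v hv huv
    rcases Finset.mem_union.1 hu with hu | hu <;> rcases Finset.mem_union.1 hv with hv | hv
    · exact hA _ hu _ hv huv
    · exact hAB _ hu _ hv huv
    · exact hAB _ hv _ hu huv.symm
    · exact hB _ hu _ hv huv
  have hs := indepCpx_isSimplicialComplex G
  refine hd.exists_facetSum_of_replace_two hT hm hk (q := v₂) (p := v₅)
    (T₁ := insert v₄ ((T k₁).filter (fun v => v = v₁ ∨ v ∈ D) ∪
      (T k₂).filter fun v => v ∉ P ∧ v ∉ D))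
    (T₂ := insert v₅ ((T k₂).filter (fun v => v ∈ D) ∪
      (T k₁).filter fun v => v = v₃ ∨ (v ∉ P ∧ v ∉ D))) ?_ ?_ ?_
  · refine IsLinkVertex.indepCpx_insert (sym _ _ (hs _ _ i1 (Finset.filter_subset _ _))
      (hs _ _ i2 (Finset.filter_subset _ _)) ?_) ⟨?_, ?_⟩
    · intro u hu v hv huv
      simp only [Finset.mem_filter] at hu hv
      rcases hu.2 with rfl | hu'
      · exact hv.2.2 (hD.left _ huv hv.2.1)
      · exact hv.2.2 (hD.closed _ hu' _ huv hv.2.1)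
    · have := hP v₄
      simp only [Finset.mem_union, Finset.mem_filter]; tauto
    · intro u hu huv
      have h4 := (n4 _).1 huv.symm
      simp only [Finset.mem_union, Finset.mem_filter] at hu
      have := hP u
      rcases h4 with rfl | rfl
      · have := hdisj u
        grind
      · grind
  · refine IsLinkVertex.indepCpx_insert (sym _ _ (hs _ _ i2 (Finset.filter_subset _ _))
      (hs _ _ i1 (Finset.filter_subset _ _)) ?_) ⟨?_, ?_⟩
    · intro u hu v hv huv
      simp only [Finset.mem_filter] at hu hv
      rcases hv.2 with rfl | hv'
      · exact hD.right _ hu.2 huv.symm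
      · exact hv'.2 (hD.closed _ hu.2 _ huv hv'.1)
    · have := hP v₅
      simp only [Finset.mem_union, Finset.mem_filter]; tauto
    · intro u hu huv
      have h5 := (n5 _).1 huv.symm
      simp only [Finset.mem_union, Finset.mem_filter] at hu
      have := hP u
      have := hdisj u
      grind
  · intro v
    have hPv := hP v
    have hdv := hdisj v
    simp only [Finset.mem_insert, Finset.mem_union, Finset.mem_filter]
    by_cases hv : v ∈ P
    · rcases hPv.1 hv with rfl | rfl | rfl | rfl | rfl <;> grind
    · grind

/-- The exchange ranks on a pentagon. -/
def pentagonRank (v₂ v₄ v₅ : V) (v : V) : ℕ :=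
  if v = v₂ then 1 else if v = v₄ then 2 else if v = v₅ then 3 else 0

lemma IsPentagonPiece.facet_pattern {P : Finset V}
    {v₁ v₂ v₃ v₄ v₅ : V} (h : IsPentagonPiece G Finset.univ P v₁ v₂ v₃ v₄ v₅)
    {T : Finset V} (hT : IsFacet (indepCpx G) T) :
    ¬ (v₂ ∈ T ∧ v₁ ∈ T) ∧ ¬ (v₂ ∈ T ∧ v₃ ∈ T) ∧
      ¬ (v₄ ∈ T ∧ v₃ ∈ T) ∧ ¬ (v₄ ∈ T ∧ v₅ ∈ T) ∧ ¬ (v₅ ∈ T ∧ v₁ ∈ T) ∧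
      (v₁ ∈ T ∨ v₂ ∈ T ∨ v₃ ∈ T) ∧ (v₃ ∈ T ∨ v₄ ∈ T ∨ v₅ ∈ T) ∧
      (v₄ ∈ T ∨ v₅ ∈ T ∨ v₁ ∈ T) := by
  have n2 := fun w => h.nbr₂ w (Finset.mem_univ _)
  have n4 := fun w => h.nbr₄ w (Finset.mem_univ _)
  have n5 := fun w => h.nbr₅ w (Finset.mem_univ _)
  have a21 : G.Adj v₂ v₁ := (n2 _).2 (Or.inl rfl)
  have a23 : G.Adj v₂ v₃ := (n2 _).2 (Or.inr rfl)
  have a43 : G.Adj v₄ v₃ := (n4 _).2 (Or.inl rfl)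
  have a45 : G.Adj v₄ v₅ := (n4 _).2 (Or.inr rfl)
  have a51 : G.Adj v₅ v₁ := (n5 _).2 (Or.inr rfl)
  have hmax : ∀ v a b, (∀ w, G.Adj v w ↔ w = a ∨ w = b) → a ∈ T ∨ v ∈ T ∨ b ∈ T := by
    intro v a b hv
    by_contra hcon
    push Not at hcon
    refine hcon.2.1 (IsFacet.mem_of_forall_not_adj hT fun u hu huv => ?_)
    rcases (hv u).1 huv.symm with rfl | rfl
    · exact hcon.1 hu
    · exact hcon.2.2 hu
  exact ⟨fun h => hT.1 _ h.1 _ h.2 a21, fun h => hT.1 _ h.1 _ h.2 a23,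
    fun h => hT.1 _ h.1 _ h.2 a43, fun h => hT.1 _ h.1 _ h.2 a45,
    fun h => hT.1 _ h.1 _ h.2 a51, hmax _ _ _ n2, hmax _ _ _ n4, hmax _ _ _ n5⟩

lemma IsPentagonPiece.exists_card_identities {P : Finset V}
    {v₁ v₂ v₃ v₄ v₅ : V} (h : IsPentagonPiece G Finset.univ P v₁ v₂ v₃ v₄ v₅)
    {s : ℕ} {T : Fin s → Finset V} (hT : ∀ k, IsFacet (indepCpx G) (T k)) {m : V → ℕ}
    (hm : ∀ v, m v = (Finset.univ.filter fun k => v ∈ T k).card) :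
    ∃ n₁₃ n₂₄, m v₁ + m v₂ + m v₃ = s + n₁₃ ∧ m v₄ + m v₅ + n₁₃ = s ∧
        m v₄ + n₁₃ = m v₁ + n₂₄ ∧ (0 < n₁₃ → ∃ k, v₁ ∈ T k ∧ v₃ ∈ T k) ∧
        (0 < n₂₄ → ∃ k, v₂ ∈ T k ∧ v₄ ∈ T k) := by
  refine ⟨(Finset.univ.filter fun k => v₁ ∈ T k ∧ v₃ ∈ T k).card,
    (Finset.univ.filter fun k => v₂ ∈ T k ∧ v₄ ∈ T k).card, ?_, ?_, ?_, ?_, ?_⟩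
  · refine Eq.trans ?_ (congrArg (· + _) (by simp : ∑ k : Fin s, 1 = s))
    simp only [hm, Finset.card_filter, ← Finset.sum_add_distrib]
    refine Finset.sum_congr rfl fun k _ => ?_
    have := h.facet_pattern (hT k)
    grind
  · refine Eq.trans ?_ (by simp : ∑ k : Fin s, 1 = s)
    simp only [hm, Finset.card_filter, ← Finset.sum_add_distrib]
    refine Finset.sum_congr rfl fun k _ => ?_
    have := h.facet_pattern (hT k)
    grind
  · simp only [hm, Finset.card_filter, ← Finset.sum_add_distrib]
    refine Finset.sum_congr rfl fun k _ => ?_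
    have := h.facet_pattern (hT k)
    grind
  · intro hpos
    obtain ⟨k, hk⟩ := Finset.card_pos.1 hpos
    exact ⟨k, by simpa using hk⟩
  · intro hpos
    obtain ⟨k, hk⟩ := Finset.card_pos.1 hpos
    exact ⟨k, by simpa using hk⟩

theorem IsPentagonPiece.isExchangePiece (hd : IsPureOfCard (indepCpx G) d) {P D : Finset V}
    {v₁ v₂ v₃ v₄ v₅ : V} (h : IsPentagonPiece G Finset.univ P v₁ v₂ v₃ v₄ v₅)
    (hD : IsPentagonSeparator G P D v₁ v₃) :
    IsExchangePiece G P (pentagonRank v₂ v₄ v₅) := by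
  have n2 := fun w => h.nbr₂ w (Finset.mem_univ _)
  have n4 := fun w => h.nbr₄ w (Finset.mem_univ _)
  have n5 := fun w => h.nbr₅ w (Finset.mem_univ _)
  have hP : ∀ v, v ∈ P ↔ v = v₁ ∨ v = v₂ ∨ v = v₃ ∨ v = v₄ ∨ v = v₅ := by
    intro v; rw [h.eq]; simp
  have a21 : G.Adj v₂ v₁ := (n2 _).2 (Or.inl rfl)
  have a23 : G.Adj v₂ v₃ := (n2 _).2 (Or.inr rfl)
  have a43 : G.Adj v₄ v₃ := (n4 _).2 (Or.inl rfl)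
  have a45 : G.Adj v₄ v₅ := (n4 _).2 (Or.inr rfl)
  have a51 : G.Adj v₅ v₁ := (n5 _).2 (Or.inr rfl)
  have hne1 := h.ne₁₃
  have hne2 := h.ne₁₄
  have hne3 := h.ne₂₄
  have hne4 := h.ne₂₅
  have hne5 := h.ne₃₅
  have d12 := a21.ne
  have d23 := a23.ne
  have d43 := a43.ne
  have d45 := a45.ne
  have d51 := a51.ne
  have r1 : pentagonRank v₂ v₄ v₅ v₁ = 0 := by simp [pentagonRank, d12.symm, hne2, d51.symm]
  have r2 : pentagonRank v₂ v₄ v₅ v₂ = 1 := by simp [pentagonRank]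
  have r3 : pentagonRank v₂ v₄ v₅ v₃ = 0 := by simp [pentagonRank, d23.symm, hne5, d43.symm]
  have r4 : pentagonRank v₂ v₄ v₅ v₄ = 2 := by simp [pentagonRank, hne3.symm]
  have r5 : pentagonRank v₂ v₄ v₅ v₅ = 3 := by simp [pentagonRank, hne4.symm, d45.symm]
  have p1 : v₁ ∈ P := by simp [hP]
  have p2 : v₂ ∈ P := by simp [hP]
  have p3 : v₃ ∈ P := by simp [hP]
  have p4 : v₄ ∈ P := by simp [hP]
  have p5 : v₅ ∈ P := by simp [hP]
  refine ⟨fun v hv hne => Or.inr ?_, fun s m m' hm hm' q hq hag _ hlt => ?_⟩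
  · rcases (hP v).1 hv with rfl | rfl | rfl | rfl | rfl
    · exact absurd r1 hne
    · exact ⟨_, _, fun w => (n2 w).1⟩
    · exact absurd r3 hne
    · exact ⟨_, _, fun w => (n4 w).1⟩
    · exact ⟨_, _, fun w => (n5 w).1⟩
  · obtain ⟨T, hT, hm⟩ := hm
    obtain ⟨T', hT', hm'⟩ := hm'
    obtain ⟨a, b, e1, e2, e3, ha, hb⟩ := h.exists_card_identities hT hm
    obtain ⟨a', b', e1', e2', e3', -, -⟩ := h.exists_card_identities hT' hm'
    obtain ⟨k, hk⟩ := exists_mem_of_lt hm hlt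
    have hpk := h.facet_pattern (hT k)
    rcases (hP q).1 hq with rfl | rfl | rfl | rfl | rfl
    · by_cases h4 : v₄ ∈ T k
      · refine ⟨v₂, p2, by omega, hd.exists_facetSum_of_swap hT hm hk a21.symm fun u hu h2u => ?_⟩
        rcases (n2 u).1 h2u with rfl | rfl
        · rfl
        · grind
      · refine ⟨v₅, p5, by omega, hd.exists_facetSum_of_swap hT hm hk a51.symm fun u hu h2u => ?_⟩
        rcases (n5 u).1 h2u with rfl | rfl
        · grind
        · rfl
    · have f1 := hag v₁ p1 (by omega)
      have f3 := hag v₃ p3 (by omega)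
      obtain ⟨k₁, hk1, hk3⟩ := ha (by omega)
      by_cases h4 : v₄ ∈ T k
      · exact ⟨v₅, p5, by omega, h.exists_facetSum hd hD hT hm hk1 hk3 hk h4⟩
      · exact ⟨v₄, p4, by omega, h.reflect.exists_facetSum hd hD.reflect hT hm hk3 hk1 hk
          (by grind)⟩
    · by_cases h1 : v₁ ∈ T k
      · refine ⟨v₄, p4, by omega, hd.exists_facetSum_of_swap hT hm hk a43.symm fun u hu h2u => ?_⟩
        rcases (n4 u).1 h2u with rfl | rfl
        · rfl
        · grind
      · refine ⟨v₂, p2, by omega, hd.exists_facetSum_of_swap hT hm hk a23.symm fun u hu h2u => ?_⟩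
        rcases (n2 u).1 h2u with rfl | rfl
        · grind
        · rfl
    · have f1 := hag v₁ p1 (by omega)
      have f2 := hag v₂ p2 (by omega)
      have f3 := hag v₃ p3 (by omega)
      obtain ⟨k₁, hk2, hk4⟩ := hb (by omega)
      have hpk1 := h.facet_pattern (hT k₁)
      refine ⟨v₅, p5, by omega, hd.exists_facetSum_of_swap hT hm hk4 a45 fun u hu h2u => ?_⟩
      rcases (n5 u).1 h2u with rfl | rfl
      · rfl
      · grind
    · have f1 := hag v₁ p1 (by omega)
      have f2 := hag v₂ p2 (by omega)
      have f3 := hag v₃ p3 (by omega)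
      have f4 := hag v₄ p4 (by omega)
      omega

end PentagonPieces

section Chordal

variable {V : Type} {G : SimpleGraph V}

/-- `y` can be reached from `x` along a walk all of whose later vertices lie in `S`. -/
def ReachableIn (G : SimpleGraph V) (S : V → Prop) : V → V → Prop :=
  Relation.ReflTransGen fun x y => G.Adj x y ∧ S y

lemma ReachableIn.mono {S S' : V → Prop} (h : ∀ v, S v → S' v) {x y : V}
    (hxy : ReachableIn G S x y) : ReachableIn G S' x y :=
  Relation.ReflTransGen.mono (r := fun x y => G.Adj x y ∧ S y) (p := fun x y => G.Adj x y ∧ S' y)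
    (fun _ _ h' => ⟨h'.1, h _ h'.2⟩) _ _ hxy

lemma ReachableIn.mem {S : V → Prop} {x y : V} (hx : S x) (hxy : ReachableIn G S x y) : S y := by
  induction hxy with
  | refl => exact hx
  | tail _ h _ => exact h.2

lemma ReachableIn.symm {S : V → Prop} {x y : V} (hx : S x) (hxy : ReachableIn G S x y) :
    ReachableIn G S y x := by
  induction hxy with
  | refl => exact Relation.ReflTransGen.refl
  | tail h₁ h₂ ih => exact Relation.ReflTransGen.head ⟨h₂.1.symm, ReachableIn.mem hx h₁⟩ ih

lemma ReachableIn.exists_walk {S : V → Prop} {x y : V} (hxy : ReachableIn G S x y) :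
    ∃ p : G.Walk x y, ∀ w ∈ p.support, w = x ∨ S w := by
  induction hxy with
  | refl => exact ⟨.nil, by simp⟩
  | tail _ h₂ ih =>
    obtain ⟨p, hp⟩ := ih
    refine ⟨p.concat h₂.1, fun w hw => ?_⟩
    rw [SimpleGraph.Walk.support_concat, List.mem_append, List.mem_singleton] at hw
    rcases hw with hw | rfl
    · exact hp w hw
    · exact Or.inr h₂.2

lemma ReachableIn.exists_isPath [DecidableEq V] {S : V → Prop} {x y : V}
    (hxy : ReachableIn G S x y) :
    ∃ p : G.Walk x y, p.IsPath ∧ ∀ w ∈ p.support, w = x ∨ S w := by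
  obtain ⟨p, hp⟩ := hxy.exists_walk
  exact ⟨p.bypass, p.bypass_isPath, fun w hw => hp w (p.support_bypass_subset_support hw)⟩

/-- A walk of minimal length inside a vertex set has no chords. -/
lemma exists_chordless_path [DecidableEq V] {S : V → Prop} {x y : V} (hxy : ReachableIn G S x y) :
    ∃ p : G.Walk x y, p.IsPath ∧ (∀ w ∈ p.support, w = x ∨ S w) ∧
      ∀ a ∈ p.support, ∀ b ∈ p.support, G.Adj a b → s(a, b) ∈ p.edges := by
  have hex : ∃ n, ∃ p : G.Walk x y, p.length = n ∧ ∀ w ∈ p.support, w = x ∨ S w := by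
    obtain ⟨p, hp⟩ := hxy.exists_walk
    exact ⟨_, p, rfl, hp⟩
  classical
  obtain ⟨p, hlen, hp⟩ := Nat.find_spec hex
  have hmin : ∀ p' : G.Walk x y, (∀ w ∈ p'.support, w = x ∨ S w) → p.length ≤ p'.length :=
    fun p' hp' => hlen ▸ Nat.find_min' hex ⟨p', rfl, hp'⟩
  have key : ∀ {a b : V} (p₁ : G.Walk x a) (p₂ : G.Walk a b) (p₃ : G.Walk b y),
      p₁.append (p₂.append p₃) = p.bypass → G.Adj a b → s(a, b) ∈ p.bypass.edges := by
    intro a b p₁ p₂ p₃ he hab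
    have h3 := hmin (p₁.append (.cons hab p₃)) (by
      intro w hw
      refine hp _ (p.support_bypass_subset_support ?_)
      rw [← he]
      simp only [SimpleGraph.Walk.mem_support_append_iff, SimpleGraph.Walk.support_cons,
        List.mem_cons] at hw ⊢
      rcases hw with hw | rfl | hw
      · exact Or.inl hw
      · exact Or.inl (SimpleGraph.Walk.end_mem_support _)
      · exact Or.inr (Or.inr hw))
    have h4 := p.length_bypass_le_length
    rw [← he] at h4 ⊢
    simp only [SimpleGraph.Walk.length_append, SimpleGraph.Walk.length_cons] at h3 h4
    have h5 : p₂.length ≤ 1 := by omega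
    simp only [SimpleGraph.Walk.edges_append, List.mem_append]
    refine Or.inr (Or.inl ?_)
    cases p₂ with
    | nil => exact absurd rfl hab.ne
    | cons h q =>
      cases q with
      | nil => simp
      | cons h' q => simp at h5
  refine ⟨p.bypass, p.bypass_isPath, fun w hw => hp w (p.support_bypass_subset_support hw),
    fun a ha b hb hab => ?_⟩
  have hb' := hb
  rw [← p.bypass.take_spec ha, SimpleGraph.Walk.mem_support_append_iff] at hb'
  rcases hb' with hb' | hb'
  · rw [Sym2.eq_swap]
    refine key ((p.bypass.takeUntil a ha).takeUntil b hb')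
      ((p.bypass.takeUntil a ha).dropUntil b hb') (p.bypass.dropUntil a ha) ?_ hab.symm
    rw [SimpleGraph.Walk.append_assoc, SimpleGraph.Walk.take_spec, SimpleGraph.Walk.take_spec]
  · refine key (p.bypass.takeUntil a ha) ((p.bypass.dropUntil a ha).takeUntil b hb')
      ((p.bypass.dropUntil a ha).dropUntil b hb') ?_ hab
    rw [SimpleGraph.Walk.take_spec, SimpleGraph.Walk.take_spec]

/-- In a chordal graph, two nonadjacent neighbours of `v` are separated by the closed
neighbourhood of `v`. -/
lemma IsChordal.not_reachableIn [DecidableEq V] (hG : IsChordal G) {v a b : V}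
    (ha : G.Adj v a) (hb : G.Adj v b) (hab : a ≠ b) (hnab : ¬ G.Adj a b)
    (h : ReachableIn G (fun w => w ≠ v ∧ (G.Adj v w → w = b)) a b) : False := by
  obtain ⟨p, hp, hS, hch⟩ := exists_chordless_path h
  have hv : v ∉ p.support := fun hv => by
    rcases hS v hv with h | h
    · exact ha.ne h
    · exact h.1 rfl
  have hlen : 2 ≤ p.length := by
    cases p with
    | nil => exact absurd rfl hab
    | cons h q =>
      cases q with
      | nil => exact absurd h hnab
      | cons h' q => simp
  have hcyc : (SimpleGraph.Walk.cons ha (p.concat hb.symm)).IsCycle := by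
    rw [SimpleGraph.Walk.cons_isCycle_iff]
    refine ⟨hp.concat hv _, fun he => ?_⟩
    rw [SimpleGraph.Walk.edges_concat, List.concat_eq_append, List.mem_append,
      List.mem_singleton] at he
    rcases he with he | he
    · exact hv (p.fst_mem_support_of_mem_edges he)
    · rw [Sym2.eq_swap, Sym2.congr_left] at he
      exact hab he
  obtain ⟨x, y, hx, hy, hxy, hne⟩ := hG v _ hcyc (by simp; omega)
  refine hne ?_
  simp only [SimpleGraph.Walk.support_cons, SimpleGraph.Walk.support_concat,
    List.mem_append, List.mem_cons] at hx hy
  simp only [SimpleGraph.Walk.edges_cons, SimpleGraph.Walk.edges_concat,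
    List.concat_eq_append, List.mem_append, List.mem_cons]
  have hnb : ∀ y ∈ p.support, G.Adj v y → y = a ∨ y = b := fun y hy hvy =>
    (hS y hy).imp id fun h => h.2 hvy
  have hx' : x = v ∨ x ∈ p.support := by tauto
  have hy' : y = v ∨ y ∈ p.support := by tauto
  rcases hx' with rfl | hx' <;> rcases hy' with rfl | hy'
  · exact absurd rfl hxy.ne
  · rcases hnb y hy' hxy with rfl | rfl
    · exact Or.inl rfl
    · exact Or.inr (Or.inr (Or.inl Sym2.eq_swap))
  · rcases hnb x hx' hxy.symm with rfl | rfl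
    · exact Or.inl Sym2.eq_swap
    · exact Or.inr (Or.inr (Or.inl rfl))
  · exact Or.inr (Or.inl (hch x hx' y hy' hxy))

/-- Dirac's lemma: some vertex not adjacent to `v` is simplicial in `U`. -/
lemma IsChordal.exists_simplicial_not_adj [DecidableEq V] (hG : IsChordal G) (U : Finset V) :
    ∀ v ∈ U, ∀ u ∈ U, u ≠ v → ¬ G.Adj v u → ∃ f ∈ U, f ≠ v ∧ ¬ G.Adj v f ∧
      ∀ x ∈ U, ∀ y ∈ U, G.Adj f x → G.Adj f y → x ≠ y → G.Adj x y := by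
  classical
  induction U using Finset.strongInduction with
  | H U ih =>
  intro v hv u hu huv hnadj
  set Sv : V → Prop := fun w => w ∈ U ∧ w ≠ v ∧ ¬ G.Adj v w
  have hSu : Sv u := ⟨hu, huv, hnadj⟩
  set C := U.filter fun x => ReachableIn G Sv u x with hC
  set S := U.filter fun s => G.Adj v s ∧ ∃ c ∈ C, G.Adj s c with hS
  have hCS : ∀ c ∈ C, Sv c := fun c hc => by
    rw [hC, Finset.mem_filter] at hc
    exact hc.2.mem hSu
  have huC : u ∈ C := by
    rw [hC, Finset.mem_filter]
    exact ⟨hu, Relation.ReflTransGen.refl⟩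
  have hSclique : ∀ s ∈ S, ∀ t ∈ S, s ≠ t → G.Adj s t := by
    intro s hs t ht hst
    rw [hS, Finset.mem_filter] at hs ht
    obtain ⟨hsU, hvs, c, hc, hsc⟩ := hs
    obtain ⟨htU, hvt, c', hc', htc⟩ := ht
    by_contra hnst
    have h1 : ReachableIn G Sv c c' := by
      rw [hC, Finset.mem_filter] at hc hc'
      exact (hc.2.symm hSu).trans hc'.2
    have h2 : ReachableIn G (fun w => w ≠ v ∧ (G.Adj v w → w = t)) c c' :=
      h1.mono fun w hw => ⟨hw.2.1, fun h => absurd h hw.2.2⟩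
    refine hG.not_reachableIn hvs hvt hst hnst
      ((Relation.ReflTransGen.head ⟨hsc, ?_⟩ h2).tail ⟨htc.symm, hvt.ne.symm, fun _ => rfl⟩)
    exact ⟨(hCS c hc).2.1, fun h => absurd h (hCS c hc).2.2⟩
  have hnbr : ∀ c ∈ C, ∀ x ∈ U, G.Adj c x → x ∈ C ∪ S := by
    intro c hc x hx hcx
    have hcS := hCS c hc
    rw [Finset.mem_union]
    by_cases hvx : G.Adj v x
    · refine Or.inr ?_
      rw [hS, Finset.mem_filter]
      exact ⟨hx, hvx, c, hc, hcx.symm⟩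
    · refine Or.inl ?_
      rw [hC, Finset.mem_filter] at hc ⊢
      refine ⟨hx, hc.2.tail ⟨hcx, hx, ?_, hvx⟩⟩
      rintro rfl
      exact hcS.2.2 hcx.symm
  have hsub : C ∪ S ⊂ U := by
    refine (Finset.ssubset_iff_of_subset (Finset.union_subset (Finset.filter_subset _ _)
      (Finset.filter_subset _ _))).2 ⟨v, hv, fun h => ?_⟩
    rcases Finset.mem_union.1 h with h | h
    · exact (hCS v h).2.1 rfl
    · exact (Finset.mem_filter.1 h).2.1.ne rfl
  have hfin : ∀ f ∈ C, (∀ x ∈ C ∪ S, ∀ y ∈ C ∪ S, G.Adj f x → G.Adj f y → x ≠ y → G.Adj x y) →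
      ∃ f ∈ U, f ≠ v ∧ ¬ G.Adj v f ∧
      ∀ x ∈ U, ∀ y ∈ U, G.Adj f x → G.Adj f y → x ≠ y → G.Adj x y :=
    fun f hf h => ⟨f, (hCS f hf).1, (hCS f hf).2.1, (hCS f hf).2.2, fun x hx y hy hfx hfy =>
      h x (hnbr f hf x hx hfx) y (hnbr f hf y hy hfy) hfx hfy⟩
  by_cases h1 : ∃ s ∈ S, ∃ t ∈ C ∪ S, t ≠ s ∧ ¬ G.Adj s t
  · obtain ⟨s, hs, t, ht, hts, hst⟩ := h1
    obtain ⟨f, hf, hfs, hsf, hsimp⟩ := ih _ hsub s (Finset.mem_union_right _ hs) t ht hts hst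
    refine hfin f ?_ hsimp
    rcases Finset.mem_union.1 hf with h | h
    · exact h
    · exact absurd (hSclique s hs f h hfs.symm) hsf
  push Not at h1
  by_cases h2 : ∃ x ∈ C ∪ S, ∃ y ∈ C ∪ S, y ≠ x ∧ ¬ G.Adj x y
  · obtain ⟨x, hx, y, hy, hyx, hxy⟩ := h2
    obtain ⟨f, hf, hfs, hsf, hsimp⟩ := ih _ hsub x hx y hy hyx hxy
    refine hfin f ?_ hsimp
    rcases Finset.mem_union.1 hf with h | h
    · exact h
    · exact absurd (h1 f h x hx hfs.symm).symm hsf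
  · push Not at h2
    exact hfin u huC fun x hx y hy _ _ hxy => h2 x hx y hy hxy.symm

lemma IsChordal.exists_simplicial [DecidableEq V] (hG : IsChordal G) {U : Finset V}
    (hU : U.Nonempty) :
    ∃ f ∈ U, ∀ x ∈ U, ∀ y ∈ U, G.Adj f x → G.Adj f y → x ≠ y → G.Adj x y := by
  by_cases h : ∃ x ∈ U, ∃ y ∈ U, y ≠ x ∧ ¬ G.Adj x y
  · obtain ⟨x, hx, y, hy, hyx, hxy⟩ := h
    obtain ⟨f, hf, -, -, hs⟩ := hG.exists_simplicial_not_adj U x hx y hy hyx hxy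
    exact ⟨f, hf, hs⟩
  · push Not at h
    obtain ⟨u, hu⟩ := hU
    exact ⟨u, hu, fun x hx y hy _ _ hxy => h x hx y hy hxy.symm⟩

/-- A chordal graph whose independent sets have at most `d` elements is covered by `d` cliques. -/
lemma IsChordal.exists_clique_cover [Fintype V] [DecidableEq V] (hG : IsChordal G) {d : ℕ}
    (hd : ∀ F, indepCpx G F → F.card ≤ d) (U : Finset V) :
    ∀ F, indepCpx G F → (∀ v, v ∈ U ↔ IsLinkVertex G F v) →
    ∃ 𝒬 : Finset (Finset V), (∀ Q ∈ 𝒬, ∀ x ∈ Q, ∀ y ∈ Q, x ≠ y → G.Adj x y) ∧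
      (∀ v ∈ U, ∃ Q ∈ 𝒬, v ∈ Q) ∧ 𝒬.card + F.card ≤ d := by
  classical
  induction U using Finset.strongInduction with
  | H U ih =>
  intro F hF hU
  rcases U.eq_empty_or_nonempty with rfl | hne
  · exact ⟨∅, by simp, by simp, by simpa using hd F hF⟩
  obtain ⟨f, hf, hs⟩ := hG.exists_simplicial hne
  have hfl := (hU f).1 hf
  set Q := U.filter fun w => w = f ∨ G.Adj f w with hQ
  have hmQ : ∀ w, w ∈ Q ↔ w ∈ U ∧ (w = f ∨ G.Adj f w) := fun w => by rw [hQ, Finset.mem_filter]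
  obtain ⟨𝒬, h1, h2, h3⟩ := ih (U \ Q) (Finset.ssubset_iff_of_subset Finset.sdiff_subset |>.2
    ⟨f, hf, by simp [hmQ, hf]⟩) (insert f F) (hfl.indepCpx_insert hF) (fun v => by
      rw [Finset.mem_sdiff, hmQ, hU]
      simp only [IsLinkVertex, Finset.mem_insert, forall_eq_or_imp]
      tauto)
  refine ⟨insert Q 𝒬, ?_, ?_, ?_⟩
  · intro Q' hQ' x hx y hy hxy
    rcases Finset.mem_insert.1 hQ' with rfl | hQ'
    · rw [hmQ] at hx hy
      rcases hx with ⟨hxU, rfl | hx⟩ <;> rcases hy with ⟨hyU, rfl | hy⟩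
      · exact absurd rfl hxy
      · exact hy
      · exact hx.symm
      · exact hs x hxU y hyU hx hy hxy
    · exact h1 Q' hQ' x hx y hy hxy
  · intro v hv
    by_cases hvQ : v ∈ Q
    · exact ⟨Q, Finset.mem_insert_self _ _, hvQ⟩
    · obtain ⟨Q', hQ', hv'⟩ := h2 v (Finset.mem_sdiff.2 ⟨hv, hvQ⟩)
      exact ⟨Q', Finset.mem_insert_of_mem hQ', hv'⟩
  · have := Finset.card_insert_le Q 𝒬
    rw [Finset.card_insert_of_notMem hfl.1] at h3
    omega

end Chordal

section ChordalPieces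

variable {V : Type} [Fintype V] [DecidableEq V] {G : SimpleGraph V} {d : ℕ}

omit [Fintype V] in
lemma IsPureOfCard.inter_nonempty_of_clique_cover (hd : IsPureOfCard (indepCpx G) d)
    {𝒬 : Finset (Finset V)} (h𝒬 : ∀ Q ∈ 𝒬, ∀ x ∈ Q, ∀ y ∈ Q, x ≠ y → G.Adj x y)
    (hcov : ∀ v, ∃ Q ∈ 𝒬, v ∈ Q) (hcard : 𝒬.card ≤ d) {T : Finset V}
    (hT : IsFacet (indepCpx G) T) {Q : Finset V} (hQ : Q ∈ 𝒬) : ∃ v ∈ Q, v ∈ T := by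
  by_contra hcon
  push Not at hcon
  choose q hq hvq using hcov
  have hlt : (𝒬.erase Q).card < T.card := by
    rw [Finset.card_erase_of_mem hQ, hd _ hT]
    have := Finset.card_pos.2 ⟨Q, hQ⟩
    omega
  obtain ⟨x, hx, y, hy, hxy, he⟩ := Finset.exists_ne_map_eq_of_card_lt_of_maps_to hlt
    (f := q) (fun x hx => Finset.mem_erase.2 ⟨fun h => hcon x (h ▸ hvq x) hx, hq x⟩)
  exact hT.1 x hx y hy (h𝒬 _ (hq x) x (hvq x) y (he ▸ hvq y) hxy)

/-- In a chordal graph, some vertex of a component `C` of the complement of a clique `Q` is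
adjacent to all vertices of `Q` that have a neighbour in `C`. -/
lemma IsChordal.exists_dominating_vertex (hG : IsChordal G) {Q : Finset V}
    (hQ : ∀ x ∈ Q, ∀ y ∈ Q, x ≠ y → G.Adj x y) {z : V} (hz : z ∉ Q) :
    ∃ u, ReachableIn G (· ∉ Q) z u ∧
      ∀ y ∈ Q, ∀ c, ReachableIn G (· ∉ Q) z c → G.Adj c y → G.Adj u y := by
  classical
  obtain ⟨u, hu, hmax⟩ := Finset.exists_max_image
    (Finset.univ.filter fun u => ReachableIn G (· ∉ Q) z u) (fun u => (Q.filter (G.Adj u)).card)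
    ⟨z, Finset.mem_filter.2 ⟨Finset.mem_univ _, Relation.ReflTransGen.refl⟩⟩
  simp only [Finset.mem_filter, Finset.mem_univ, true_and] at hu hmax
  refine ⟨u, hu, fun y hy c hc hcy => ?_⟩
  by_contra huy
  have huQ : u ∉ Q := ReachableIn.mem (S := (· ∉ Q)) hz hu
  have hstep : ∀ c, ReachableIn G (· ∉ Q) u c →
      ReachableIn G (fun w => w ∉ Q ∧ ¬ G.Adj w y) u c ∨ ∃ t c',
        ReachableIn G (fun w => w ∉ Q ∧ ¬ G.Adj w y) u t ∧ G.Adj t c' ∧ c' ∉ Q ∧ G.Adj c' y := by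
    intro c hc
    induction hc with
    | refl => exact Or.inl Relation.ReflTransGen.refl
    | @tail b e _ h ih =>
      rcases ih with ih | ih
      · by_cases hey : G.Adj e y
        · exact Or.inr ⟨b, e, ih, h.1, h.2, hey⟩
        · exact Or.inl (ih.tail ⟨h.1, h.2, hey⟩)
      · exact Or.inr ih
  rcases hstep c ((ReachableIn.symm (S := (· ∉ Q)) hz hu).trans hc) with
    h | ⟨t, c', h, htc, hcQ, hcy'⟩
  · exact (ReachableIn.mem (S := fun w => w ∉ Q ∧ ¬ G.Adj w y) ⟨huQ, huy⟩ h).2 hcy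
  have hzc : ReachableIn G (· ∉ Q) z c' :=
    hu.trans ((h.mono fun w hw => hw.1).tail ⟨htc, hcQ⟩)
  have hlt : (Q.filter (G.Adj u)).card < (Q.filter (G.Adj c')).card := by
    refine Finset.card_lt_card (Finset.ssubset_iff_of_subset (fun x hx => ?_) |>.2
      ⟨y, by simp [hy, hcy'], by simp [huy]⟩)
    rw [Finset.mem_filter] at hx ⊢
    refine ⟨hx.1, ?_⟩
    by_contra hcx
    have hxy : y ≠ x := by rintro rfl; exact huy hx.2
    have hxc : x ≠ c' := by rintro rfl; exact hcQ hx.1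
    refine hG.not_reachableIn (hQ y hy x hx.1 hxy) hcy'.symm hxc (fun h => hcx h.symm) ?_
    have h' : ReachableIn G (fun w => w ≠ y ∧ (G.Adj y w → w = c')) u t :=
      h.mono fun w hw => ⟨fun he => hw.1 (he ▸ hy), fun he => absurd he.symm hw.2⟩
    refine (Relation.ReflTransGen.head ⟨hx.2.symm, ?_, ?_⟩ h').tail ⟨htc, ?_, fun _ => rfl⟩
    · rintro rfl; exact hcQ hy
    · rintro rfl; exact huQ hy
    · exact fun he => absurd he.symm huy
  exact absurd (hmax c' hzc) (by omega)

lemma IsChordal.exists_private_of_meets (hG : IsChordal G) {Q : Finset V}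
    (hQ : ∀ x ∈ Q, ∀ y ∈ Q, x ≠ y → G.Adj x y)
    (hmeet : ∀ T, IsFacet (indepCpx G) T → ∃ v ∈ Q, v ∈ T) :
    ∃ y ∈ Q, ∀ w, G.Adj y w → w ∈ Q := by
  classical
  by_contra hcon
  push Not at hcon
  have hdom : ∀ z, z ∉ Q → ∃ u, ReachableIn G (· ∉ Q) z u ∧
      ∀ y ∈ Q, ∀ c, ReachableIn G (· ∉ Q) z c → G.Adj c y → G.Adj u y :=
    fun z hz => hG.exists_dominating_vertex hQ hz
  let C : V → Finset V := fun z => Finset.univ.filter fun c => ReachableIn G (· ∉ Q) z c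
  have hC : ∀ z c, c ∈ C z ↔ ReachableIn G (· ∉ Q) z c := fun z c => by simp [C]
  have hdom' : ∀ D : Finset V, ∃ u, ∀ z, z ∉ Q → C z = D →
      u ∈ D ∧ ∀ y ∈ Q, ∀ c ∈ D, G.Adj c y → G.Adj u y := by
    intro D
    by_cases h : ∃ z, z ∉ Q ∧ C z = D
    · obtain ⟨z, hz, rfl⟩ := h
      obtain ⟨u, h1, h2⟩ := hdom z hz
      exact ⟨u, fun _ _ _ => ⟨(hC _ _).2 h1, fun y hy c hc => h2 y hy c ((hC _ _).1 hc)⟩⟩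
    · by_cases hne : Nonempty V
      · exact ⟨hne.some, fun z hz he => absurd ⟨z, hz, he⟩ h⟩
      · obtain ⟨v, _, _⟩ := hmeet ∅ ⟨by simp [indepCpx], fun G _ _ => by
          ext v; exact absurd ⟨v⟩ hne⟩
        exact absurd ⟨v⟩ hne
  choose g hg using hdom'
  have hsymC : ∀ z z', z ∉ Q → ReachableIn G (· ∉ Q) z z' → C z = C z' := by
    intro z z' hz h
    ext c
    rw [hC, hC]
    exact ⟨fun hc => (ReachableIn.symm (S := (· ∉ Q)) hz h).trans hc, fun hc => h.trans hc⟩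
  have hgz : ∀ z, z ∉ Q → ReachableIn G (· ∉ Q) z (g (C z)) := fun z hz =>
    (hC _ _).1 (hg _ z hz rfl).1
  set J : Finset V := (Finset.univ.filter (· ∉ Q)).image fun z => g (C z) with hJ
  have hJi : indepCpx G J := by
    intro u hu v hv huv
    rw [hJ, Finset.mem_image] at hu hv
    obtain ⟨z, hz, rfl⟩ := hu
    obtain ⟨z', hz', rfl⟩ := hv
    simp only [Finset.mem_filter, Finset.mem_univ, true_and] at hz hz'
    have hm : g (C z') ∉ Q := ReachableIn.mem (S := (· ∉ Q)) hz' (hgz z' hz')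
    have h1 : C z = C z' := by
      rw [hsymC z _ hz ((hgz z hz).tail ⟨huv, hm⟩), ← hsymC z' _ hz' (hgz z' hz')]
    rw [h1] at huv
    exact huv.ne rfl
  obtain ⟨T, hJT, hT⟩ := exists_isFacet_superset (indepCpx G) hJi
  obtain ⟨y, hyQ, hyT⟩ := hmeet T hT
  obtain ⟨z, hyz, hz⟩ := hcon y hyQ
  have h1 : g (C z) ∈ T := hJT (by
    rw [hJ, Finset.mem_image]
    exact ⟨z, by simpa using hz, rfl⟩)
  exact hT.1 _ h1 _ hyT ((hg _ z hz rfl).2 y hyQ z ((hC _ _).2 Relation.ReflTransGen.refl) hyz.symm)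

theorem IsChordal.facetSumExchange (hG : IsChordal G) (hd : IsPureOfCard (indepCpx G) d) :
    ∃ ρ, FacetSumExchange G ρ := by
  classical
  obtain ⟨𝒬, h1, h2, h3⟩ := hG.exists_clique_cover (fun F hF => hd.card_le hF) Finset.univ ∅
    (by simp [indepCpx]) (fun v => by simp [IsLinkVertex])
  replace h2 := fun v => h2 v (Finset.mem_univ v)
  have h4 : ∀ Q ∈ 𝒬, ∃ y ∈ Q, ∀ w, G.Adj y w → w ∈ Q := fun Q hQ =>
    hG.exists_private_of_meets (h1 Q hQ) fun T hT =>
      hd.inter_nonempty_of_clique_cover h1 h2 (by simpa using h3) hT hQ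
  refine exists_facetSumExchange_of_pieces 𝒬 (fun P hP Q hQ hne => ?_) h2 fun Q hQ => ?_
  · obtain ⟨y, hyP, hy⟩ := h4 P hP
    obtain ⟨z, hzQ, hz⟩ := h4 Q hQ
    by_contra hdis
    rw [Finset.not_disjoint_iff] at hdis
    obtain ⟨w, hwP, hwQ⟩ := hdis
    have key : ∀ P ∈ 𝒬, ∀ Q ∈ 𝒬, ∀ y ∈ P, y ∈ Q → (∀ w, G.Adj y w → w ∈ P) → Q ⊆ P := by
      intro P _ Q hQ y hyP hyQ hy x hx
      by_cases hxy : x = y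
      · exact hxy ▸ hyP
      · exact hy x (h1 Q hQ y hyQ x hx (Ne.symm hxy))
    by_cases hyQ : y ∈ Q
    · by_cases hzP : z ∈ P
      · exact hne ((key Q hQ P hP z hzQ hzP hz).antisymm (key P hP Q hQ y hyP hyQ hy))
      · by_cases hyz : y = z
        · exact hzP (hyz ▸ hyP)
        · exact hzP (hy z (h1 Q hQ y hyQ z hzQ hyz))
    · have hyz : y ≠ z := fun h => hyQ (h ▸ hzQ)
      have hadj : ¬ G.Adj y z := fun h => hyQ (hz y h.symm)
      have hyw : y ≠ w := fun h => hyQ (h ▸ hwQ)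
      by_cases hzP : z ∈ P
      · exact hadj (h1 P hP y hyP z hzP hyz)
      have hzw : z ≠ w := fun h => hzP (h ▸ hwP)
      have hle := hd.card_le_of_dominates (I := {w}) (I' := {y, z}) (by simp [indepCpx])
        (by
          intro a ha b hb
          simp only [Finset.mem_insert, Finset.mem_singleton] at ha hb
          rcases ha with rfl | rfl <;> rcases hb with rfl | rfl
          · exact fun h => h.ne rfl
          · exact hadj
          · exact fun h => hadj h.symm
          · exact fun h => h.ne rfl)
        (by
          intro v hv
          simp only [Finset.mem_insert, Finset.mem_singleton] at hv
          rcases hv with rfl | rfl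
          · exact Or.inr ⟨w, by simp, h1 P hP w hwP _ hyP hyw.symm⟩
          · exact Or.inr ⟨w, by simp, h1 Q hQ w hwQ _ hzQ hzw.symm⟩)
        (by
          intro u hu v huv
          have hv : (v ∈ P ∨ v ∈ Q) := by
            simp only [Finset.mem_insert, Finset.mem_singleton] at hu
            rcases hu with rfl | rfl
            · exact Or.inl (hy v huv)
            · exact Or.inr (hz v huv)
          by_cases hvw : v = w
          · exact Or.inl (by simp [hvw])
          · exact Or.inr ⟨w, by simp, hv.elim (fun h => h1 P hP w hwP v h (Ne.symm hvw))
              fun h => h1 Q hQ w hwQ v h (Ne.symm hvw)⟩)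
      rw [Finset.card_pair hyz] at hle
      simp at hle
  · obtain ⟨y, hyQ, hy⟩ := h4 Q hQ
    exact ⟨_, IsSimplicialPiece.isExchangePiece hd ⟨Finset.subset_univ _, hyQ, h1 Q hQ,
      fun w _ => hy w⟩⟩

end ChordalPieces

section Cactus

variable {V : Type} {G : SimpleGraph V}

lemma exists_isCycleSubgraph {a b₁ b₂ : V} (h₁ : G.Adj a b₁) (h₂ : G.Adj a b₂)
    (hne : b₁ ≠ b₂) (h : ReachableIn G (· ≠ a) b₁ b₂) :
    ∃ C : G.Subgraph, IsCycleSubgraph G C ∧ C.Adj a b₁ ∧ C.Adj a b₂ := by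
  classical
  obtain ⟨p, hp, hS⟩ := h.exists_isPath
  have ha : a ∉ p.support := fun ha => (hS a ha).elim h₁.ne fun h => h rfl
  have hcyc : (SimpleGraph.Walk.cons h₁ (p.concat h₂.symm)).IsCycle := by
    rw [SimpleGraph.Walk.cons_isCycle_iff]
    refine ⟨hp.concat ha _, fun he => ?_⟩
    rw [SimpleGraph.Walk.edges_concat, List.concat_eq_append, List.mem_append,
      List.mem_singleton] at he
    rcases he with he | he
    · exact ha (p.fst_mem_support_of_mem_edges he)
    · rw [Sym2.eq_swap, Sym2.congr_left] at he
      exact hne he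
  refine ⟨_, ⟨SimpleGraph.Walk.toSubgraph_connected _, fun v hv =>
    hcyc.ncard_neighborSet_toSubgraph_eq_two ((SimpleGraph.Walk.mem_verts_toSubgraph _).1 hv)⟩,
    ?_, ?_⟩
  · rw [← SimpleGraph.Subgraph.mem_edgeSet, SimpleGraph.Walk.mem_edges_toSubgraph]
    simp
  · rw [← SimpleGraph.Subgraph.mem_edgeSet, SimpleGraph.Walk.mem_edges_toSubgraph]
    simp [SimpleGraph.Walk.edges_concat, Sym2.eq_swap]

/-- In a cactus graph, three neighbours of `a` cannot be connected to each other away from `a`. -/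
theorem IsCactus.not_theta (hG : IsCactus G) {a b₁ b₂ b₃ : V} (h₁ : G.Adj a b₁)
    (h₂ : G.Adj a b₂) (h₃ : G.Adj a b₃) (h₁₂ : b₁ ≠ b₂) (h₁₃ : b₁ ≠ b₃) (h₂₃ : b₂ ≠ b₃)
    (r₂ : ReachableIn G (· ≠ a) b₁ b₂) (r₃ : ReachableIn G (· ≠ a) b₁ b₃) : False := by
  obtain ⟨C, hC, hC1, hC2⟩ := exists_isCycleSubgraph h₁ h₂ h₁₂ r₂
  obtain ⟨D, hD, hD1, hD3⟩ := exists_isCycleSubgraph h₁ h₃ h₁₃ r₃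
  obtain rfl := hG C D hC hD s(a, b₁) hC1 hD1
  have h2 := hC.2 a hC1.fst_mem
  have hfin : (C.neighborSet a).Finite := Set.finite_of_ncard_ne_zero (by omega)
  have hsub : ({b₁, b₂, b₃} : Set V) ⊆ C.neighborSet a := by
    rintro x (rfl | rfl | rfl)
    exacts [hC1, hC2, hD3]
  have := Set.ncard_le_ncard hsub hfin
  rw [Set.ncard_eq_three.2 ⟨_, _, _, h₁₂, h₁₃, h₂₃, rfl⟩] at this
  omega

end Cactus

section CactusPieces

variable {V : Type} [DecidableEq V] {G : SimpleGraph V}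

omit [DecidableEq V] in
lemma ReachableIn.rfl {S : V → Prop} {x : V} : ReachableIn G S x x :=
  Relation.ReflTransGen.refl

omit [DecidableEq V] in
lemma ReachableIn.step {S : V → Prop} {x y z : V} (h : G.Adj x y) (hy : S y)
    (hyz : ReachableIn G S y z) : ReachableIn G S x z :=
  Relation.ReflTransGen.head ⟨h, hy⟩ hyz

/-- One of the three kinds of pieces on which exchanges are possible. -/
def IsPiece (G : SimpleGraph V) (W P : Finset V) : Prop :=
  (∃ f, IsSimplicialPiece G W P f) ∨ (∃ x₁ x₂ x₃ x₄, IsSquarePiece G W P x₁ x₂ x₃ x₄) ∨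
    ∃ v₁ v₂ v₃ v₄ v₅, IsPentagonPiece G W P v₁ v₂ v₃ v₄ v₅

/-- A piece `B` of `W`, whose removal leaves `W'`, attached to `W'` in a controlled way. -/
structure IsGatedBlock (G : SimpleGraph V) (W B W' : Finset V) : Prop where
  union : ∀ v, v ∈ W ↔ v ∈ B ∨ v ∈ W'
  disj : ∀ v ∈ B, v ∉ W'
  piece : IsPiece G W B
  swap : ∀ c ∈ B, ∀ d ∈ W', G.Adj c d → ∀ F ⊆ W', indepCpx G F →
    (∀ u ∈ F, ¬ G.Adj u c ∧ u ≠ d ∧ ¬ G.Adj u d) →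
    ∃ w ∈ W', G.Adj d w ∧ ¬ G.Adj w c ∧ w ∉ F ∧ ∀ u ∈ F, ¬ G.Adj u w
  gate : ∀ c ∈ B, ∀ d ∈ W', G.Adj c d → ∃ b ∈ B, G.Adj b c ∧ ∀ w ∈ W', ¬ G.Adj b w
  gates : ∀ c ∈ B, ∀ c' ∈ B, c ≠ c' → ∀ d ∈ W', ∀ d' ∈ W', G.Adj c d → G.Adj c' d' →
    G.Adj c c' ∧ ∃ b ∈ B, G.Adj b c ∧ G.Adj b c' ∧ ∀ w ∈ W', ¬ G.Adj b w
  twin : ∀ c ∈ B, ∀ d ∈ W', ∀ d' ∈ W', ∀ e ∈ W', d ≠ d' →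
    (∀ w ∈ W, G.Adj d w ↔ w = c ∨ w = e) → (∀ w ∈ W, G.Adj d' w ↔ w = c ∨ w = e) → False

variable {W B W' P : Finset V}

lemma IsGatedBlock.swap_empty (hB : IsGatedBlock G W B W') {c d : V} (hc : c ∈ B) (hd : d ∈ W')
    (hcd : G.Adj c d) : ∃ w ∈ W', G.Adj d w ∧ ¬ G.Adj w c := by
  obtain ⟨w, h1, h2, h3, -⟩ := hB.swap c hc d hd hcd ∅ (by simp) (by simp [indepCpx]) (by simp)
  exact ⟨w, h1, h2, h3⟩

lemma IsGatedBlock.swap_pair (hB : IsGatedBlock G W B W') {c d h h' : V} (hc : c ∈ B)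
    (hd : d ∈ W') (hcd : G.Adj c d) (hh : h ∈ W') (hh' : h' ∈ W') (h₁ : ¬ G.Adj h h')
    (h₂ : ¬ G.Adj h c) (h₃ : ¬ G.Adj h' c) (h₄ : h ≠ d) (h₅ : h' ≠ d) (h₆ : ¬ G.Adj h d)
    (h₇ : ¬ G.Adj h' d) : ∃ w ∈ W', G.Adj d w ∧ ¬ G.Adj h w ∧ ¬ G.Adj h' w := by
  obtain ⟨w, h1, h2, -, -, h3⟩ := hB.swap c hc d hd hcd {h, h'} (by
    intro x hx
    simp only [Finset.mem_insert, Finset.mem_singleton] at hx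
    rcases hx with rfl | rfl <;> assumption) (by
    intro x hx y hy
    simp only [Finset.mem_insert, Finset.mem_singleton] at hx hy
    rcases hx with rfl | rfl <;> rcases hy with rfl | rfl
    · exact G.irrefl
    · exact h₁
    · exact fun h => h₁ h.symm
    · exact G.irrefl) (by
    intro x hx
    simp only [Finset.mem_insert, Finset.mem_singleton] at hx
    rcases hx with rfl | rfl
    · exact ⟨h₂, h₄, h₆⟩
    · exact ⟨h₃, h₅, h₇⟩)
  exact ⟨w, h1, h2, h3 h (by simp), h3 h' (by simp)⟩

lemma IsGatedBlock.mem_left (hB : IsGatedBlock G W B W') {v : V} (hv : v ∈ B) : v ∈ W :=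
  (hB.union v).2 (Or.inl hv)

lemma IsGatedBlock.mem_right (hB : IsGatedBlock G W B W') {v : V} (hv : v ∈ W') : v ∈ W :=
  (hB.union v).2 (Or.inr hv)

lemma IsGatedBlock.ne (hB : IsGatedBlock G W B W') {b v : V} (hb : b ∈ B) (hv : v ∈ W') :
    b ≠ v := fun h => hB.disj b hb (h ▸ hv)

/-- Two vertices of `B` with neighbours in `W'` are connected inside `B`. -/
lemma IsGatedBlock.reachable (hB : IsGatedBlock G W B W') {c c' d d' a : V} (hc : c ∈ B)
    (hc' : c' ∈ B) (hd : d ∈ W') (hd' : d' ∈ W') (hcd : G.Adj c d) (hcd' : G.Adj c' d')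
    (ha : a ∈ W') : ReachableIn G (· ≠ a) c c' := by
  by_cases h : c = c'
  · subst h; exact .rfl
  · exact .step (hB.gates c hc c' hc' h d hd d' hd' hcd hcd').1 (hB.ne hc' ha) .rfl

theorem IsGatedBlock.simplicial_step (hG : IsCactus G) (hB : IsGatedBlock G W B W') {f : V}
    (h : IsSimplicialPiece G W' P f) : IsPiece G W P := by
  have hPW : P ⊆ W := fun v hv => hB.mem_right (h.subset hv)
  have hfW := h.subset h.mem
  by_cases h0 : ∃ e ∈ P, ∀ w ∈ W, G.Adj e w → w ∈ P
  · obtain ⟨e, he, hen⟩ := h0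
    exact Or.inl ⟨e, hPW, he, h.clique, hen⟩
  push Not at h0
  obtain ⟨c, hcW, hfc, hcP⟩ := h0 f h.mem
  have hcB : c ∈ B := by
    rcases (hB.union c).1 hcW with hc | hc
    · exact hc
    · exact absurd (h.nbr c hc hfc) hcP
  obtain ⟨e, heW', hfe, hec⟩ := hB.swap_empty hcB hfW hfc.symm
  have heP := h.nbr e heW' hfe
  obtain ⟨g, hgW, heg, hgP⟩ := h0 e heP
  have hce : c ≠ e := hB.ne hcB heW'
  by_cases h3 : ∃ e' ∈ P, e' ≠ f ∧ e' ≠ e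
  · exfalso
    obtain ⟨e', he'P, he'f, he'e⟩ := h3
    have he'W' := h.subset he'P
    obtain ⟨g', hgW', heg', hgP'⟩ := h0 e' he'P
    have hee' : G.Adj e e' := h.clique e heP e' he'P (Ne.symm he'e)
    have hfe' : G.Adj f e' := h.clique f h.mem e' he'P (Ne.symm he'f)
    have hce' : c ≠ e' := hB.ne hcB he'W'
    have gf : g ≠ f := fun he => hgP (he ▸ h.mem)
    have gf' : g' ≠ f := fun he => hgP' (he ▸ h.mem)
    have th : ∀ x, G.Adj x e ∨ G.Adj x e' → x ≠ f → ReachableIn G (· ≠ f) x c → False := by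
      intro x hx hxf hxc
      refine hG.not_theta hfe hfe' hfc (Ne.symm he'e) (Ne.symm hce) (Ne.symm hce')
        (.step hee' he'f .rfl) ?_
      rcases hx with hx | hx
      · exact .step hx.symm hxf hxc
      · exact .step hee' he'f (.step hx.symm hxf hxc)
    have hgW2 : g ∈ W' := by
      rcases (hB.union g).1 hgW with hg | hg
      · exact (th g (Or.inl heg.symm) gf (hB.reachable hg hcB heW' hfW heg.symm hfc.symm hfW)).elim
      · exact hg
    have hgW2' : g' ∈ W' := by
      rcases (hB.union g').1 hgW' with hg | hg
      · exact (th g' (Or.inr heg'.symm) gf'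
          (hB.reachable hg hcB he'W' hfW heg'.symm hfc.symm hfW)).elim
      · exact hg
    have hnadj : ¬ G.Adj g g' := by
      intro hgg
      refine hG.not_theta hfe.symm hee' heg (Ne.symm he'f) gf.symm
        (fun he => hgP (he ▸ he'P)) (.step hfe' he'e .rfl) (.step hfe' he'e (.step heg' ?_
          (.step hgg.symm heg.ne.symm .rfl)))
      exact fun he => hgP' (he ▸ heP)
    obtain ⟨w, hwW, hfw, hgw, hgw'⟩ := hB.swap_pair hcB hfW hfc.symm hgW2 hgW2' hnadj
      (fun hgc => th g (Or.inl heg.symm) gf (.step hgc hfc.ne.symm .rfl))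
      (fun hgc => th g' (Or.inr heg'.symm) gf' (.step hgc hfc.ne.symm .rfl)) gf gf'
      (fun hgf => hgP (h.nbr g hgW2 hgf.symm)) (fun hgf => hgP' (h.nbr g' hgW2' hgf.symm))
    have hwP := h.nbr w hwW hfw
    refine hG.not_theta hfe hfe' hfw (Ne.symm he'e) ?_ ?_ (.step hee' he'f .rfl)
      (.step (h.clique e heP w hwP ?_) hfw.ne.symm .rfl)
    · rintro rfl; exact hgw heg.symm
    · rintro rfl; exact hgw' heg'.symm
    · rintro rfl; exact hgw heg.symm
  push Not at h3
  have hPe : ∀ v ∈ P, v = f ∨ v = e := fun v hv => by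
    by_cases hvf : v = f
    · exact Or.inl hvf
    · exact Or.inr (h3 v hv hvf)
  obtain ⟨b, hb, hbc, hbp⟩ := hB.gate c hcB f hfW hfc.symm
  -- every further neighbour of `e` lies in `W'` and is adjacent to `c`
  have hout : ∀ x ∈ W, G.Adj e x → x ∉ P → x ∈ W' ∧ G.Adj x c := by
    intro x hx hex hxP
    have hxf : x ≠ f := fun he => hxP (he ▸ h.mem)
    have hxW : x ∈ W' := by
      rcases (hB.union x).1 hx with hxB | hxW
      · exfalso
        have hxc : c ≠ x := by rintro rfl; exact hec hex
        obtain ⟨hcx, b', hb', hb'c, hb'x, hb'p⟩ := hB.gates c hcB x hxB hxc f hfW e heW'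
          hfc.symm hex.symm
        refine hG.not_theta hcx hfc.symm hb'c.symm hxf hb'x.ne.symm (hB.ne hb' hfW).symm
          (.step hex.symm hce.symm (.step hfe.symm hfc.ne .rfl))
          (.step hb'x.symm hb'c.ne .rfl)
      · exact hxW
    refine ⟨hxW, ?_⟩
    by_contra hxc
    have hxfa : ¬ G.Adj x f := fun hxf' => hxP (h.nbr x hxW hxf'.symm)
    obtain ⟨w, hw, hfw, hxw, -⟩ := hB.swap_pair hcB hfW hfc.symm hxW hxW G.irrefl hxc hxc
      hxf hxf hxfa hxfa
    rcases hPe w (h.nbr w hw hfw) with rfl | rfl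
    · exact hfw.ne rfl
    · exact hxw hex.symm
  obtain ⟨hgW', hgc⟩ := hout g hgW heg hgP
  have hgf : g ≠ f := fun he => hgP (he ▸ h.mem)
  have nf : ∀ w ∈ W, G.Adj f w ↔ w = e ∨ w = c := by
    intro w hw
    refine ⟨fun hfw => ?_, ?_⟩
    · rcases (hB.union w).1 hw with hwB | hwW
      · right
        by_contra hwc
        obtain ⟨hcx, b', hb', hb'c, hb'x, hb'p⟩ := hB.gates c hcB w hwB (Ne.symm hwc) f hfW f hfW
          hfc.symm hfw.symm
        exact hG.not_theta hcx hfc.symm hb'c.symm hfw.ne.symm hb'x.ne.symm (hB.ne hb' hfW).symm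
          (.step hfw.symm hfc.ne .rfl) (.step hb'x.symm hb'c.ne .rfl)
      · rcases hPe w (h.nbr w hwW hfw) with rfl | rfl
        · exact absurd rfl hfw.ne
        · exact Or.inl rfl
    · rintro (rfl | rfl)
      exacts [hfe, hfc]
  have ne : ∀ w ∈ W, G.Adj e w ↔ w = f ∨ w = g := by
    intro w hw
    refine ⟨fun hew => ?_, ?_⟩
    · by_cases hwP : w ∈ P
      · rcases hPe w hwP with rfl | rfl
        · exact Or.inl rfl
        · exact absurd rfl hew.ne
      · right
        by_contra hwg
        have hwc := (hout w hw hew hwP).2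
        have hwf : w ≠ f := fun he => hwP (he ▸ h.mem)
        exact hG.not_theta hfe.symm heg hew hgf.symm hwf.symm (Ne.symm hwg)
          (.step hfc hce (.step hgc.symm heg.ne.symm .rfl))
          (.step hfc hce (.step hwc.symm hew.ne.symm .rfl))
    · rintro (rfl | rfl)
      exacts [hfe.symm, heg]
  refine Or.inr (Or.inl ⟨f, e, g, c, ?_, hB.mem_right hfW, hB.mem_right heW', hgW, hcW, hgf.symm,
    hce.symm, nf, ne, hgc, ?_, ?_⟩)
  · ext v
    simp only [Finset.mem_insert, Finset.mem_singleton]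
    exact ⟨hPe v, by rintro (rfl | rfl); exacts [h.mem, heP]⟩
  · by_contra hcon
    push Not at hcon
    refine hB.twin c hcB f hfW g hgW' e heW' hgf.symm (fun w hw => by rw [nf w hw, or_comm])
      fun w hw => ⟨fun hgw => ?_, ?_⟩
    · by_cases hwe : w = e
      · exact Or.inr hwe
      · exact Or.inl (hcon w hw hgw hwe)
    · rintro (rfl | rfl)
      exacts [hgc, heg.symm]
  · exact ⟨b, hB.mem_left hb, hbc.symm, hB.ne hb hfW, hB.ne hb hgW'⟩

end CactusPieces

section CactusSteps

variable {V : Type} [DecidableEq V] {G : SimpleGraph V} {W B W' P : Finset V}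

lemma IsGatedBlock.not_adj_of_gate (hG : IsCactus G) (hB : IsGatedBlock G W B W')
    {a p q x c c' : V} (hc : c ∈ B) (hc' : c' ∈ B) (ha : a ∈ W') (hx : x ∈ W') (hp : p ∈ W')
    (hq : q ∈ W') (hap : G.Adj a p) (haq : G.Adj a q) (hpq : p ≠ q)
    (rq : ReachableIn G (· ≠ a) p q) (rx : ReachableIn G (· ≠ a) p x) (hac : G.Adj a c) :
    ¬ G.Adj x c' := fun hxc =>
  hG.not_theta hap haq hac hpq (hB.ne hc hp).symm (hB.ne hc hq).symm rq
    (rx.trans (ReachableIn.step hxc (hB.ne hc' ha)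
      (hB.reachable hc' hc hx ha hxc.symm hac.symm ha)))

lemma IsSquarePiece.reflect {x₁ x₂ x₃ x₄ : V} (h : IsSquarePiece G W P x₁ x₂ x₃ x₄) :
    IsSquarePiece G W P x₂ x₁ x₄ x₃ where
  eq := by rw [h.eq, Finset.pair_comm]
  mem₁ := h.mem₂
  mem₂ := h.mem₁
  mem₃ := h.mem₄
  mem₄ := h.mem₃
  ne₁₃ := h.ne₂₄
  ne₂₄ := h.ne₁₃
  nbr₁ := h.nbr₂
  nbr₂ := h.nbr₁
  adj := h.adj.symm
  ex₃ := h.ex₄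
  ex₄ := h.ex₃

lemma IsGatedBlock.not_adj_square (hG : IsCactus G) (hB : IsGatedBlock G W B W')
    {x₁ x₂ x₃ x₄ c : V} (h : IsSquarePiece G W' P x₁ x₂ x₃ x₄) (hc : c ∈ B) :
    ¬ G.Adj x₁ c := by
  intro h1c
  have a12 : G.Adj x₁ x₂ := (h.nbr₁ _ h.mem₂).2 (Or.inl rfl)
  have a14 : G.Adj x₁ x₄ := (h.nbr₁ _ h.mem₄).2 (Or.inr rfl)
  have a23 : G.Adj x₂ x₃ := (h.nbr₂ _ h.mem₃).2 (Or.inr rfl)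
  have n31 : ¬ G.Adj x₃ x₁ := fun h31 => by
    rcases (h.nbr₁ _ h.mem₃).1 h31.symm with h' | h'
    exacts [a23.ne h'.symm, h.adj.ne h']
  obtain ⟨w, hw, h1w, h3w, -⟩ := hB.swap_pair hc h.mem₁ h1c.symm h.mem₃ h.mem₃ G.irrefl
    (hB.not_adj_of_gate hG hc hc h.mem₁ h.mem₃ h.mem₂ h.mem₄ a12 a14 h.ne₂₄
      (.step a23 h.ne₁₃.symm (.step h.adj a14.ne.symm .rfl)) (.step a23 h.ne₁₃.symm .rfl) h1c)
    (hB.not_adj_of_gate hG hc hc h.mem₁ h.mem₃ h.mem₂ h.mem₄ a12 a14 h.ne₂₄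
      (.step a23 h.ne₁₃.symm (.step h.adj a14.ne.symm .rfl)) (.step a23 h.ne₁₃.symm .rfl) h1c)
    h.ne₁₃.symm h.ne₁₃.symm n31 n31
  rcases (h.nbr₁ w hw).1 h1w with rfl | rfl
  exacts [h3w a23.symm, h3w h.adj]

lemma IsGatedBlock.square_step (hG : IsCactus G) (hB : IsGatedBlock G W B W')
    {x₁ x₂ x₃ x₄ : V} (h : IsSquarePiece G W' P x₁ x₂ x₃ x₄) :
    IsSquarePiece G W P x₁ x₂ x₃ x₄ where
  eq := h.eq
  mem₁ := hB.mem_right h.mem₁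
  mem₂ := hB.mem_right h.mem₂
  mem₃ := hB.mem_right h.mem₃
  mem₄ := hB.mem_right h.mem₄
  ne₁₃ := h.ne₁₃
  ne₂₄ := h.ne₂₄
  nbr₁ w hw := by
    rcases (hB.union w).1 hw with hwB | hwW
    · refine ⟨fun h1 => absurd h1 (hB.not_adj_square hG h hwB), ?_⟩
      rintro (rfl | rfl)
      exacts [(hB.disj _ hwB h.mem₂).elim, (hB.disj _ hwB h.mem₄).elim]
    · exact h.nbr₁ w hwW
  nbr₂ w hw := by
    rcases (hB.union w).1 hw with hwB | hwW
    · refine ⟨fun h1 => absurd h1 (hB.not_adj_square hG h.reflect hwB), ?_⟩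
      rintro (rfl | rfl)
      exacts [(hB.disj _ hwB h.mem₁).elim, (hB.disj _ hwB h.mem₃).elim]
    · exact h.nbr₂ w hwW
  adj := h.adj
  ex₃ := let ⟨w, hw, h'⟩ := h.ex₃; ⟨w, hB.mem_right hw, h'⟩
  ex₄ := let ⟨w, hw, h'⟩ := h.ex₄; ⟨w, hB.mem_right hw, h'⟩

/-- The vertices `v₁, …, v₅` span a pentagon in `W'`. -/
structure IsPentagon (G : SimpleGraph V) (W' P : Finset V) (v₁ v₂ v₃ v₄ v₅ : V) : Prop where
  eq : P = {v₁, v₂, v₃, v₄, v₅}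
  subset : P ⊆ W'
  adj₁₂ : G.Adj v₁ v₂
  adj₂₃ : G.Adj v₂ v₃
  adj₃₄ : G.Adj v₃ v₄
  adj₄₅ : G.Adj v₄ v₅
  adj₅₁ : G.Adj v₅ v₁
  ne₁₃ : v₁ ≠ v₃
  ne₁₄ : v₁ ≠ v₄
  ne₂₄ : v₂ ≠ v₄
  ne₂₅ : v₂ ≠ v₅
  ne₃₅ : v₃ ≠ v₅

lemma IsPentagon.rotate {v₁ v₂ v₃ v₄ v₅ : V} (h : IsPentagon G W' P v₁ v₂ v₃ v₄ v₅) :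
    IsPentagon G W' P v₂ v₃ v₄ v₅ v₁ where
  eq := by rw [h.eq]; ext; simp only [Finset.mem_insert, Finset.mem_singleton]; tauto
  subset := h.subset
  adj₁₂ := h.adj₂₃
  adj₂₃ := h.adj₃₄
  adj₃₄ := h.adj₄₅
  adj₄₅ := h.adj₅₁
  adj₅₁ := h.adj₁₂
  ne₁₃ := h.ne₂₄
  ne₁₄ := h.ne₂₅
  ne₂₄ := h.ne₃₅
  ne₂₅ := h.ne₁₃.symm
  ne₃₅ := h.ne₁₄.symm

lemma IsPentagon.mem {v₁ v₂ v₃ v₄ v₅ : V} (h : IsPentagon G W' P v₁ v₂ v₃ v₄ v₅) :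
    v₁ ∈ W' := h.subset (by rw [h.eq]; simp)

lemma IsPentagonPiece.isPentagon {v₁ v₂ v₃ v₄ v₅ : V}
    (h : IsPentagonPiece G W' P v₁ v₂ v₃ v₄ v₅) : IsPentagon G W' P v₁ v₂ v₃ v₄ v₅ where
  eq := h.eq
  subset := h.subset
  adj₁₂ := ((h.nbr₂ _ (h.subset (by simp [h.eq]))).2 (Or.inl rfl)).symm
  adj₂₃ := (h.nbr₂ _ (h.subset (by simp [h.eq]))).2 (Or.inr rfl)
  adj₃₄ := ((h.nbr₄ _ (h.subset (by simp [h.eq]))).2 (Or.inl rfl)).symm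
  adj₄₅ := (h.nbr₄ _ (h.subset (by simp [h.eq]))).2 (Or.inr rfl)
  adj₅₁ := (h.nbr₅ _ (h.subset (by simp [h.eq]))).2 (Or.inr rfl)
  ne₁₃ := h.ne₁₃
  ne₁₄ := h.ne₁₄
  ne₂₄ := h.ne₂₄
  ne₂₅ := h.ne₂₅
  ne₃₅ := h.ne₃₅

lemma IsPentagon.not_adj (hG : IsCactus G) {v₁ v₂ v₃ v₄ v₅ : V}
    (h : IsPentagon G W' P v₁ v₂ v₃ v₄ v₅) : ¬ G.Adj v₁ v₃ := fun h13 =>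
  hG.not_theta h.adj₁₂ h13 h.adj₅₁.symm h.adj₂₃.ne h.ne₂₅ h.ne₃₅
    (.step h.adj₂₃ h.ne₁₃.symm .rfl)
    (.step h.adj₂₃ h.ne₁₃.symm (.step h.adj₃₄ h.ne₁₄.symm (.step h.adj₄₅ h.adj₅₁.ne .rfl)))

/-- If a vertex of a pentagon has all its neighbours on the pentagon, they are the two
neighbouring vertices. -/
lemma IsPentagon.nbr_iff (hG : IsCactus G) {v₁ v₂ v₃ v₄ v₅ w : V}
    (h : IsPentagon G W' P v₁ v₂ v₃ v₄ v₅) (hw : G.Adj v₁ w → w ∈ P) :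
    G.Adj v₁ w ↔ w = v₅ ∨ w = v₂ := by
  refine ⟨fun h1 => ?_, ?_⟩
  · have := hw h1
    rw [h.eq] at this
    simp only [Finset.mem_insert, Finset.mem_singleton] at this
    rcases this with rfl | rfl | rfl | rfl | rfl
    · exact absurd rfl h1.ne
    · exact Or.inr rfl
    · exact absurd h1 (h.not_adj hG)
    · exact absurd h1.symm (h.rotate.rotate.rotate.not_adj hG)
    · exact Or.inl rfl
  · rintro (rfl | rfl)
    exacts [h.adj₅₁.symm, h.adj₁₂]

lemma IsGatedBlock.pentagon_gate (hG : IsCactus G) (hB : IsGatedBlock G W B W')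
    {v₁ v₂ v₃ v₄ v₅ c c' : V} (h : IsPentagon G W' P v₁ v₂ v₃ v₄ v₅) (hc : c ∈ B)
    (h1c : G.Adj v₁ c) (hc' : c' ∈ B) :
    ¬ G.Adj v₂ c' ∧ ¬ G.Adj v₃ c' ∧ ¬ G.Adj v₄ c' ∧ ¬ G.Adj v₅ c' := by
  have r3 : ReachableIn G (· ≠ v₁) v₂ v₃ := .step h.adj₂₃ h.ne₁₃.symm .rfl
  have r4 : ReachableIn G (· ≠ v₁) v₂ v₄ := r3.trans (ReachableIn.step h.adj₃₄ h.ne₁₄.symm .rfl)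
  have r5 : ReachableIn G (· ≠ v₁) v₂ v₅ := r4.trans (ReachableIn.step h.adj₄₅ h.adj₅₁.ne .rfl)
  have m2 := h.rotate.mem
  have m5 := h.rotate.rotate.rotate.rotate.mem
  exact ⟨hB.not_adj_of_gate hG hc hc' h.mem m2 m2 m5 h.adj₁₂ h.adj₅₁.symm h.ne₂₅ r5 .rfl h1c,
    hB.not_adj_of_gate hG hc hc' h.mem h.rotate.rotate.mem m2 m5 h.adj₁₂ h.adj₅₁.symm h.ne₂₅ r5
      r3 h1c,
    hB.not_adj_of_gate hG hc hc' h.mem h.rotate.rotate.rotate.mem m2 m5 h.adj₁₂ h.adj₅₁.symm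
      h.ne₂₅ r5 r4 h1c,
    hB.not_adj_of_gate hG hc hc' h.mem m5 m2 m5 h.adj₁₂ h.adj₅₁.symm h.ne₂₅ r5 r5 h1c⟩

lemma IsGatedBlock.pentagon_private₁ (hG : IsCactus G) (hB : IsGatedBlock G W B W')
    {v₁ v₂ v₃ v₄ v₅ c w : V} (h : IsPentagonPiece G W' P v₁ v₂ v₃ v₄ v₅) (hc : c ∈ B)
    (h2c : G.Adj v₂ c) (hw : w ∈ W) (h1w : G.Adj v₁ w) : w ∈ P := by
  have hp := h.isPentagon
  by_contra hwP
  have hmem : ∀ v, v = v₁ ∨ v = v₂ ∨ v = v₃ ∨ v = v₄ ∨ v = v₅ → v ∈ P := fun v hv => by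
    rw [h.eq]; simpa using hv
  have hwW : w ∈ W' := ((hB.union w).1 hw).resolve_left fun hwB =>
    (hB.pentagon_gate hG hp.rotate hc h2c hwB).2.2.2 h1w
  have n24 : ¬ G.Adj v₄ v₂ := fun h' => hp.rotate.not_adj hG h'.symm
  obtain ⟨x, hx, h2x, hwx, h4x⟩ := hB.swap_pair hc hp.rotate.mem h2c.symm hwW
    hp.rotate.rotate.rotate.mem
    (fun h' => by
      rcases (h.nbr₄ w hwW).1 h'.symm with h' | h'
      exacts [hwP (hmem _ (by tauto)), hwP (hmem _ (by tauto))])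
    (fun hwc => hG.not_theta hp.adj₁₂.symm hp.adj₂₃ h2c h.ne₁₃ (hB.ne hc hp.mem).symm
      (hB.ne hc hp.rotate.rotate.mem).symm
      (.step hp.adj₅₁.symm h.ne₂₅.symm (.step hp.adj₄₅.symm h.ne₂₄.symm
        (.step hp.adj₃₄.symm hp.adj₂₃.ne.symm .rfl)))
      (.step h1w (fun h' => hwP (hmem _ (by tauto))) (.step hwc h2c.ne.symm .rfl)))
    (hB.pentagon_gate hG hp.rotate hc h2c hc).2.1
    (fun h' => hwP (hmem _ (by tauto))) h.ne₂₄.symm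
    (fun h' => by
      rcases (h.nbr₂ w hwW).1 h'.symm with h' | h'
      exacts [hwP (hmem _ (by tauto)), hwP (hmem _ (by tauto))])
    n24
  rcases (h.nbr₂ x hx).1 h2x with rfl | rfl
  exacts [hwx h1w.symm, h4x hp.adj₃₄.symm]

lemma IsGatedBlock.pentagon_private₃ (hG : IsCactus G) (hB : IsGatedBlock G W B W')
    {v₁ v₂ v₃ v₄ v₅ c w : V} (h : IsPentagonPiece G W' P v₁ v₂ v₃ v₄ v₅) (hc : c ∈ B)
    (h4c : G.Adj v₄ c) (hw : w ∈ W) (h3w : G.Adj v₃ w) : w ∈ P := by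
  have hp := h.isPentagon
  by_contra hwP
  have hmem : ∀ v, v = v₁ ∨ v = v₂ ∨ v = v₃ ∨ v = v₄ ∨ v = v₅ → v ∈ P := fun v hv => by
    rw [h.eq]; simpa using hv
  have hwne : ∀ v, v = v₁ ∨ v = v₂ ∨ v = v₃ ∨ v = v₄ ∨ v = v₅ → w ≠ v := fun v hv h' =>
    hwP (h' ▸ hmem v hv)
  have hg := fun {c'} => hB.pentagon_gate hG hp.rotate.rotate.rotate hc h4c (c' := c')
  have hwW : w ∈ W' := ((hB.union w).1 hw).resolve_left fun hwB => (hg hwB).2.2.2 h3w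
  have n41 : ¬ G.Adj v₁ v₄ := fun h' => hp.rotate.rotate.rotate.not_adj hG h'.symm
  obtain ⟨x, hx, h4x, hwx, h1x⟩ := hB.swap_pair hc hp.rotate.rotate.rotate.mem h4c.symm hwW
    hp.mem
    (fun hw1 => hG.not_theta hp.adj₂₃.symm hp.adj₃₄ h3w h.ne₂₄ (hwne _ (by tauto)).symm
      (hwne _ (by tauto)).symm
      (.step hp.adj₁₂.symm h.ne₁₃ (.step hp.adj₅₁.symm h.ne₃₅.symm
        (.step hp.adj₄₅.symm hp.adj₃₄.ne.symm .rfl)))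
      (.step hp.adj₁₂.symm h.ne₁₃ (.step hw1.symm h3w.ne.symm .rfl)))
    (fun hwc => hG.not_theta hp.adj₃₄.symm hp.adj₄₅ h4c h.ne₃₅
      (hB.ne hc hp.rotate.rotate.mem).symm
      (hB.ne hc hp.rotate.rotate.rotate.rotate.mem).symm
      (.step hp.adj₂₃.symm h.ne₂₄ (.step hp.adj₁₂.symm h.ne₁₄
        (.step hp.adj₅₁.symm hp.adj₄₅.ne.symm .rfl)))
      (.step h3w (hwne _ (by tauto)) (.step hwc h4c.ne.symm .rfl)))
    (hg hc).2.1 (hwne _ (by tauto)) h.ne₁₄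
    (fun h' => by
      rcases (h.nbr₄ w hwW).1 h'.symm with h' | h'
      exacts [hwP (hmem _ (by tauto)), hwP (hmem _ (by tauto))])
    n41
  rcases (h.nbr₄ x hx).1 h4x with rfl | rfl
  exacts [hwx h3w.symm, h1x hp.adj₅₁.symm]

lemma IsGatedBlock.pentagon_step₄ (hG : IsCactus G) (hB : IsGatedBlock G W B W')
    {v₁ v₂ v₃ v₄ v₅ c : V} (h : IsPentagonPiece G W' P v₁ v₂ v₃ v₄ v₅) (hc : c ∈ B)
    (h4c : G.Adj v₄ c) : IsPentagonPiece G W P v₁ v₅ v₄ v₃ v₂ := by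
  have hp := h.isPentagon
  have hmem : ∀ v, v = v₁ ∨ v = v₂ ∨ v = v₃ ∨ v = v₄ ∨ v = v₅ → v ∈ P := fun v hv => by
    rw [h.eq]; simpa using hv
  have hg := fun {c'} => hB.pentagon_gate hG hp.rotate.rotate.rotate hc h4c (c' := c')
  refine ⟨?_, fun v hv => hB.mem_right (h.subset hv), h.ne₁₄, h.ne₁₃, h.ne₃₅.symm, h.ne₂₅.symm,
    h.ne₂₄.symm, fun w hw => ?_, fun w hw => ?_, fun w hw => ?_⟩
  · rw [h.eq]; ext; simp only [Finset.mem_insert, Finset.mem_singleton]; tauto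
  · rw [hp.rotate.rotate.rotate.rotate.nbr_iff hG, or_comm]
    intro h5
    rcases (hB.union w).1 hw with hwB | hwW
    · exact absurd h5 (hg hwB).1
    · rcases (h.nbr₅ w hwW).1 h5 with h' | h'
      exacts [hmem _ (by tauto), hmem _ (by tauto)]
  · rw [hp.rotate.rotate.nbr_iff hG (hB.pentagon_private₃ hG h hc h4c hw), or_comm]
  · rw [hp.rotate.nbr_iff hG, or_comm]
    intro h2
    rcases (hB.union w).1 hw with hwB | hwW
    · exact absurd h2 (hg hwB).2.2.1
    · rcases (h.nbr₂ w hwW).1 h2 with h' | h'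
      exacts [hmem _ (by tauto), hmem _ (by tauto)]

lemma IsGatedBlock.pentagon_step₂ (hG : IsCactus G) (hB : IsGatedBlock G W B W')
    {v₁ v₂ v₃ v₄ v₅ c : V} (h : IsPentagonPiece G W' P v₁ v₂ v₃ v₄ v₅) (hc : c ∈ B)
    (h2c : G.Adj v₂ c) : IsPentagonPiece G W P v₂ v₃ v₄ v₅ v₁ := by
  have hp := h.isPentagon
  have hmem : ∀ v, v = v₁ ∨ v = v₂ ∨ v = v₃ ∨ v = v₄ ∨ v = v₅ → v ∈ P := fun v hv => by
    rw [h.eq]; simpa using hv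
  have hg := fun {c'} => hB.pentagon_gate hG hp.rotate hc h2c (c' := c')
  refine ⟨?_, fun v hv => hB.mem_right (h.subset hv), h.ne₂₄, h.ne₂₅, h.ne₃₅, h.ne₁₃.symm,
    h.ne₁₄.symm, fun w hw => ?_, fun w hw => ?_, fun w hw => ?_⟩
  · rw [h.eq]; ext; simp only [Finset.mem_insert, Finset.mem_singleton]; tauto
  · exact hp.rotate.rotate.nbr_iff hG (hB.pentagon_private₁ hG h.reflect hc h2c hw)
  · rw [hp.rotate.rotate.rotate.rotate.nbr_iff hG]
    intro h5
    rcases (hB.union w).1 hw with hwB | hwW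
    · exact absurd h5 (hg hwB).2.2.1
    · rcases (h.nbr₅ w hwW).1 h5 with h' | h'
      exacts [hmem _ (by tauto), hmem _ (by tauto)]
  · exact hp.nbr_iff hG (hB.pentagon_private₁ hG h hc h2c hw)

theorem IsGatedBlock.pentagon_step (hG : IsCactus G) (hB : IsGatedBlock G W B W')
    {v₁ v₂ v₃ v₄ v₅ : V} (h : IsPentagonPiece G W' P v₁ v₂ v₃ v₄ v₅) : IsPiece G W P := by
  by_cases h2 : ∃ c ∈ B, G.Adj v₂ c
  · obtain ⟨c, hc, h2c⟩ := h2
    exact Or.inr (Or.inr ⟨_, _, _, _, _, hB.pentagon_step₂ hG h hc h2c⟩)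
  by_cases h4 : ∃ c ∈ B, G.Adj v₄ c
  · obtain ⟨c, hc, h4c⟩ := h4
    exact Or.inr (Or.inr ⟨_, _, _, _, _, hB.pentagon_step₄ hG h hc h4c⟩)
  by_cases h5 : ∃ c ∈ B, G.Adj v₅ c
  · obtain ⟨c, hc, h5c⟩ := h5
    exact Or.inr (Or.inr ⟨_, _, _, _, _, hB.pentagon_step₄ hG h.reflect hc h5c⟩)
  push Not at h2 h4 h5
  have hmem : ∀ v, v = v₁ ∨ v = v₂ ∨ v = v₃ ∨ v = v₄ ∨ v = v₅ → v ∈ W' := fun v hv =>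
    h.subset (by rw [h.eq]; simpa using hv)
  refine Or.inr (Or.inr ⟨v₁, v₂, v₃, v₄, v₅, h.eq, fun v hv => hB.mem_right (h.subset hv),
    h.ne₁₃, h.ne₁₄, h.ne₂₄, h.ne₂₅, h.ne₃₅, fun w hw => ?_, fun w hw => ?_, fun w hw => ?_⟩)
  all_goals rcases (hB.union w).1 hw with hwB | hwW
  · refine ⟨fun h' => absurd h' (h2 w hwB), ?_⟩
    rintro (rfl | rfl) <;> exact (hB.disj _ hwB (hmem _ (by tauto))).elim
  · exact h.nbr₂ w hwW
  · refine ⟨fun h' => absurd h' (h4 w hwB), ?_⟩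
    rintro (rfl | rfl) <;> exact (hB.disj _ hwB (hmem _ (by tauto))).elim
  · exact h.nbr₄ w hwW
  · refine ⟨fun h' => absurd h' (h5 w hwB), ?_⟩
    rintro (rfl | rfl) <;> exact (hB.disj _ hwB (hmem _ (by tauto))).elim
  · exact h.nbr₅ w hwW

theorem IsGatedBlock.isPiece (hG : IsCactus G) (hB : IsGatedBlock G W B W')
    (h : IsPiece G W' P) : IsPiece G W P := by
  rcases h with ⟨f, h⟩ | ⟨x₁, x₂, x₃, x₄, h⟩ | ⟨v₁, v₂, v₃, v₄, v₅, h⟩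
  · exact hB.simplicial_step hG h
  · exact Or.inr (Or.inl ⟨x₁, x₂, x₃, x₄, hB.square_step hG h⟩)
  · exact hB.pentagon_step hG h

end CactusSteps

section GatedBlocks

variable {V : Type} [Fintype V] [DecidableEq V] {G : SimpleGraph V} {W B W' F : Finset V} {d : ℕ}

lemma IsPureOfCard.card_le_of_dominates_link (hd : IsPureOfCard (indepCpx G) d)
    (hF : indepCpx G F) (hW : ∀ v, v ∈ W ↔ IsLinkVertex G F v) {I I' : Finset V}
    (hI : indepCpx G I) (hI' : indepCpx G I') (hIW : I ⊆ W) (hIW' : I' ⊆ W)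
    (h₁ : ∀ v ∈ I', v ∈ I ∨ ∃ u ∈ I, G.Adj u v)
    (h₂ : ∀ u ∈ I', ∀ v ∈ W, G.Adj u v → v ∈ I ∨ ∃ u ∈ I, G.Adj u v) : I'.card ≤ I.card := by
  have key : ∀ J, indepCpx G J → J ⊆ W → indepCpx G (F ∪ J) ∧ (F ∪ J).card = F.card + J.card := by
    intro J hJ hJW
    refine ⟨?_, Finset.card_union_of_disjoint
      (Finset.disjoint_right.2 fun v hv => ((hW v).1 (hJW hv)).1)⟩
    intro u hu v hv
    rw [Finset.mem_union] at hu hv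
    rcases hu with hu | hu <;> rcases hv with hv | hv
    · exact hF u hu v hv
    · exact ((hW v).1 (hJW hv)).2 u hu
    · exact fun h => ((hW u).1 (hJW hu)).2 v hv h.symm
    · exact hJ u hu v hv
  have := hd.card_le_of_dominates (key I hI hIW).1 (key I' hI' hIW').1 (fun v hv => by
    rcases Finset.mem_union.1 hv with hv | hv
    · exact Or.inl (Finset.mem_union_left _ hv)
    · rcases h₁ v hv with h | ⟨u, hu, huv⟩
      · exact Or.inl (Finset.mem_union_right _ h)
      · exact Or.inr ⟨u, Finset.mem_union_right _ hu, huv⟩) (fun u hu v huv => by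
    rcases Finset.mem_union.1 hu with hu | hu
    · exact Or.inr ⟨u, Finset.mem_union_left _ hu, huv⟩
    · by_cases hv : v ∈ W
      · rcases h₂ u hu v hv huv with h | ⟨u, hu, huv⟩
        · exact Or.inl (Finset.mem_union_right _ h)
        · exact Or.inr ⟨u, Finset.mem_union_right _ hu, huv⟩
      · rw [hW, IsLinkVertex] at hv
        by_cases hvF : v ∈ F
        · exact Or.inl (Finset.mem_union_left _ hvF)
        · have : ¬ ∀ u ∈ F, ¬ G.Adj u v := fun h => hv ⟨hvF, h⟩
          push Not at this
          obtain ⟨u, hu, huv⟩ := this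
          exact Or.inr ⟨u, Finset.mem_union_left _ hu, huv⟩)
  rw [(key I hI hIW).2, (key I' hI' hIW').2] at this
  omega

/-- Two independent sets of `B` of which the first dominates `B` and only meets `W'` through
`c` allow exchanges along `c`. -/
lemma IsPureOfCard.exists_swap (hd : IsPureOfCard (indepCpx G) d)
    (hF : indepCpx G F) (hW : ∀ v, v ∈ W ↔ IsLinkVertex G F v)
    (hu : ∀ v, v ∈ W ↔ v ∈ B ∨ v ∈ W') (hdisj : ∀ v ∈ B, v ∉ W') {I I' : Finset V}
    (hI : indepCpx G I) (hI' : indepCpx G I') (hIB : I ⊆ B) (hIB' : I' ⊆ B)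
    (hcard : I.card ≤ I'.card) (hdom : ∀ v ∈ B, v ∈ I ∨ ∃ u ∈ I, G.Adj u v) {c x : V}
    (hn : ∀ u ∈ I, u ≠ c → ∀ w ∈ W', ¬ G.Adj u w) (hn' : ∀ u ∈ I', ∀ w ∈ W', ¬ G.Adj u w)
    (hcI : c ∈ I) (hx : x ∈ W') (hcx : G.Adj c x) {T : Finset V} (hTW : T ⊆ W')
    (hT : indepCpx G T) (hTc : ∀ u ∈ T, ¬ G.Adj u c ∧ u ≠ x ∧ ¬ G.Adj u x) :
    ∃ w ∈ W', G.Adj x w ∧ ¬ G.Adj w c ∧ w ∉ T ∧ ∀ u ∈ T, ¬ G.Adj u w := by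
  by_contra hcon
  push Not at hcon
  have hdj : ∀ J : Finset V, J ⊆ B → Disjoint J T := fun J hJ =>
    Finset.disjoint_left.2 fun v hv hvT => hdisj v (hJ hv) (hTW hvT)
  have hxI' : x ∉ I' := fun h => hdisj x (hIB' h) hx
  have hxT : x ∉ T := fun h => (hTc x h).2.1 rfl
  have := hd.card_le_of_dominates_link hF hW (I := I ∪ T) (I' := insert x (I' ∪ T)) ?_ ?_ ?_ ?_
    ?_ ?_
  · rw [Finset.card_insert_of_notMem (by simp [hxI', hxT]),
      Finset.card_union_of_disjoint (hdj _ hIB), Finset.card_union_of_disjoint (hdj _ hIB')] at this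
    omega
  · have hIT : ∀ u ∈ I, ∀ v ∈ T, ¬ G.Adj u v := by
      intro u hu v hv
      by_cases huc : u = c
      · exact fun h => (hTc v hv).1 (huc ▸ h.symm)
      · exact hn u hu huc v (hTW hv)
    intro u hu v hv
    rw [Finset.mem_union] at hu hv
    rcases hu with hu | hu <;> rcases hv with hv | hv
    · exact hI u hu v hv
    · exact hIT u hu v hv
    · exact fun h => hIT v hv u hu h.symm
    · exact hT u hu v hv
  · intro u hu v hv
    rw [Finset.mem_insert, Finset.mem_union] at hu hv
    rcases hu with rfl | hu | hu <;> rcases hv with rfl | hv | hv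
    · exact G.irrefl
    · exact fun h => hn' v hv u hx h.symm
    · exact fun h => (hTc v hv).2.2 h.symm
    · exact hn' u hu v hx
    · exact hI' u hu v hv
    · exact hn' u hu v (hTW hv)
    · exact (hTc u hu).2.2
    · exact fun h => hn' v hv u (hTW hu) h.symm
    · exact hT u hu v hv
  · intro v hv
    rw [hu]
    rcases Finset.mem_union.1 hv with h | h
    exacts [Or.inl (hIB h), Or.inr (hTW h)]
  · intro v hv
    rw [hu]
    rw [Finset.mem_insert, Finset.mem_union] at hv
    rcases hv with rfl | h | h
    exacts [Or.inr hx, Or.inl (hIB' h), Or.inr (hTW h)]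
  · intro v hv
    rw [Finset.mem_insert, Finset.mem_union] at hv
    rcases hv with rfl | h | h
    · exact Or.inr ⟨c, Finset.mem_union_left _ hcI, hcx⟩
    · rcases hdom v (hIB' h) with h | ⟨u, hu, huv⟩
      · exact Or.inl (Finset.mem_union_left _ h)
      · exact Or.inr ⟨u, Finset.mem_union_left _ hu, huv⟩
    · exact Or.inl (Finset.mem_union_right _ h)
  · intro u hu' v hv huv
    rcases (hu v).1 hv with hvB | hvW
    · rcases hdom v hvB with h | ⟨u, hu, huv⟩
      · exact Or.inl (Finset.mem_union_left _ h)
      · exact Or.inr ⟨u, Finset.mem_union_left _ hu, huv⟩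
    rw [Finset.mem_insert, Finset.mem_union] at hu'
    rcases hu' with rfl | h | h
    · by_cases hvc : G.Adj v c
      · exact Or.inr ⟨c, Finset.mem_union_left _ hcI, hvc.symm⟩
      by_cases hvT : v ∈ T
      · exact Or.inl (Finset.mem_union_right _ hvT)
      · obtain ⟨t, ht, htv⟩ := hcon v hvW huv hvc hvT
        exact Or.inr ⟨t, Finset.mem_union_right _ ht, htv⟩
    · exact absurd huv (hn' u h v hvW)
    · exact Or.inr ⟨u, Finset.mem_union_right _ h, huv⟩

lemma IsPureOfCard.not_twins (hd : IsPureOfCard (indepCpx G) d)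
    (hF : indepCpx G F) (hW : ∀ v, v ∈ W ↔ IsLinkVertex G F v)
    (hu : ∀ v, v ∈ W ↔ v ∈ B ∨ v ∈ W') (hdisj : ∀ v ∈ B, v ∉ W') {b c x x' e : V} (hb : b ∈ B)
    (hc : c ∈ B) (hbc : G.Adj b c) (hbW : ∀ w ∈ W', ¬ G.Adj b w) (hx : x ∈ W') (hx' : x' ∈ W')
    (he : e ∈ W') (hne : x ≠ x') (hnx : ∀ w ∈ W, G.Adj x w ↔ w = c ∨ w = e)
    (hnx' : ∀ w ∈ W, G.Adj x' w ↔ w = c ∨ w = e) : False := by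
  have hbx : b ≠ x := fun h => hdisj b hb (h ▸ hx)
  have hbx' : b ≠ x' := fun h => hdisj b hb (h ▸ hx')
  have hbe : b ≠ e := fun h => hdisj b hb (h ▸ he)
  have mW : ∀ w ∈ W', w ∈ W := fun w hw => (hu w).2 (Or.inr hw)
  have mB : ∀ w ∈ B, w ∈ W := fun w hw => (hu w).2 (Or.inl hw)
  have hxe : G.Adj x e := (hnx e (mW e he)).2 (Or.inr rfl)
  have hxe' : G.Adj x' e := (hnx' e (mW e he)).2 (Or.inr rfl)
  have hxx : ¬ G.Adj x x' := fun h => by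
    rcases (hnx x' (mW x' hx')).1 h with h' | h'
    · exact hdisj c hc (h' ▸ hx')
    · exact hxe'.ne h'
  have := hd.card_le_of_dominates_link hF hW (I := {b, e}) (I' := {b, x, x'}) ?_ ?_ ?_ ?_ ?_ ?_
  · rw [Finset.card_pair hbe, Finset.card_eq_three.2 ⟨b, x, x', hbx, hbx', hne, rfl⟩] at this
    omega
  · intro u hu v hv
    simp only [Finset.mem_insert, Finset.mem_singleton] at hu hv
    rcases hu with rfl | rfl <;> rcases hv with rfl | rfl
    exacts [G.irrefl, hbW _ he, fun h => hbW _ he h.symm, G.irrefl]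
  · intro u hu v hv
    simp only [Finset.mem_insert, Finset.mem_singleton] at hu hv
    rcases hu with rfl | rfl | rfl <;> rcases hv with rfl | rfl | rfl
    exacts [G.irrefl, hbW _ hx, hbW _ hx', fun h => hbW _ hx h.symm, G.irrefl, hxx,
      fun h => hbW _ hx' h.symm, fun h => hxx h.symm, G.irrefl]
  · intro v hv
    simp only [Finset.mem_insert, Finset.mem_singleton] at hv
    rcases hv with rfl | rfl
    exacts [mB _ hb, mW _ he]
  · intro v hv
    simp only [Finset.mem_insert, Finset.mem_singleton] at hv
    rcases hv with rfl | rfl | rfl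
    exacts [mB _ hb, mW _ hx, mW _ hx']
  · intro v hv
    simp only [Finset.mem_insert, Finset.mem_singleton] at hv
    rcases hv with rfl | rfl | rfl
    exacts [Or.inl (by simp), Or.inr ⟨e, by simp, hxe.symm⟩, Or.inr ⟨e, by simp, hxe'.symm⟩]
  · intro u hu v hv huv
    simp only [Finset.mem_insert, Finset.mem_singleton] at hu
    have hce : v = c ∨ v = e → v ∈ ({b, e} : Finset V) ∨ ∃ u ∈ ({b, e} : Finset V), G.Adj u v := by
      rintro (rfl | rfl)
      exacts [Or.inr ⟨b, by simp, hbc⟩, Or.inl (by simp)]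
    rcases hu with rfl | rfl | rfl
    · exact Or.inr ⟨_, by simp, huv⟩
    · exact hce ((hnx v hv).1 huv)
    · exact hce ((hnx' v hv).1 huv)

/-- A gated block obtained from a simplicial vertex. -/
theorem IsPureOfCard.exists_isGatedBlock_of_simplicial (hd : IsPureOfCard (indepCpx G) d)
    (hF : indepCpx G F) (hW : ∀ v, v ∈ W ↔ IsLinkVertex G F v) {f : V} (hf : f ∈ W)
    (hs : ∀ u ∈ W, ∀ v ∈ W, G.Adj f u → G.Adj f v → u ≠ v → G.Adj u v) :
    ∃ B W' F', f ∈ B ∧ IsGatedBlock G W B W' ∧ indepCpx G F' ∧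
      ∀ v, v ∈ W' ↔ IsLinkVertex G F' v := by
  classical
  set B := W.filter fun v => v = f ∨ G.Adj f v with hB
  set W' := W.filter fun v => ¬ (v = f ∨ G.Adj f v) with hW'
  have mB : ∀ v, v ∈ B ↔ v ∈ W ∧ (v = f ∨ G.Adj f v) := fun v => by rw [hB, Finset.mem_filter]
  have mW' : ∀ v, v ∈ W' ↔ v ∈ W ∧ ¬ (v = f ∨ G.Adj f v) := fun v => by
    rw [hW', Finset.mem_filter]
  have hfB : f ∈ B := (mB f).2 ⟨hf, Or.inl rfl⟩
  have hu : ∀ v, v ∈ W ↔ v ∈ B ∨ v ∈ W' := fun v => by rw [mB, mW']; tauto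
  have hdisj : ∀ v ∈ B, v ∉ W' := fun v hv hv' => ((mW' v).1 hv').2 ((mB v).1 hv).2
  have hfn : ∀ w ∈ W', ¬ G.Adj f w := fun w hw h => ((mW' w).1 hw).2 (Or.inr h)
  have hclq : ∀ u ∈ B, ∀ v ∈ B, u ≠ v → G.Adj u v := by
    intro u hu v hv huv
    obtain ⟨huW, rfl | hfu⟩ := (mB u).1 hu <;> obtain ⟨hvW, rfl | hfv⟩ := (mB v).1 hv
    · exact absurd rfl huv
    · exact hfv
    · exact hfu.symm
    · exact hs u huW v hvW hfu hfv huv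
  have hgate : ∀ c ∈ B, ∀ x ∈ W', G.Adj c x → G.Adj f c := by
    intro c hc x hx hcx
    obtain ⟨-, rfl | h⟩ := (mB c).1 hc
    · exact absurd hcx (hfn x hx)
    · exact h
  refine ⟨B, W', insert f F, hfB, ⟨hu, hdisj, Or.inl ⟨f, fun v hv => ((mB v).1 hv).1, hfB, hclq,
    fun w hw h => (mB w).2 ⟨hw, Or.inr h⟩⟩, ?_, ?_, ?_, ?_⟩,
    IsLinkVertex.indepCpx_insert hF ((hW f).1 hf), ?_⟩
  · intro c hc x hx hcx T hTW hT hTc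
    refine hd.exists_swap hF hW hu hdisj (I := {c}) (I' := {f}) ?_ ?_ (by simpa using hc)
      (by simpa using hfB) (by simp) ?_ ?_ ?_ (by simp) hx hcx hTW hT hTc
    · simp [indepCpx]
    · simp [indepCpx]
    · intro v hv
      by_cases h : v = c
      · exact Or.inl (by simp [h])
      · exact Or.inr ⟨c, by simp, hclq c hc v hv (Ne.symm h)⟩
    · intro u hu huc
      exact absurd (Finset.mem_singleton.1 hu) huc
    · intro u hu
      rw [Finset.mem_singleton.1 hu]
      exact hfn
  · exact fun c hc x hx hcx => ⟨f, hfB, hgate c hc x hx hcx, hfn⟩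
  · exact fun c hc c' hc' hcc x hx x' hx' hcx hcx' => ⟨hclq c hc c' hc' hcc, f, hfB,
      hgate c hc x hx hcx, hgate c' hc' x' hx' hcx', hfn⟩
  · intro c hc x hx x' hx' e he hxx hnx hnx'
    have hxc : G.Adj x c := (hnx c ((hu c).2 (Or.inl hc))).2 (Or.inl rfl)
    exact hd.not_twins hF hW hu hdisj hfB hc (hgate c hc x hx hxc.symm) hfn hx hx' he hxx hnx hnx'
  · intro v
    rw [mW', hW, IsLinkVertex, IsLinkVertex]
    simp only [Finset.mem_insert, forall_eq_or_imp, not_or]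
    tauto

end GatedBlocks

section CyclicLinks

variable {K : Type} [Field K] {V : Type} [Fintype V] [DecidableEq V] {G : SimpleGraph V}
  {W Z F : Finset V} {d : ℕ}

lemma exists_link_eq (hF : indepCpx G F) (hW : ∀ v, v ∈ W ↔ IsLinkVertex G F v) (hZW : Z ⊆ W)
    (hZ : ∀ z ∈ Z, ∀ w ∈ W, G.Adj z w → w ∈ Z) :
    ∃ F', indepCpx G F' ∧ ∀ v, v ∈ Z ↔ IsLinkVertex G F' v := by
  obtain ⟨F', hle, hmax⟩ := Finite.exists_le_maximal
    (p := fun T : Finset V => indepCpx G T ∧ F ⊆ T ∧ ∀ z ∈ Z, IsLinkVertex G T z)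
    (a := F) ⟨hF, subset_rfl, fun z hz => (hW z).1 (hZW hz)⟩
  obtain ⟨h1, h2, h3⟩ := hmax.prop
  refine ⟨F', h1, fun v => ⟨h3 v, fun hv => ?_⟩⟩
  by_contra hvZ
  have hvW : v ∈ W := (hW v).2 ⟨fun h => hv.1 (h2 h), fun u hu => hv.2 u (h2 hu)⟩
  refine hv.1 (hmax.le_of_ge (y := insert v F') ⟨hv.indepCpx_insert h1,
    h2.trans (Finset.subset_insert _ _), fun z hz => ⟨?_, ?_⟩⟩ (Finset.subset_insert _ _)
    (Finset.mem_insert_self _ _))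
  · rw [Finset.mem_insert, not_or]
    exact ⟨fun h => hvZ (h ▸ hz), (h3 z hz).1⟩
  · intro u hu
    rcases Finset.mem_insert.1 hu with rfl | hu
    · exact fun h => hvZ (hZ z hz u hvW h.symm)
    · exact (h3 z hz).2 u hu

lemma IsPureOfCard.card_add_card_le (hd : IsPureOfCard (indepCpx G) d) (hF : indepCpx G F)
    (hW : ∀ v, v ∈ W ↔ IsLinkVertex G F v) {J : Finset V} (hJ : indepCpx G J) (hJW : J ⊆ W) :
    F.card + J.card ≤ d := by
  rw [← Finset.card_union_of_disjoint
    (Finset.disjoint_right.2 fun v hv => ((hW v).1 (hJW hv)).1)]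
  refine hd.card_le fun u hu v hv => ?_
  rw [Finset.mem_union] at hu hv
  rcases hu with hu | hu <;> rcases hv with hv | hv
  · exact hF u hu v hv
  · exact ((hW v).1 (hJW hv)).2 u hu
  · exact fun h => ((hW u).1 (hJW hu)).2 v hv h.symm
  · exact hJ u hu v hv

/-- A link is not a four-cycle. -/
lemma IsCohenMacaulayQuot.link_ne_square (hd : IsPureOfCard (indepCpx G) d)
    (hCM : IsCohenMacaulayQuot K (edgeIdeal K G)) (hF : indepCpx G F) {x₁ x₂ x₃ x₄ : V}
    (h₁₃ : x₁ ≠ x₃) (h₁₂ : G.Adj x₁ x₂) (h₂₃ : G.Adj x₂ x₃) (h₃₄ : G.Adj x₃ x₄)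
    (h₄₁ : G.Adj x₄ x₁) (hn : ¬ G.Adj x₁ x₃)
    (hW : ∀ v, v ∈ ({x₁, x₂, x₃, x₄} : Finset V) ↔ IsLinkVertex G F v) : False := by
  have hcard := hd.card_add_card_le hF hW (J := {x₁, x₃}) (by
    intro u hu v hv
    simp only [Finset.mem_insert, Finset.mem_singleton] at hu hv
    rcases hu with rfl | rfl <;> rcases hv with rfl | rfl
    exacts [G.irrefl, hn, fun h => hn h.symm, G.irrefl])
    (by intro v; simp only [Finset.mem_insert, Finset.mem_singleton]; tauto)
  rw [Finset.card_pair h₁₃] at hcard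
  have := hCM.link_coloring_const hd hcard (fun v => if v = x₁ ∨ v = x₃ then 1 else 0) (by
    intro u v hu hv huv
    rw [← hW] at hu hv
    simp only [Finset.mem_insert, Finset.mem_singleton] at hu hv
    have e₂ : ¬ (x₂ = x₁ ∨ x₂ = x₃) := not_or.2 ⟨h₁₂.ne.symm, h₂₃.ne⟩
    have e₄ : ¬ (x₄ = x₁ ∨ x₄ = x₃) := not_or.2 ⟨h₄₁.ne, h₃₄.ne.symm⟩
    rcases hu with hu | hu | hu | hu <;> rcases hv with hv | hv | hv | hv <;> rw [hu, hv] at huv ⊢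
    all_goals first
      | exact absurd (by assumption) huv
      | exact absurd (SimpleGraph.Adj.symm (by assumption)) huv
      | simp [e₂, e₄]) hF ((hW x₁).1 (by simp)) ((hW x₂).1 (by simp))
  simp [h₁₂.ne.symm, h₂₃.ne] at this

/-- A cocycle on the pairs of non-adjacent vertices of a seven-cycle, the vertices `s`, `t` being
adjacent when `s - t` is `3` or `4`. -/
def heptagonCocycle (s t : Fin 7) : ℤ :=
  if (s = 6 ∧ t = 0) ∨ (s = 6 ∧ t = 1) ∨ (s = 5 ∧ t = 0) then 1
  else if (s = 0 ∧ t = 6) ∨ (s = 1 ∧ t = 6) ∨ (s = 0 ∧ t = 5) then -1 else 0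

lemma heptagonCocycle_add : ∀ s t u : Fin 7, ¬ (s - t = 3 ∨ s - t = 4) →
    ¬ (s - u = 3 ∨ s - u = 4) → ¬ (t - u = 3 ∨ t - u = 4) →
    heptagonCocycle t u - heptagonCocycle s u + heptagonCocycle s t = 0 := by
  decide

/-- A link is not a seven-cycle. -/
lemma IsCohenMacaulayQuot.link_ne_heptagon (hd : IsPureOfCard (indepCpx G) d)
    (hCM : IsCohenMacaulayQuot K (edgeIdeal K G)) (hF : indepCpx G F) {y : Fin 7 → V}
    (hy : Function.Injective y) (hadj : ∀ s t, G.Adj (y s) (y t) ↔ (s - t = 3 ∨ s - t = 4))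
    (hW : ∀ v, IsLinkVertex G F v ↔ ∃ t, y t = v) : False := by
  have hcard := hd.card_add_card_le hF (W := Finset.univ.image y)
    (fun v => by rw [hW]; simp) (J := {y 0, y 1, y 2}) (by
    intro u hu v hv
    simp only [Finset.mem_insert, Finset.mem_singleton] at hu hv
    rcases hu with rfl | rfl | rfl <;> rcases hv with rfl | rfl | rfl <;> rw [hadj] <;> decide)
    (by
      intro v
      simp only [Finset.mem_insert, Finset.mem_singleton, Finset.mem_image]
      rintro (rfl | rfl | rfl) <;> exact ⟨_, Finset.mem_univ _, rfl⟩)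
  rw [Finset.card_eq_three.2 ⟨y 0, y 1, y 2, hy.ne (by decide), hy.ne (by decide),
    hy.ne (by decide), rfl⟩] at hcard
  have hlink : ∀ l : List V, (∀ v ∈ l, v ∉ F) → indepCpx G (F ∪ l.toFinset) →
      ∀ v ∈ l, ∃ t, y t = v := fun l hl h v hv =>
    (hW v).1 ⟨hl v hv, fun u hu => h u (by simp [hu]) v (by simp [hv])⟩
  have hinv : ∀ t, Function.invFun y (y t) = t := Function.leftInverse_invFun hy
  obtain ⟨e, he⟩ := hCM.exists_primitive hd (F := F) (j := 2) (by omega)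
    (fun l => match l with
      | [a, b] => ((heptagonCocycle (Function.invFun y a) (Function.invFun y b) : ℤ) : K)
      | _ => 0) (by
      intro l hl hlF hli
      match l, hl with
      | [a, b, c], _ =>
        obtain ⟨s, rfl⟩ := hlink _ hlF hli a (by simp)
        obtain ⟨t, rfl⟩ := hlink _ hlF hli b (by simp)
        obtain ⟨u, rfl⟩ := hlink _ hlF hli c (by simp)
        have h := heptagonCocycle_add s t u
          (by rw [← hadj]; exact hli _ (by simp) _ (by simp))
          (by rw [← hadj]; exact hli _ (by simp) _ (by simp))
          (by rw [← hadj]; exact hli _ (by simp) _ (by simp))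
        have h' := congrArg (Int.cast (R := K)) h
        push_cast at h'
        simp only [koszulD, hinv, Pi.one_apply]
        linear_combination h')
  have hpair : ∀ s t : Fin 7, ¬ (s - t = 3 ∨ s - t = 4) →
      ((heptagonCocycle s t : ℤ) : K) = e [y t] - e [y s] := by
    intro s t hst
    have hs := (hW (y s)).2 ⟨s, rfl⟩
    have ht := (hW (y t)).2 ⟨t, rfl⟩
    have h := he [y s, y t] rfl (by
      intro v hv
      simp only [List.mem_cons, List.not_mem_nil, or_false] at hv
      rcases hv with rfl | rfl
      exacts [hs.1, ht.1]) (by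
      have h1 := hs.indepCpx_insert hF
      have h2 : IsLinkVertex G F (y t) := ht
      intro u hu v hv
      simp only [List.toFinset_cons, List.toFinset_nil, Finset.mem_union, Finset.mem_insert,
        Finset.notMem_empty, or_false] at hu hv
      have hst' : ¬ G.Adj (y s) (y t) := by rwa [hadj]
      rcases hu with hu | rfl | rfl <;> rcases hv with hv | rfl | rfl
      exacts [hF u hu v hv, hs.2 u hu, ht.2 u hu, fun h => hs.2 v hv h.symm, G.irrefl, hst',
        fun h => ht.2 v hv h.symm, fun h => hst' h.symm, G.irrefl])
    simp only [koszulD, hinv, Pi.one_apply] at h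
    linear_combination h
  have h0 := hpair 0 1 (by decide)
  have h1 := hpair 1 2 (by decide)
  have h2 := hpair 2 3 (by decide)
  have h3 := hpair 3 4 (by decide)
  have h4 := hpair 4 5 (by decide)
  have h5 := hpair 5 6 (by decide)
  have h6 := hpair 6 0 (by decide)
  rw [show heptagonCocycle 0 1 = 0 by decide, Int.cast_zero] at h0
  rw [show heptagonCocycle 1 2 = 0 by decide, Int.cast_zero] at h1
  rw [show heptagonCocycle 2 3 = 0 by decide, Int.cast_zero] at h2
  rw [show heptagonCocycle 3 4 = 0 by decide, Int.cast_zero] at h3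
  rw [show heptagonCocycle 4 5 = 0 by decide, Int.cast_zero] at h4
  rw [show heptagonCocycle 5 6 = 0 by decide, Int.cast_zero] at h5
  rw [show heptagonCocycle 6 0 = 1 by decide, Int.cast_one] at h6
  exact one_ne_zero (α := K) (by linear_combination h0 + h1 + h2 + h3 + h4 + h5 + h6)

end CyclicLinks

section CycleEnds

variable {V : Type} [DecidableEq V] {G : SimpleGraph V} {W A : Finset V} {c : V}

/-- All vertices of `A` have exactly two neighbours in `W`, which are non-adjacent and lie in
`A ∪ {c}`; moreover `c` has a neighbour in `A`. -/
structure IsCycleEnd (G : SimpleGraph V) (W A : Finset V) (c : V) : Prop where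
  subset : A ⊆ W
  mem : c ∈ W
  notMem : c ∉ A
  nbr : ∀ a ∈ A, ∃ u v, (u = c ∨ u ∈ A) ∧ (v = c ∨ v ∈ A) ∧ u ≠ v ∧ ¬ G.Adj u v ∧
    ∀ w ∈ W, G.Adj a w ↔ w = u ∨ w = v
  adj : ∃ z ∈ A, G.Adj c z

omit [DecidableEq V] in
lemma IsCycleEnd.exists_next (h : IsCycleEnd G W A c) {a p : V} (ha : a ∈ A) (hp : p ∈ W)
    (hap : G.Adj a p) : ∃ q, (q = c ∨ q ∈ A) ∧ q ∈ W ∧ q ≠ p ∧ ¬ G.Adj p q ∧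
      ∀ w ∈ W, G.Adj a w ↔ w = p ∨ w = q := by
  obtain ⟨u, v, hu, hv, huv, hnuv, hn⟩ := h.nbr a ha
  have hm : ∀ x, x = c ∨ x ∈ A → x ∈ W := by
    rintro x (rfl | hx)
    exacts [h.mem, h.subset hx]
  rcases (hn p hp).1 hap with rfl | rfl
  · exact ⟨v, hv, hm v hv, huv.symm, hnuv, hn⟩
  · exact ⟨u, hu, hm u hu, huv, fun h => hnuv h.symm, fun w hw => by rw [hn w hw, or_comm]⟩

theorem IsCactus.exists_isCycleEnd (hG : IsCactus G) (hne : W.Nonempty)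
    (hs : ∀ f ∈ W, ∃ u ∈ W, ∃ v ∈ W, G.Adj f u ∧ G.Adj f v ∧ u ≠ v ∧ ¬ G.Adj u v) :
    ∃ A c, IsCycleEnd G W A c := by
  classical
  let p : ℕ → Prop := fun n => ∃ (A : Finset V) (c : V), A.card = n ∧ A.Nonempty ∧ A ⊆ W ∧ c ∈ W ∧
    c ∉ A ∧ ∀ a ∈ A, ∀ w ∈ W, G.Adj a w → w = c ∨ w ∈ A
  have hp : ∃ n, p n := by
    obtain ⟨c, hc⟩ := hne
    obtain ⟨u, hu, -, -, hcu, -⟩ := hs c hc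
    exact ⟨_, W.erase c, c, rfl, ⟨u, Finset.mem_erase.2 ⟨hcu.ne.symm, hu⟩⟩,
      Finset.erase_subset _ _, hc, Finset.notMem_erase _ _,
      fun a _ w hw _ => or_iff_not_imp_left.2 fun h => Finset.mem_erase.2 ⟨h, hw⟩⟩
  obtain ⟨A, c, hcard, hA, hAW, hcW, hcA, hcl⟩ := Nat.find_spec hp
  have hmin : ∀ (A' : Finset V) (c' : V), A'.Nonempty → A' ⊆ A → c' ∈ A → c' ∉ A' →
      (∀ a ∈ A', ∀ w ∈ W, G.Adj a w → w = c' ∨ w ∈ A') → False := by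
    intro A' c' h1 h2 h3 h4 h5
    have hlt : A'.card < A.card := Finset.card_lt_card ⟨h2, fun h => h4 (h h3)⟩
    rw [hcard] at hlt
    exact Nat.find_min hp hlt ⟨A', c', rfl, h1, h2.trans hAW, hAW h3, h4, h5⟩
  have hreach : ∀ a ∈ A, ∀ x ∈ W, G.Adj a x → ReachableIn G (· ≠ a) c x := by
    intro a ha x hx hax
    by_contra hcon
    refine hmin (A.filter fun v => v ≠ a ∧ ReachableIn G (· ≠ a) x v) a ⟨x, ?_⟩
      (Finset.filter_subset _ _) ha (by simp) ?_
    · refine Finset.mem_filter.2 ⟨(hcl a ha x hx hax).resolve_left ?_, hax.ne.symm, .rfl⟩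
      rintro rfl
      exact hcon .rfl
    · intro v hv w hw hvw
      obtain ⟨hvA, hva, hxv⟩ := Finset.mem_filter.1 hv
      by_cases hwa : w = a
      · exact Or.inl hwa
      have hxw : ReachableIn G (· ≠ a) x w := hxv.trans (ReachableIn.step hvw hwa .rfl)
      refine Or.inr (Finset.mem_filter.2 ⟨(hcl v hvA w hw hvw).resolve_left ?_, hwa, hxw⟩)
      rintro rfl
      exact hcon (hxw.symm hax.ne.symm)
  refine ⟨A, c, hAW, hcW, hcA, ?_, ?_⟩
  · intro a ha
    obtain ⟨u, hu, v, hv, hau, hav, huv, hnuv⟩ := hs a (hAW ha)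
    refine ⟨u, v, hcl a ha u hu hau, hcl a ha v hv hav, huv, hnuv, fun w hw => ⟨fun haw => ?_, ?_⟩⟩
    · by_contra hcon
      push Not at hcon
      have hca : c ≠ a := fun h => hcA (h ▸ ha)
      have hr : ReachableIn G (· ≠ a) u c := (hreach a ha u hu hau).symm hca
      exact hG.not_theta hau hav haw huv hcon.1.symm hcon.2.symm
        (hr.trans (hreach a ha v hv hav)) (hr.trans (hreach a ha w hw haw))
    · rintro (rfl | rfl)
      exacts [hau, hav]
  · by_contra hcon
    push Not at hcon
    obtain ⟨a, ha⟩ := hA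
    obtain ⟨u, hu, -, -, hau, -⟩ := hs a (hAW ha)
    have huA : u ∈ A := (hcl a ha u hu hau).resolve_left fun h => hcon a ha (h ▸ hau.symm)
    refine hmin (A.erase a) a ⟨u, Finset.mem_erase.2 ⟨hau.ne.symm, huA⟩⟩ (Finset.erase_subset _ _)
      ha (Finset.notMem_erase _ _) fun v hv w hw hvw => or_iff_not_imp_left.2 fun hwa =>
        Finset.mem_erase.2 ⟨hwa, ?_⟩
    have hvA := Finset.mem_of_mem_erase hv
    exact (hcl v hvA w hw hvw).resolve_left fun h => hcon v hvA (h ▸ hvw.symm)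

end CycleEnds

section CycleEndLengths

variable {V : Type} [Fintype V] [DecidableEq V] {G : SimpleGraph V} {W F : Finset V} {d : ℕ}
  {z₀ z₁ z₂ z₃ z₄ z₅ z₆ z₇ w : V}

lemma IsPureOfCard.not_square_tail (hd : IsPureOfCard (indepCpx G) d)
    (hF : indepCpx G F) (hW : ∀ v, v ∈ W ↔ IsLinkVertex G F v) (m₁ : z₁ ∈ W) (m₂ : z₂ ∈ W)
    (m₃ : z₃ ∈ W) (n₁ : ∀ v ∈ W, G.Adj z₁ v ↔ v = z₀ ∨ v = z₂)
    (n₂ : ∀ v ∈ W, G.Adj z₂ v ↔ v = z₁ ∨ v = z₃) (n₃ : ∀ v ∈ W, G.Adj z₃ v ↔ v = z₂ ∨ v = z₀)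
    (hne : z₁ ≠ z₃) (hw : w ∈ W) (h₀ : G.Adj z₀ w) (hw₁ : w ≠ z₁) (hw₂ : w ≠ z₂)
    (hw₃ : w ≠ z₃) : False := by
  have := hd.card_le_of_dominates_link hF hW (I := {w, z₂}) (I' := {w, z₁, z₃})
    (by intro u hu v hv; grind [SimpleGraph.Adj.symm, SimpleGraph.irrefl])
    (by intro u hu v hv; grind [SimpleGraph.Adj.symm, SimpleGraph.irrefl])
    (by intro v hv; grind) (by intro v hv; grind)
    (by intro v hv; grind [SimpleGraph.Adj.symm])
    (by intro u hu v hv huv; grind [SimpleGraph.Adj.symm])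
  grind

lemma IsPureOfCard.not_hexagon_tail (hd : IsPureOfCard (indepCpx G) d)
    (hF : indepCpx G F) (hW : ∀ v, v ∈ W ↔ IsLinkVertex G F v) (m₀ : z₀ ∈ W) (m₁ : z₁ ∈ W)
    (m₃ : z₃ ∈ W) (m₅ : z₅ ∈ W) (n₁ : ∀ v ∈ W, G.Adj z₁ v ↔ v = z₀ ∨ v = z₂)
    (n₃ : ∀ v ∈ W, G.Adj z₃ v ↔ v = z₂ ∨ v = z₄)
    (n₅ : ∀ v ∈ W, G.Adj z₅ v ↔ v = z₄ ∨ v = z₀)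
    (h₀₂ : z₀ ≠ z₂) (h₀₃ : z₀ ≠ z₃) (h₀₄ : z₀ ≠ z₄) (h₁₃ : z₁ ≠ z₃) (h₁₅ : z₁ ≠ z₅)
    (h₃₅ : z₃ ≠ z₅) (h₁₂ : z₁ ≠ z₂) (h₁₄ : z₁ ≠ z₄) (h₂₃ : z₂ ≠ z₃) (h₂₅ : z₂ ≠ z₅)
    (m₄ : z₄ ∈ W) : False := by
  have := hd.card_le_of_dominates_link hF hW (I := {z₀, z₃}) (I' := {z₁, z₃, z₅})
    (by intro u hu v hv; grind [SimpleGraph.Adj.symm, SimpleGraph.irrefl])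
    (by intro u hu v hv; grind [SimpleGraph.Adj.symm, SimpleGraph.irrefl])
    (by intro v hv; grind) (by intro v hv; grind)
    (by intro v hv; grind [SimpleGraph.Adj.symm])
    (by intro u hu v hv huv; grind [SimpleGraph.Adj.symm])
  grind

lemma IsPureOfCard.not_heptagon_tail (hd : IsPureOfCard (indepCpx G) d)
    (hF : indepCpx G F) (hW : ∀ v, v ∈ W ↔ IsLinkVertex G F v) (m₁ : z₁ ∈ W) (m₂ : z₂ ∈ W)
    (m₃ : z₃ ∈ W) (m₄ : z₄ ∈ W) (m₅ : z₅ ∈ W) (m₆ : z₆ ∈ W)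
    (n₁ : ∀ v ∈ W, G.Adj z₁ v ↔ v = z₀ ∨ v = z₂) (n₂ : ∀ v ∈ W, G.Adj z₂ v ↔ v = z₁ ∨ v = z₃)
    (n₃ : ∀ v ∈ W, G.Adj z₃ v ↔ v = z₂ ∨ v = z₄) (n₄ : ∀ v ∈ W, G.Adj z₄ v ↔ v = z₃ ∨ v = z₅)
    (n₅ : ∀ v ∈ W, G.Adj z₅ v ↔ v = z₄ ∨ v = z₆) (n₆ : ∀ v ∈ W, G.Adj z₆ v ↔ v = z₅ ∨ v = z₀)
    (hc : [z₀, z₁, z₂, z₃, z₄, z₅, z₆].Nodup) (hw : w ∈ W) (h₀ : G.Adj z₀ w) (hw₁ : w ≠ z₁)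
    (hw₆ : w ≠ z₆) (m₀ : z₀ ∈ W) : False := by
  have hw₂ : w ≠ z₂ := by rintro rfl; grind [SimpleGraph.Adj.symm]
  have hw₃ : w ≠ z₃ := by rintro rfl; grind [SimpleGraph.Adj.symm]
  have hw₅ : w ≠ z₅ := by rintro rfl; grind [SimpleGraph.Adj.symm]
  have hw₄ : w ≠ z₄ := by rintro rfl; grind [SimpleGraph.Adj.symm]
  have := hd.card_le_of_dominates_link hF hW (I := {w, z₂, z₅}) (I' := {w, z₁, z₃, z₆})
    (by intro u hu v hv; grind [SimpleGraph.Adj.symm, SimpleGraph.irrefl])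
    (by intro u hu v hv; grind [SimpleGraph.Adj.symm, SimpleGraph.irrefl])
    (by intro v hv; grind) (by intro v hv; grind)
    (by intro v hv; grind [SimpleGraph.Adj.symm])
    (by intro u hu v hv huv; grind [SimpleGraph.Adj.symm])
  grind

lemma IsPureOfCard.not_long_tail (hd : IsPureOfCard (indepCpx G) d)
    (hF : indepCpx G F) (hW : ∀ v, v ∈ W ↔ IsLinkVertex G F v) {z₈ : V} (m₁ : z₁ ∈ W)
    (m₂ : z₂ ∈ W) (m₃ : z₃ ∈ W) (m₄ : z₄ ∈ W) (m₅ : z₅ ∈ W) (m₆ : z₆ ∈ W) (m₇ : z₇ ∈ W)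
    (n₁ : ∀ v ∈ W, G.Adj z₁ v ↔ v = z₀ ∨ v = z₂)
    (n₃ : ∀ v ∈ W, G.Adj z₃ v ↔ v = z₂ ∨ v = z₄) (n₄ : ∀ v ∈ W, G.Adj z₄ v ↔ v = z₃ ∨ v = z₅)
    (n₅ : ∀ v ∈ W, G.Adj z₅ v ↔ v = z₄ ∨ v = z₆) (n₇ : ∀ v ∈ W, G.Adj z₇ v ↔ v = z₆ ∨ v = z₈)
    (hc : [z₀, z₁, z₂, z₃, z₄, z₅, z₆, z₇].Nodup) : False := by
  have := hd.card_le_of_dominates_link hF hW (I := {z₁, z₄, z₇}) (I' := {z₁, z₃, z₅, z₇})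
    (by intro u hu v hv; grind [SimpleGraph.Adj.symm, SimpleGraph.irrefl])
    (by intro u hu v hv; grind [SimpleGraph.Adj.symm, SimpleGraph.irrefl])
    (by intro v hv; grind) (by intro v hv; grind)
    (by intro v hv; grind [SimpleGraph.Adj.symm])
    (by intro u hu v hv huv; grind [SimpleGraph.Adj.symm])
  grind

end CycleEndLengths

section CycleBlocks

variable {V : Type} [Fintype V] [DecidableEq V] {G : SimpleGraph V} {W F : Finset V} {d : ℕ}

/-- A gated block obtained from a pentagon with a single attaching vertex. -/
theorem IsPureOfCard.exists_isGatedBlock_of_pentagon (hd : IsPureOfCard (indepCpx G) d)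
    (hF : indepCpx G F) (hW : ∀ v, v ∈ W ↔ IsLinkVertex G F v) {z₀ z₁ z₂ z₃ z₄ : V}
    (m₀ : z₀ ∈ W) (m₁ : z₁ ∈ W) (m₂ : z₂ ∈ W) (m₃ : z₃ ∈ W) (m₄ : z₄ ∈ W)
    (n₁ : ∀ v ∈ W, G.Adj z₁ v ↔ v = z₀ ∨ v = z₂) (n₂ : ∀ v ∈ W, G.Adj z₂ v ↔ v = z₁ ∨ v = z₃)
    (n₃ : ∀ v ∈ W, G.Adj z₃ v ↔ v = z₂ ∨ v = z₄) (n₄ : ∀ v ∈ W, G.Adj z₄ v ↔ v = z₃ ∨ v = z₀)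
    (hc : [z₀, z₁, z₂, z₃, z₄].Nodup) :
    ∃ B W' F', z₀ ∈ B ∧ IsGatedBlock G W B W' ∧ indepCpx G F' ∧
      ∀ v, v ∈ W' ↔ IsLinkVertex G F' v := by
  have hBW : ({z₀, z₁, z₂, z₃, z₄} : Finset V) ⊆ W := by intro v hv; grind
  have hu : ∀ v, v ∈ W ↔ v ∈ ({z₀, z₁, z₂, z₃, z₄} : Finset V) ∨ v ∈ W \ {z₀, z₁, z₂, z₃, z₄} := by
    intro v; rw [Finset.mem_sdiff]; have := @hBW v; tauto
  have hdisj : ∀ v ∈ ({z₀, z₁, z₂, z₃, z₄} : Finset V), v ∉ W \ {z₀, z₁, z₂, z₃, z₄} :=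
    fun v hv h => (Finset.mem_sdiff.1 h).2 hv
  have hno : ∀ u ∈ ({z₀, z₁, z₂, z₃, z₄} : Finset V), u ≠ z₀ →
      ∀ x ∈ W \ {z₀, z₁, z₂, z₃, z₄}, ¬ G.Adj u x := by
    intro u hu hu0 x hx; grind
  have hgate : ∀ c ∈ ({z₀, z₁, z₂, z₃, z₄} : Finset V), ∀ x ∈ W \ {z₀, z₁, z₂, z₃, z₄},
      G.Adj c x → c = z₀ := by
    intro c hc x hx hcx
    by_contra h
    exact hno c hc h x hx hcx
  have h10 : G.Adj z₁ z₀ := (n₁ z₀ m₀).2 (Or.inl rfl)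
  have hz₁ : ∀ x ∈ W \ {z₀, z₁, z₂, z₃, z₄}, ¬ G.Adj z₁ x :=
    hno z₁ (by simp) (by grind)
  refine ⟨{z₀, z₁, z₂, z₃, z₄}, W \ {z₀, z₁, z₂, z₃, z₄}, insert z₁ (insert z₃ F), by simp,
    ⟨hu, hdisj, Or.inr (Or.inr ⟨z₀, z₁, z₂, z₃, z₄, rfl, hBW, ?_, ?_, ?_, ?_, ?_, n₁, n₃, n₄⟩),
    ?_, ?_, ?_, ?_⟩, ?_, ?_⟩
  iterate 5 grind
  · intro c hc x hx hcx T hTW hT hTc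
    obtain rfl := hgate c hc x hx hcx
    refine hd.exists_swap hF hW hu hdisj (I := {c, z₂}) (I' := {z₁, z₃}) ?_ ?_ ?_ ?_ ?_ ?_ ?_ ?_
      (by simp) hx hcx hTW hT hTc
    · intro u hu v hv; grind [SimpleGraph.Adj.symm, SimpleGraph.irrefl]
    · intro u hu v hv; grind [SimpleGraph.Adj.symm, SimpleGraph.irrefl]
    · intro v hv; grind
    · intro v hv; grind
    · rw [Finset.card_pair (by grind), Finset.card_pair (by grind)]
    · intro v hv; grind [SimpleGraph.Adj.symm]
    · intro u hu huc; exact hno u (by grind) huc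
    · intro u hu; exact hno u (by grind) (by grind)
  · intro c hc x hx hcx
    obtain rfl := hgate c hc x hx hcx
    exact ⟨z₁, by simp, h10, hz₁⟩
  · intro c hc c' hc' hcc x hx x' hx' hcx hcx'
    exact absurd ((hgate c hc x hx hcx).trans (hgate c' hc' x' hx' hcx').symm) hcc
  · intro c hc x hx x' hx' e he hxx hnx hnx'
    have hxc : G.Adj x c := (hnx c (hBW hc)).2 (Or.inl rfl)
    obtain rfl := hgate c hc x hx hxc.symm
    exact hd.not_twins hF hW hu hdisj (b := z₁) (by simp) (by simp) h10 hz₁ hx hx' he hxx hnx hnx'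
  · have h3 := IsLinkVertex.indepCpx_insert hF ((hW z₃).1 m₃)
    refine IsLinkVertex.indepCpx_insert h3 ⟨?_, ?_⟩
    · rw [Finset.mem_insert, not_or]
      exact ⟨by grind, ((hW z₁).1 m₁).1⟩
    · intro u hu
      rcases Finset.mem_insert.1 hu with rfl | hu
      · intro h; grind
      · exact ((hW z₁).1 m₁).2 u hu
  · intro v
    rw [Finset.mem_sdiff, hW]
    have k : v ∈ W → (v ∉ ({z₀, z₁, z₂, z₃, z₄} : Finset V) ↔
        v ≠ z₁ ∧ v ≠ z₃ ∧ ¬ G.Adj z₁ v ∧ ¬ G.Adj z₃ v) := fun hv => by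
      rw [n₁ v hv, n₃ v hv]; grind
    constructor
    · rintro ⟨hv, hvB⟩
      obtain ⟨k1, k2, k3, k4⟩ := (k ((hW v).2 hv)).1 hvB
      refine ⟨by simp [k1, k2, hv.1], fun u hu => ?_⟩
      rcases Finset.mem_insert.1 hu with rfl | hu
      · exact k3
      rcases Finset.mem_insert.1 hu with rfl | hu
      exacts [k4, hv.2 u hu]
    · rintro ⟨hv1, hv2⟩
      simp only [Finset.mem_insert, not_or] at hv1
      have hv : IsLinkVertex G F v := ⟨hv1.2.2, fun u hu => hv2 u (by simp [hu])⟩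
      exact ⟨hv, (k ((hW v).2 hv)).2 ⟨hv1.1, hv1.2.1, hv2 z₁ (by simp), hv2 z₃ (by simp)⟩⟩

lemma IsCohenMacaulayQuot.not_heptagon_component {K : Type} [Field K]
    (hd : IsPureOfCard (indepCpx G) d) (hCM : IsCohenMacaulayQuot K (edgeIdeal K G))
    (hF : indepCpx G F) {z₀ z₁ z₂ z₃ z₄ z₅ z₆ : V} (hc : [z₀, z₁, z₂, z₃, z₄, z₅, z₆].Nodup)
    (hW : ∀ v, v ∈ ({z₀, z₁, z₂, z₃, z₄, z₅, z₆} : Finset V) ↔ IsLinkVertex G F v)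
    (hWn : ({z₀, z₁, z₂, z₃, z₄, z₅, z₆} : Finset V) ⊆ W)
    (n₀ : ∀ v ∈ W, G.Adj z₀ v ↔ v = z₆ ∨ v = z₁) (n₁ : ∀ v ∈ W, G.Adj z₁ v ↔ v = z₀ ∨ v = z₂)
    (n₂ : ∀ v ∈ W, G.Adj z₂ v ↔ v = z₁ ∨ v = z₃) (n₃ : ∀ v ∈ W, G.Adj z₃ v ↔ v = z₂ ∨ v = z₄)
    (n₄ : ∀ v ∈ W, G.Adj z₄ v ↔ v = z₃ ∨ v = z₅) (n₅ : ∀ v ∈ W, G.Adj z₅ v ↔ v = z₄ ∨ v = z₆)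
    (n₆ : ∀ v ∈ W, G.Adj z₆ v ↔ v = z₅ ∨ v = z₀) : False := by
  obtain ⟨y, hy⟩ : ∃ y : Fin 7 → V, y = ![z₀, z₂, z₄, z₆, z₁, z₃, z₅] := ⟨_, rfl⟩
  have hmem : ∀ v, v ∈ ({z₀, z₁, z₂, z₃, z₄, z₅, z₆} : Finset V) ↔ ∃ t, y t = v := by
    intro v
    simp only [Finset.mem_insert, Finset.mem_singleton, hy]
    constructor
    · rintro (rfl | rfl | rfl | rfl | rfl | rfl | rfl)
      exacts [⟨0, rfl⟩, ⟨4, rfl⟩, ⟨1, rfl⟩, ⟨5, rfl⟩, ⟨2, rfl⟩, ⟨6, rfl⟩, ⟨3, rfl⟩]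
    · rintro ⟨t, rfl⟩
      fin_cases t <;> simp
  have hinj : Function.Injective y := by
    have : (List.ofFn y).Nodup := by
      rw [hy]
      simp only [List.ofFn_succ, List.ofFn_zero, Matrix.cons_val_zero, Matrix.cons_val_succ]
      grind
    exact List.nodup_ofFn.1 this
  have key : ∀ s t, G.Adj (y s) (y t) ↔ y t = y (s + 3) ∨ y t = y (s + 4) := by
    intro s t
    have ht : y t ∈ W := hWn ((hmem _).2 ⟨t, rfl⟩)
    generalize y t = v at ht
    rw [hy]
    fin_cases s
    exacts [n₀ v ht, n₂ v ht, n₄ v ht, n₆ v ht, n₁ v ht, n₃ v ht, n₅ v ht]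
  refine hCM.link_ne_heptagon hd hF hinj (fun s t => ?_) fun v => by rw [← hW, hmem]
  rw [key, hinj.eq_iff, hinj.eq_iff]
  revert s t
  decide

theorem IsCycleEnd.exists_isGatedBlock {K : Type} [Field K] (hd : IsPureOfCard (indepCpx G) d)
    (hCM : IsCohenMacaulayQuot K (edgeIdeal K G)) (hF : indepCpx G F)
    (hW : ∀ v, v ∈ W ↔ IsLinkVertex G F v) {A : Finset V} {z₀ : V} (h : IsCycleEnd G W A z₀) :
    ∃ B W' F', z₀ ∈ B ∧ IsGatedBlock G W B W' ∧ indepCpx G F' ∧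
      ∀ v, v ∈ W' ↔ IsLinkVertex G F' v := by
  have hsub := h.subset
  have m₀ := h.mem
  have hn₀ := h.notMem
  obtain ⟨z₁, a₁, h01⟩ := h.adj
  have m₁ := hsub a₁
  obtain ⟨z₂, a₂, m₂, h20, x02, n₁⟩ := h.exists_next a₁ m₀ h01.symm
  replace a₂ := a₂.resolve_left h20
  obtain ⟨z₃, a₃, m₃, h31, x13, n₂⟩ := h.exists_next a₂ m₁ ((n₁ z₂ m₂).2 (Or.inr rfl)).symm
  have h12 : G.Adj z₁ z₂ := (n₁ z₂ m₂).2 (Or.inr rfl)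
  have h23 : G.Adj z₂ z₃ := (n₂ z₃ m₃).2 (Or.inr rfl)
  have h30 : z₃ ≠ z₀ := fun h' => x13 (h' ▸ h01.symm)
  replace a₃ := a₃.resolve_left h30
  obtain ⟨z₄, a₄, m₄, h42, x24, n₃⟩ := h.exists_next a₃ m₂ h23.symm
  have h34 : G.Adj z₃ z₄ := (n₃ z₄ m₄).2 (Or.inr rfl)
  have h41 : z₄ ≠ z₁ := fun h' => x13 (h' ▸ h34.symm)
  rcases a₄ with rfl | a₄
  · by_cases hex : ∃ w ∈ W, G.Adj z₄ w ∧ w ≠ z₁ ∧ w ≠ z₃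
    · obtain ⟨w, hw, h0w, hw1, hw3⟩ := hex
      refine (hd.not_square_tail hF hW m₁ m₂ m₃ n₁ n₂ n₃ h31.symm hw h0w hw1 ?_ hw3).elim
      rintro rfl
      exact x02 h0w
    · push Not at hex
      obtain ⟨F', hF', hZ⟩ := exists_link_eq (Z := {z₁, z₂, z₃, z₄}) hF hW
        (by intro v hv; grind) (by intro u hu v hv huv; grind)
      exact (hCM.link_ne_square hd hF' h31.symm h12 h23 h34 h01 x13 hZ).elim
  have h40 : z₄ ≠ z₀ := fun h' => hn₀ (h' ▸ a₄)
  obtain ⟨z₅, a₅, m₅, h53, x35, n₄⟩ := h.exists_next a₄ m₃ h34.symm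
  have h45 : G.Adj z₄ z₅ := (n₄ z₅ m₅).2 (Or.inr rfl)
  rcases a₅ with rfl | a₅
  · exact hd.exists_isGatedBlock_of_pentagon hF hW m₀ m₁ m₂ m₃ m₄ n₁ n₂ n₃ n₄
      (by have := h01.ne; have := h12.ne; have := h23.ne; have := h34.ne; have := h45.ne; grind)
  have h50 : z₅ ≠ z₀ := fun h' => hn₀ (h' ▸ a₅)
  have h51 : z₅ ≠ z₁ := by
    rintro rfl; have := (n₁ z₄ m₄).1 h45.symm; grind
  have h52 : z₅ ≠ z₂ := fun h' => x24 (h' ▸ h45.symm)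
  obtain ⟨z₆, a₆, m₆, h64, x46, n₅⟩ := h.exists_next a₅ m₄ h45.symm
  have h56 : G.Adj z₅ z₆ := (n₅ z₆ m₆).2 (Or.inr rfl)
  rcases a₆ with rfl | a₆
  · refine (hd.not_hexagon_tail hF hW m₀ m₁ m₃ m₅ n₁ n₃ n₅ ?_ ?_ ?_ ?_ ?_ ?_ ?_ ?_ ?_ ?_
      m₄).elim
    exacts [h20.symm, h30.symm, h40.symm, h31.symm, h51.symm, h53.symm, h12.ne, h41.symm, h23.ne,
      h52.symm]
  have h60 : z₆ ≠ z₀ := fun h' => hn₀ (h' ▸ a₆)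
  have h61 : z₆ ≠ z₁ := by
    rintro rfl; have := (n₁ z₅ m₅).1 h56.symm; grind
  have h62 : z₆ ≠ z₂ := by
    rintro rfl; have := (n₂ z₅ m₅).1 h56.symm; grind
  have h63 : z₆ ≠ z₃ := fun h' => x35 (h' ▸ h56.symm)
  obtain ⟨z₇, a₇, m₇, h75, x57, n₆⟩ := h.exists_next a₆ m₅ h56.symm
  have h67 : G.Adj z₆ z₇ := (n₆ z₇ m₇).2 (Or.inr rfl)
  have hne := And.intro h01.ne (And.intro h12.ne (And.intro h23.ne (And.intro h34.ne
    (And.intro h45.ne (And.intro h56.ne h67.ne)))))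
  rcases a₇ with rfl | a₇
  · have hnd : [z₇, z₁, z₂, z₃, z₄, z₅, z₆].Nodup := by grind
    by_cases hex : ∃ w ∈ W, G.Adj z₇ w ∧ w ≠ z₁ ∧ w ≠ z₆
    · obtain ⟨w, hw, h0w, hw1, hw6⟩ := hex
      exact (hd.not_heptagon_tail hF hW m₁ m₂ m₃ m₄ m₅ m₆ n₁ n₂ n₃ n₄ n₅ n₆ hnd hw h0w hw1 hw6
        m₀).elim
    · push Not at hex
      have n₀ : ∀ w ∈ W, G.Adj z₇ w ↔ w = z₆ ∨ w = z₁ := fun w hw => ⟨fun h' =>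
        or_iff_not_imp_right.2 (hex w hw h'), by rintro (rfl | rfl); exacts [h67.symm, h01]⟩
      have hZW : ({z₇, z₁, z₂, z₃, z₄, z₅, z₆} : Finset V) ⊆ W := by intro v hv; grind
      obtain ⟨F', hF', hZ⟩ := exists_link_eq hF hW hZW (by intro u hu v hv huv; grind)
      exact (hCM.not_heptagon_component hd hF' hnd hZ hZW n₀ n₁ n₂ n₃ n₄ n₅ n₆).elim
  have h70 : z₇ ≠ z₀ := fun h' => hn₀ (h' ▸ a₇)
  have h71 : z₇ ≠ z₁ := by
    rintro rfl; have := (n₁ z₆ m₆).1 h67.symm; grind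
  have h72 : z₇ ≠ z₂ := by
    rintro rfl; have := (n₂ z₆ m₆).1 h67.symm; grind
  have h73 : z₇ ≠ z₃ := by
    rintro rfl; have := (n₃ z₆ m₆).1 h67.symm; grind
  have h74 : z₇ ≠ z₄ := fun h' => x46 (h' ▸ h67.symm)
  obtain ⟨z₈, -, -, -, -, n₇⟩ := h.exists_next a₇ m₆ h67.symm
  exact (hd.not_long_tail hF hW m₁ m₂ m₃ m₄ m₅ m₆ m₇ n₁ n₃ n₄ n₅ n₇ (by grind)).elim

theorem IsCactus.exists_isGatedBlock {K : Type} [Field K] (hG : IsCactus G)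
    (hd : IsPureOfCard (indepCpx G) d) (hCM : IsCohenMacaulayQuot K (edgeIdeal K G))
    (hF : indepCpx G F) (hW : ∀ v, v ∈ W ↔ IsLinkVertex G F v) (hne : W.Nonempty) :
    ∃ B W' F', B.Nonempty ∧ IsGatedBlock G W B W' ∧ indepCpx G F' ∧
      ∀ v, v ∈ W' ↔ IsLinkVertex G F' v := by
  by_cases hs : ∃ f ∈ W, ∀ u ∈ W, ∀ v ∈ W, G.Adj f u → G.Adj f v → u ≠ v → G.Adj u v
  · obtain ⟨f, hf, hs⟩ := hs
    obtain ⟨B, W', F', h1, h2⟩ := hd.exists_isGatedBlock_of_simplicial hF hW hf hs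
    exact ⟨B, W', F', ⟨f, h1⟩, h2⟩
  · push Not at hs
    obtain ⟨A, c, h⟩ := hG.exists_isCycleEnd hne hs
    obtain ⟨B, W', F', h1, h2⟩ := h.exists_isGatedBlock hd hCM hF hW
    exact ⟨B, W', F', ⟨c, h1⟩, h2⟩

end CycleBlocks

section CactusExchange

variable {V : Type} [DecidableEq V] {G : SimpleGraph V}

lemma IsPiece.subset {W P : Finset V} (h : IsPiece G W P) : P ⊆ W := by
  rcases h with ⟨f, h⟩ | ⟨x₁, x₂, x₃, x₄, h⟩ | ⟨v₁, v₂, v₃, v₄, v₅, h⟩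
  · exact h.subset
  · rw [h.eq, Finset.insert_subset_iff, Finset.singleton_subset_iff]
    exact ⟨h.mem₁, h.mem₂⟩
  · exact h.subset

/-- Every pentagon piece of a cactus has a separator. -/
lemma IsPentagonPiece.exists_isPentagonSeparator [Fintype V] (hG : IsCactus G) {P : Finset V}
    {v₁ v₂ v₃ v₄ v₅ : V} (h : IsPentagonPiece G Finset.univ P v₁ v₂ v₃ v₄ v₅) :
    ∃ D, IsPentagonSeparator G P D v₁ v₃ := by
  classical
  have n2 := fun w => h.nbr₂ w (Finset.mem_univ _)
  have n4 := fun w => h.nbr₄ w (Finset.mem_univ _)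
  have n5 := fun w => h.nbr₅ w (Finset.mem_univ _)
  have hP : ∀ v, v ∈ P ↔ v = v₁ ∨ v = v₂ ∨ v = v₃ ∨ v = v₄ ∨ v = v₅ := by
    intro v; rw [h.eq]; simp
  refine ⟨Finset.univ.filter fun v => v ∉ P ∧ ∃ g, G.Adj v₁ g ∧ g ∉ P ∧
    ReachableIn G (· ∉ P) g v, ?_, ?_, ?_, ?_⟩
  · intro v hv
    exact (Finset.mem_filter.1 hv).2.1
  · intro v hv hvP
    exact Finset.mem_filter.2 ⟨Finset.mem_univ _, hvP, v, hv, hvP, ReachableIn.rfl⟩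
  · intro u hu v huv hvP
    obtain ⟨-, -, g, hg, hgP, hr⟩ := Finset.mem_filter.1 hu
    exact Finset.mem_filter.2 ⟨Finset.mem_univ _, hvP, g, hg, hgP,
      Relation.ReflTransGen.tail hr ⟨huv, hvP⟩⟩
  · intro u hu h3u
    obtain ⟨-, huP, g, hg, hgP, hr⟩ := Finset.mem_filter.1 hu
    have a21 : G.Adj v₂ v₁ := (n2 _).2 (Or.inl rfl)
    have a23 : G.Adj v₂ v₃ := (n2 _).2 (Or.inr rfl)
    have a43 : G.Adj v₄ v₃ := (n4 _).2 (Or.inl rfl)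
    have a45 : G.Adj v₄ v₅ := (n4 _).2 (Or.inr rfl)
    have a51 : G.Adj v₅ v₁ := (n5 _).2 (Or.inr rfl)
    have hu1 : u ≠ v₁ := fun e => huP ((hP u).2 (Or.inl e))
    refine hG.not_theta a21.symm a51.symm hg h.ne₂₅ ?_ ?_ ?_ ?_
    · rintro rfl
      exact hgP ((hP _).2 (by simp))
    · rintro rfl
      exact hgP ((hP _).2 (by simp))
    · exact ReachableIn.step a23 h.ne₁₃.symm (ReachableIn.step a43.symm h.ne₁₄.symm
        (ReachableIn.step a45 a51.ne ReachableIn.rfl))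
    · refine ReachableIn.step a23 h.ne₁₃.symm (ReachableIn.step h3u hu1 ?_)
      refine (ReachableIn.symm (S := (· ∉ P)) hgP hr).mono ?_
      rintro v hv rfl
      exact hv ((hP _).2 (Or.inl rfl))

/-- The link of an independent set in a Cohen–Macaulay cactus is partitioned into pieces. -/
lemma IsCactus.exists_pieces [Fintype V] {K : Type} [Field K] {d : ℕ} (hG : IsCactus G)
    (hd : IsPureOfCard (indepCpx G) d) (hCM : IsCohenMacaulayQuot K (edgeIdeal K G))
    (W F : Finset V) (hF : indepCpx G F) (hW : ∀ v, v ∈ W ↔ IsLinkVertex G F v) :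
    ∃ 𝒬 : Finset (Finset V), (∀ P ∈ 𝒬, ∀ Q ∈ 𝒬, P ≠ Q → Disjoint P Q) ∧
      (∀ P ∈ 𝒬, IsPiece G W P) ∧ ∀ v ∈ W, ∃ P ∈ 𝒬, v ∈ P := by
  induction W using Finset.strongInduction generalizing F with
  | H W ih =>
    rcases W.eq_empty_or_nonempty with rfl | hne
    · exact ⟨∅, by simp, by simp, by simp⟩
    · obtain ⟨B, W', F', ⟨b, hb⟩, hB, hF', hW'⟩ := hG.exists_isGatedBlock hd hCM hF hW hne
      have hss : W' ⊂ W := Finset.ssubset_iff_of_subset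
        (fun v hv => (hB.union v).2 (Or.inr hv)) |>.2
        ⟨b, (hB.union b).2 (Or.inl hb), hB.disj b hb⟩
      obtain ⟨𝒬, h1, h2, h3⟩ := ih W' hss F' hF' hW'
      have hBQ : ∀ Q ∈ 𝒬, Disjoint B Q := fun Q hQ =>
        Finset.disjoint_left.2 fun v hv hvQ => hB.disj v hv ((h2 Q hQ).subset hvQ)
      refine ⟨insert B 𝒬, ?_, ?_, ?_⟩
      · intro P hP Q hQ hPQ
        rcases Finset.mem_insert.1 hP with rfl | hP' <;>
          rcases Finset.mem_insert.1 hQ with rfl | hQ'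
        · exact absurd rfl hPQ
        · exact hBQ Q hQ'
        · exact (hBQ P hP').symm
        · exact h1 P hP' Q hQ' hPQ
      · intro P hP
        rcases Finset.mem_insert.1 hP with rfl | hP'
        · exact hB.piece
        · exact hB.isPiece hG (h2 P hP')
      · intro v hv
        rcases (hB.union v).1 hv with hv' | hv'
        · exact ⟨B, Finset.mem_insert_self _ _, hv'⟩
        · obtain ⟨P, hP, hvP⟩ := h3 v hv'
          exact ⟨P, Finset.mem_insert_of_mem hP, hvP⟩

theorem IsCactus.facetSumExchange [Fintype V] {K : Type} [Field K] {d : ℕ} (hG : IsCactus G)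
    (hd : IsPureOfCard (indepCpx G) d) (hCM : IsCohenMacaulayQuot K (edgeIdeal K G)) :
    ∃ ρ, FacetSumExchange G ρ := by
  obtain ⟨𝒬, h1, h2, h3⟩ := hG.exists_pieces hd hCM Finset.univ ∅ (by simp [indepCpx])
    (fun v => by simp [IsLinkVertex])
  refine exists_facetSumExchange_of_pieces 𝒬 h1 (fun v => h3 v (Finset.mem_univ _)) ?_
  intro P hP
  rcases h2 P hP with ⟨f, h⟩ | ⟨x₁, x₂, x₃, x₄, h⟩ | ⟨v₁, v₂, v₃, v₄, v₅, h⟩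
  · exact ⟨_, IsSimplicialPiece.isExchangePiece hd h⟩
  · exact ⟨_, IsSquarePiece.isExchangePiece hd h⟩
  · obtain ⟨D, hD⟩ := h.exists_isPentagonSeparator hG
    exact ⟨_, IsPentagonPiece.isExchangePiece hd h hD⟩

end CactusExchange

theorem tfae_CM_vertexDecomposable_weaklyPolymatroidal
    (V : Type) [Fintype V] [DecidableEq V] (G : SimpleGraph V)
    (hclass : IsCactus G ∨ G.Colorable 2 ∨ IsChordal G)
    (hunmixed : IsUnmixed G) :
    List.TFAE
      [IsCohenMacaulayQuot K (edgeIdeal K G),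
       VertexDecomposable (indepCpx G),
       ∃ r : LinearOrder V, WeaklyPolymatroidalWrt K r.lt (coverIdeal K G),
       ∀ s : ℕ, 1 ≤ s →
         ∃ r : LinearOrder V, WeaklyPolymatroidalWrt K r.lt (coverIdeal K G ^ s)] := by
  obtain ⟨d, hd⟩ := hunmixed.exists_isPureOfCard
  tfae_have 1 → 4 := by
    intro hCM
    have hex : ∃ ρ, FacetSumExchange G ρ := by
      rcases hclass with h | h | h
      · exact h.facetSumExchange hd hCM
      · obtain ⟨Y, φ, ψ, hm⟩ := exists_isBipartiteMatching hd h
        exact hm.facetSumExchange hd hCM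
      · exact h.facetSumExchange hd
    obtain ⟨ρ, hρ⟩ := hex
    obtain ⟨r, hr⟩ := weaklyPolymatroidal_of_facetSumExchange (K := K) hd hρ
    exact fun s _ => ⟨r, hr s⟩
  tfae_have 4 → 3 := by
    intro h
    obtain ⟨r, hr⟩ := h 1 le_rfl
    exact ⟨r, by rwa [pow_one] at hr⟩
  tfae_have 3 → 2 := fun ⟨r, hr⟩ => vertexDecomposable_of_weaklyPolymatroidal hd r hr
  tfae_have 2 → 1 := isCohenMacaulayQuot_of_vertexDecomposable hd
  tfae_finish

end Stmt
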